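/- Suppose M' = ⟨Δ'<:Δ ⊢ M : A<:A'⟩ is the canonical type cast of a valid typing judgment Δ ⊢ M : A along Δ' <: Δ and A <: A'. Then ⟦Δ' ⊢ M' : A'⟧^c = I_{Δ',Δ} ; ⟦Δ ⊢ M : A⟧^c ; T(I_{A,A'}). If M = V is a value, then M' = V' is a value and ⟦Δ' ⊢ V' : A'⟧^v = I_{Δ',Δ} ; ⟦Δ ⊢ V : A⟧^v ; I_{A,A'}. -/

import Mathlib

/- The call-by-value linear lambda calculus of Selinger-Valiron, with Type-valued
   subtyping and typing derivations (used to define the categorical semantics). -/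

namespace QLamSem

/-- Types: A,B ::= α | A ⊸ B | A ⊗ B | ⊤ | !A -/
inductive Ty : Type where
  | tconst : ℕ → Ty
  | arrow : Ty → Ty → Ty
  | tensor : Ty → Ty → Ty
  | unit : Ty
  | bang : Ty → Ty
deriving DecidableEq

/-- `bangN n A` is `!ⁿA`. -/
def bangN : ℕ → Ty → Ty
  | 0, A => A
  | n + 1, A => Ty.bang (bangN n A)

/-- Derivations of the subtyping relation `A <: B`. -/
inductive SubD : Ty → Ty → Type where
  | tconst (n m a : ℕ) : (m = 0 ∨ 1 ≤ n) →
      SubD (bangN n (Ty.tconst a)) (bangN m (Ty.tconst a))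
  | unit (n m : ℕ) : (m = 0 ∨ 1 ≤ n) →
      SubD (bangN n Ty.unit) (bangN m Ty.unit)
  | arrow (n m : ℕ) (A A' B B' : Ty) : (m = 0 ∨ 1 ≤ n) → SubD A A' → SubD B B' →
      SubD (bangN n (Ty.arrow A' B)) (bangN m (Ty.arrow A B'))
  | tensor (n m : ℕ) (A A' B B' : Ty) : (m = 0 ∨ 1 ≤ n) → SubD A A' → SubD B B' →
      SubD (bangN n (Ty.tensor A B)) (bangN m (Ty.tensor A' B'))

/-- The subtyping relation `A <: B`. -/
def Sub (A B : Ty) : Prop := Nonempty (SubD A B)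

/-- Indexed terms (with the `let` forms as primitive constructs). -/
inductive Tm : Type where
  | var : ℕ → Ty → Tm
  | cst : ℕ → Ty → Tm
  | star : ℕ → Tm
  | lam : ℕ → ℕ → Ty → Tm → Tm
  | app : Tm → Tm → Tm
  | pair : ℕ → Tm → Tm → Tm
  | letv : ℕ → Ty → Tm → Tm → Tm
  | letPair : ℕ → ℕ → Ty → ℕ → Ty → Tm → Tm → Tm
  | letUnit : Tm → Tm → Tm
deriving DecidableEq

/-- The values among the terms. -/
def isValue : Tm → Bool
  | .var _ _ => true
  | .cst _ _ => true
  | .star _ => true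
  | .lam _ _ _ _ => true
  | .app _ _ => false
  | .pair _ V W => isValue V && isValue W
  | .letv _ _ V W => isValue V && isValue W
  | .letPair _ _ _ _ _ V W => isValue V && isValue W
  | .letUnit V W => isValue V && isValue W

/-- Untyped (pure) terms. -/
inductive PTm : Type where
  | var : ℕ → PTm
  | cst : ℕ → PTm
  | star : PTm
  | lam : ℕ → PTm → PTm
  | app : PTm → PTm → PTm
  | pair : PTm → PTm → PTm
  | letv : ℕ → PTm → PTm → PTm
  | letPair : ℕ → ℕ → PTm → PTm → PTm
  | letUnit : PTm → PTm → PTm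
deriving DecidableEq

/-- The erasure operation, deleting all type and integer annotations. -/
def erase : Tm → PTm
  | .var x _ => .var x
  | .cst c _ => .cst c
  | .star _ => .star
  | .lam _ x _ M => .lam x (erase M)
  | .app M N => .app (erase M) (erase N)
  | .pair _ M N => .pair (erase M) (erase N)
  | .letv x _ M N => .letv x (erase M) (erase N)
  | .letPair _ x _ y _ M N => .letPair x y (erase M) (erase N)
  | .letUnit M N => .letUnit (erase M) (erase N)

/-- `FreeAt x A M` : the term `M` has a free instance `x^A` of the variable `x`. -/
inductive FreeAt (x : ℕ) : Ty → Tm → Prop where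
  | var (A : Ty) : FreeAt x A (.var x A)
  | lam {A : Ty} {M : Tm} (n y : ℕ) (B : Ty) : y ≠ x → FreeAt x A M →
      FreeAt x A (.lam n y B M)
  | appL {A : Ty} {M : Tm} (N : Tm) : FreeAt x A M → FreeAt x A (.app M N)
  | appR {A : Ty} {N : Tm} (M : Tm) : FreeAt x A N → FreeAt x A (.app M N)
  | pairL {A : Ty} {M : Tm} (n : ℕ) (N : Tm) : FreeAt x A M → FreeAt x A (.pair n M N)
  | pairR {A : Ty} {N : Tm} (n : ℕ) (M : Tm) : FreeAt x A N → FreeAt x A (.pair n M N)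
  | letvL {A : Ty} {M : Tm} (y : ℕ) (B : Ty) (N : Tm) : FreeAt x A M →
      FreeAt x A (.letv y B M N)
  | letvR {A : Ty} {N : Tm} (y : ℕ) (B : Ty) (M : Tm) : y ≠ x → FreeAt x A N →
      FreeAt x A (.letv y B M N)
  | letPairL {A : Ty} {M : Tm} (n y : ℕ) (B : Ty) (z : ℕ) (C : Ty) (N : Tm) :
      FreeAt x A M → FreeAt x A (.letPair n y B z C M N)
  | letPairR {A : Ty} {N : Tm} (n y : ℕ) (B : Ty) (z : ℕ) (C : Ty) (M : Tm) :
      y ≠ x → z ≠ x → FreeAt x A N → FreeAt x A (.letPair n y B z C M N)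
  | letUnitL {A : Ty} {M : Tm} (N : Tm) : FreeAt x A M → FreeAt x A (.letUnit M N)
  | letUnitR {A : Ty} {N : Tm} (M : Tm) : FreeAt x A N → FreeAt x A (.letUnit M N)

/-- `x` occurs free in `M`. -/
def Free (x : ℕ) (M : Tm) : Prop := ∃ A, FreeAt x A M

/-- Substitution on untyped terms. -/
def psubst (x : ℕ) (V : PTm) : PTm → PTm
  | .var y => if y = x then V else .var y
  | .cst c => .cst c
  | .star => .star
  | .lam y M => if y = x then .lam y M else .lam y (psubst x V M)
  | .app M N => .app (psubst x V M) (psubst x V N)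
  | .pair M N => .pair (psubst x V M) (psubst x V N)
  | .letv y M N => .letv y (psubst x V M) (if y = x then N else psubst x V N)
  | .letPair y z M N =>
      .letPair y z (psubst x V M) (if y = x ∨ z = x then N else psubst x V N)
  | .letUnit M N => .letUnit (psubst x V M) (psubst x V N)

/-- Typing contexts as (ordered) lists of typed variables. -/
abbrev CtxL : Type := List (ℕ × Ty)

/-- The names of the variables of a context. -/
def names (Γ : CtxL) : List ℕ := Γ.map Prod.fst

/-- `!Δ`: the context obtained from `Δ` by prefixing every type with `!`. -/
def bangify (Δ : CtxL) : CtxL := Δ.map (fun p => (p.1, Ty.bang p.2))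

/-- Typing derivations for the rules of Table 1.  Contexts are treated as lists with
an explicit exchange rule `swap`.  The parameter `cty` assigns to each constant `c`
the type `A_c` (the type assigned to `c` being `!A_c`). -/
inductive TypingD (cty : ℕ → Ty) : CtxL → Tm → Ty → Type where
  | swap {Γ₁ Γ₂ : CtxL} {p q : ℕ × Ty} {M : Tm} {A : Ty} :
      TypingD cty (Γ₁ ++ p :: q :: Γ₂) M A →
      TypingD cty (Γ₁ ++ q :: p :: Γ₂) M A
  | var {Δ : CtxL} {x : ℕ} {A B : Ty} :
      x ∉ names Δ → SubD A B →
      TypingD cty (bangify Δ ++ [(x, A)]) (.var x B) B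
  | cst {Δ : CtxL} {c : ℕ} {B : Ty} :
      SubD (.bang (cty c)) B →
      TypingD cty (bangify Δ) (.cst c B) B
  | star {Δ : CtxL} {n : ℕ} :
      TypingD cty (bangify Δ) (.star n) (bangN n .unit)
  | lam0 {Δ : CtxL} {x : ℕ} {A : Ty} {M : Tm} {B : Ty} :
      x ∉ names Δ → TypingD cty (Δ ++ [(x, A)]) M B →
      TypingD cty Δ (.lam 0 x A M) (.arrow A B)
  | lamS {Δ : CtxL} {n x : ℕ} {A : Ty} {M : Tm} {B : Ty} :
      x ∉ names Δ → TypingD cty (bangify Δ ++ [(x, A)]) M B →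
      TypingD cty (bangify Δ) (.lam (n + 1) x A M) (bangN (n + 1) (.arrow A B))
  | app {Δ Γ₁ Γ₂ : CtxL} {M N : Tm} {A B : Ty} :
      (names (bangify Δ ++ Γ₁ ++ Γ₂)).Nodup →
      TypingD cty (bangify Δ ++ Γ₁) M (.arrow A B) →
      TypingD cty (bangify Δ ++ Γ₂) N A →
      TypingD cty (bangify Δ ++ Γ₁ ++ Γ₂) (.app M N) B
  | pair {Δ Γ₁ Γ₂ : CtxL} {n : ℕ} {M₁ M₂ : Tm} {A₁ A₂ : Ty} :
      (names (bangify Δ ++ Γ₁ ++ Γ₂)).Nodup →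
      TypingD cty (bangify Δ ++ Γ₁) M₁ (bangN n A₁) →
      TypingD cty (bangify Δ ++ Γ₂) M₂ (bangN n A₂) →
      TypingD cty (bangify Δ ++ Γ₁ ++ Γ₂) (.pair n M₁ M₂) (bangN n (.tensor A₁ A₂))
  | letv {Δ Γ₁ Γ₂ : CtxL} {x : ℕ} {A : Ty} {M N : Tm} {B : Ty} :
      (names (bangify Δ ++ Γ₁ ++ Γ₂)).Nodup →
      x ∉ names (bangify Δ ++ Γ₁ ++ Γ₂) →
      TypingD cty (bangify Δ ++ Γ₁) M A →
      TypingD cty ((bangify Δ ++ Γ₂) ++ [(x, A)]) N B →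
      TypingD cty (bangify Δ ++ Γ₁ ++ Γ₂) (.letv x A M N) B
  | letUnit {Δ Γ₁ Γ₂ : CtxL} {M N : Tm} {A : Ty} :
      (names (bangify Δ ++ Γ₁ ++ Γ₂)).Nodup →
      TypingD cty (bangify Δ ++ Γ₁) M .unit →
      TypingD cty (bangify Δ ++ Γ₂) N A →
      TypingD cty (bangify Δ ++ Γ₁ ++ Γ₂) (.letUnit M N) A
  | letPair {Δ Γ₁ Γ₂ : CtxL} {n x₁ : ℕ} {A₁ : Ty} {x₂ : ℕ} {A₂ : Ty} {M N : Tm} {A : Ty} :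
      (names (bangify Δ ++ Γ₁ ++ Γ₂)).Nodup →
      x₁ ≠ x₂ →
      x₁ ∉ names (bangify Δ ++ Γ₁ ++ Γ₂) →
      x₂ ∉ names (bangify Δ ++ Γ₁ ++ Γ₂) →
      TypingD cty (bangify Δ ++ Γ₁) M (bangN n (.tensor A₁ A₂)) →
      TypingD cty ((bangify Δ ++ Γ₂) ++ [(x₁, bangN n A₁), (x₂, bangN n A₂)]) N A →
      TypingD cty (bangify Δ ++ Γ₁ ++ Γ₂) (.letPair n x₁ A₁ x₂ A₂ M N) A

/-- Validity of a typing judgment. -/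
def Typ (cty : ℕ → Ty) (Γ : CtxL) (M : Tm) (A : Ty) : Prop :=
  Nonempty (TypingD cty Γ M A)

end QLamSem

namespace QLamSem

/-- The data of a linear category for duplication: a symmetric monoidal category,
an idempotent strongly monoidal linear exponential comonad `(L,δ,ε,m₂,m₀,△,◇)`,
a strong monad `(T,η,μ,t)`, and Kleisli exponentials `⊸` with `Φ`. -/
structure LCDData : Type 1 where
  Obj : Type
  Hom : Obj → Obj → Type
  id : ∀ A, Hom A A
  comp : ∀ {A B C}, Hom A B → Hom B C → Hom A C
  tens : Obj → Obj → Obj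
  unit : Obj
  tmap : ∀ {A B X Y}, Hom A B → Hom X Y → Hom (tens A X) (tens B Y)
  assoc : ∀ A B X, Hom (tens (tens A B) X) (tens A (tens B X))
  assocInv : ∀ A B X, Hom (tens A (tens B X)) (tens (tens A B) X)
  lunit : ∀ A, Hom (tens unit A) A
  lunitInv : ∀ A, Hom A (tens unit A)
  runit : ∀ A, Hom (tens A unit) A
  runitInv : ∀ A, Hom A (tens A unit)
  symm : ∀ A B, Hom (tens A B) (tens B A)
  L : Obj → Obj
  Lmap : ∀ {A B}, Hom A B → Hom (L A) (L B)
  eps : ∀ A, Hom (L A) A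
  delta : ∀ A, Hom (L A) (L (L A))
  deltaInv : ∀ A, Hom (L (L A)) (L A)
  m2 : ∀ A B, Hom (tens (L A) (L B)) (L (tens A B))
  m2Inv : ∀ A B, Hom (L (tens A B)) (tens (L A) (L B))
  m0 : Hom unit (L unit)
  m0Inv : Hom (L unit) unit
  dup : ∀ A, Hom (L A) (tens (L A) (L A))
  disc : ∀ A, Hom (L A) unit
  T : Obj → Obj
  Tmap : ∀ {A B}, Hom A B → Hom (T A) (T B)
  eta : ∀ A, Hom A (T A)
  mu : ∀ A, Hom (T (T A)) (T A)
  str : ∀ A B, Hom (tens A (T B)) (T (tens A B))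
  lolli : Obj → Obj → Obj
  lolliL : ∀ {A' A} (_ : Hom A' A) (B : Obj), Hom (lolli A B) (lolli A' B)
  lolliR : ∀ (A : Obj) {B B'} (_ : Hom B B'), Hom (lolli A B) (lolli A B')
  Phi : ∀ {X A B}, Hom X (lolli A B) → Hom (tens X A) (T B)
  PhiInv : ∀ {X A B}, Hom (tens X A) (T B) → Hom X (lolli A B)

namespace LCDData

variable (D : LCDData)

/-- Kleisli lifting `f* = T f ; μ`. -/
def klift {A B : D.Obj} (f : D.Hom A (D.T B)) : D.Hom (D.T A) (D.T B) :=
  D.comp (D.Tmap f) (D.mu B)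

/-- `Ψ₁ : TA ⊗ TB → T(A ⊗ B)` (first component first). -/
def Psi1 (A B : D.Obj) : D.Hom (D.tens (D.T A) (D.T B)) (D.T (D.tens A B)) :=
  D.comp (D.symm (D.T A) (D.T B))
    (D.comp (D.str (D.T B) A)
      (D.klift (D.comp (D.symm (D.T B) A) (D.str A B))))

/-- The evaluation map `(A ⊸ B) ⊗ A → T B` induced by `Φ`. -/
def appnt (A B : D.Obj) : D.Hom (D.tens (D.lolli A B) A) (D.T B) :=
  D.Phi (D.id (D.lolli A B))

/-- Transport of homs along equalities of objects. -/
def castHom {A A' B B' : D.Obj} (h₁ : A = A') (h₂ : B = B') (f : D.Hom A B) :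
    D.Hom A' B' := h₁ ▸ h₂ ▸ f

end LCDData

/-- The laws of a linear category for duplication (Definition of linear category for
duplication: symmetric monoidal category, idempotent strongly monoidal linear
exponential comonad, strong monad, Kleisli exponentials). -/
structure LCDLaws (D : LCDData) : Prop where
  /- category -/
  id_comp : ∀ {A B} (f : D.Hom A B), D.comp (D.id A) f = f
  comp_id : ∀ {A B} (f : D.Hom A B), D.comp f (D.id B) = f
  comp_assoc : ∀ {A B C E} (f : D.Hom A B) (g : D.Hom B C) (h : D.Hom C E),
    D.comp (D.comp f g) h = D.comp f (D.comp g h)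
  /- monoidal structure -/
  tmap_id : ∀ A B, D.tmap (D.id A) (D.id B) = D.id (D.tens A B)
  tmap_comp : ∀ {A B C X Y Z} (f : D.Hom A B) (g : D.Hom B C)
    (h : D.Hom X Y) (k : D.Hom Y Z),
    D.tmap (D.comp f g) (D.comp h k) = D.comp (D.tmap f h) (D.tmap g k)
  assoc_iso₁ : ∀ A B X, D.comp (D.assoc A B X) (D.assocInv A B X) = D.id _
  assoc_iso₂ : ∀ A B X, D.comp (D.assocInv A B X) (D.assoc A B X) = D.id _
  assoc_natural : ∀ {A A' B B' X X'} (f : D.Hom A A') (g : D.Hom B B') (h : D.Hom X X'),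
    D.comp (D.tmap (D.tmap f g) h) (D.assoc A' B' X')
      = D.comp (D.assoc A B X) (D.tmap f (D.tmap g h))
  lunit_iso₁ : ∀ A, D.comp (D.lunit A) (D.lunitInv A) = D.id _
  lunit_iso₂ : ∀ A, D.comp (D.lunitInv A) (D.lunit A) = D.id _
  lunit_natural : ∀ {A A'} (f : D.Hom A A'),
    D.comp (D.tmap (D.id D.unit) f) (D.lunit A') = D.comp (D.lunit A) f
  runit_iso₁ : ∀ A, D.comp (D.runit A) (D.runitInv A) = D.id _
  runit_iso₂ : ∀ A, D.comp (D.runitInv A) (D.runit A) = D.id _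
  runit_natural : ∀ {A A'} (f : D.Hom A A'),
    D.comp (D.tmap f (D.id D.unit)) (D.runit A') = D.comp (D.runit A) f
  pentagon : ∀ A B X Y,
    D.comp (D.assoc (D.tens A B) X Y) (D.assoc A B (D.tens X Y))
      = D.comp (D.tmap (D.assoc A B X) (D.id Y))
          (D.comp (D.assoc A (D.tens B X) Y) (D.tmap (D.id A) (D.assoc B X Y)))
  triangle : ∀ A B,
    D.comp (D.assoc A D.unit B) (D.tmap (D.id A) (D.lunit B))
      = D.tmap (D.runit A) (D.id B)
  symm_natural : ∀ {A A' B B'} (f : D.Hom A A') (g : D.Hom B B'),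
    D.comp (D.tmap f g) (D.symm A' B') = D.comp (D.symm A B) (D.tmap g f)
  symm_symm : ∀ A B, D.comp (D.symm A B) (D.symm B A) = D.id _
  hexagon : ∀ A B X,
    D.comp (D.assoc A B X) (D.comp (D.symm A (D.tens B X)) (D.assoc B X A))
      = D.comp (D.tmap (D.symm A B) (D.id X))
          (D.comp (D.assoc B A X) (D.tmap (D.id B) (D.symm A X)))
  /- the comonad L -/
  Lmap_id : ∀ A, D.Lmap (D.id A) = D.id (D.L A)
  Lmap_comp : ∀ {A B C} (f : D.Hom A B) (g : D.Hom B C),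
    D.Lmap (D.comp f g) = D.comp (D.Lmap f) (D.Lmap g)
  eps_natural : ∀ {A B} (f : D.Hom A B),
    D.comp (D.Lmap f) (D.eps B) = D.comp (D.eps A) f
  delta_natural : ∀ {A B} (f : D.Hom A B),
    D.comp (D.Lmap f) (D.delta B) = D.comp (D.delta A) (D.Lmap (D.Lmap f))
  delta_assoc : ∀ A, D.comp (D.delta A) (D.delta (D.L A))
    = D.comp (D.delta A) (D.Lmap (D.delta A))
  delta_counit_left : ∀ A, D.comp (D.delta A) (D.eps (D.L A)) = D.id (D.L A)
  delta_counit_right : ∀ A, D.comp (D.delta A) (D.Lmap (D.eps A)) = D.id (D.L A)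
  /- idempotency -/
  delta_iso₁ : ∀ A, D.comp (D.delta A) (D.deltaInv A) = D.id _
  delta_iso₂ : ∀ A, D.comp (D.deltaInv A) (D.delta A) = D.id _
  /- monoidality of L (strong monoidal comonad) -/
  m2_natural : ∀ {A A' B B'} (f : D.Hom A A') (g : D.Hom B B'),
    D.comp (D.tmap (D.Lmap f) (D.Lmap g)) (D.m2 A' B')
      = D.comp (D.m2 A B) (D.Lmap (D.tmap f g))
  m2_iso₁ : ∀ A B, D.comp (D.m2 A B) (D.m2Inv A B) = D.id _
  m2_iso₂ : ∀ A B, D.comp (D.m2Inv A B) (D.m2 A B) = D.id _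
  m0_iso₁ : D.comp D.m0 D.m0Inv = D.id _
  m0_iso₂ : D.comp D.m0Inv D.m0 = D.id _
  m2_assoc : ∀ A B X,
    D.comp (D.tmap (D.m2 A B) (D.id (D.L X)))
      (D.comp (D.m2 (D.tens A B) X) (D.Lmap (D.assoc A B X)))
    = D.comp (D.assoc (D.L A) (D.L B) (D.L X))
        (D.comp (D.tmap (D.id (D.L A)) (D.m2 B X)) (D.m2 A (D.tens B X)))
  m2_left_unit : ∀ B,
    D.comp (D.tmap D.m0 (D.id (D.L B))) (D.comp (D.m2 D.unit B) (D.Lmap (D.lunit B)))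
      = D.lunit (D.L B)
  m2_right_unit : ∀ A,
    D.comp (D.tmap (D.id (D.L A)) D.m0) (D.comp (D.m2 A D.unit) (D.Lmap (D.runit A)))
      = D.runit (D.L A)
  eps_monoidal : ∀ A B,
    D.comp (D.m2 A B) (D.eps (D.tens A B)) = D.tmap (D.eps A) (D.eps B)
  eps_monoidal_unit : D.comp D.m0 (D.eps D.unit) = D.id D.unit
  delta_monoidal : ∀ A B,
    D.comp (D.m2 A B) (D.delta (D.tens A B))
      = D.comp (D.tmap (D.delta A) (D.delta B))
          (D.comp (D.m2 (D.L A) (D.L B)) (D.Lmap (D.m2 A B)))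
  delta_monoidal_unit : D.comp D.m0 (D.delta D.unit) = D.comp D.m0 (D.Lmap D.m0)
  /- each LA is a commutative comonoid (LA, △, ◇) -/
  dup_natural : ∀ {A B} (f : D.Hom A B),
    D.comp (D.Lmap f) (D.dup B) = D.comp (D.dup A) (D.tmap (D.Lmap f) (D.Lmap f))
  disc_natural : ∀ {A B} (f : D.Hom A B),
    D.comp (D.Lmap f) (D.disc B) = D.disc A
  dup_comm : ∀ A, D.comp (D.dup A) (D.symm (D.L A) (D.L A)) = D.dup A
  dup_assoc : ∀ A,
    D.comp (D.dup A) (D.comp (D.tmap (D.dup A) (D.id (D.L A)))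
      (D.assoc (D.L A) (D.L A) (D.L A)))
    = D.comp (D.dup A) (D.tmap (D.id (D.L A)) (D.dup A))
  dup_counit_left : ∀ A,
    D.comp (D.dup A) (D.comp (D.tmap (D.disc A) (D.id (D.L A))) (D.lunit (D.L A)))
      = D.id (D.L A)
  dup_counit_right : ∀ A,
    D.comp (D.dup A) (D.comp (D.tmap (D.id (D.L A)) (D.disc A)) (D.runit (D.L A)))
      = D.id (D.L A)
  /- △ and ◇ are monoidal natural transformations (Table 3, first group) -/
  dup_monoidal : ∀ A B,
    D.comp (D.m2 A B) (D.dup (D.tens A B))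
      = D.comp (D.tmap (D.dup A) (D.dup B))
          (D.comp (D.comp (D.assoc (D.L A) (D.L A) (D.tens (D.L B) (D.L B)))
              (D.comp (D.tmap (D.id (D.L A)) (D.comp
                  (D.assocInv (D.L A) (D.L B) (D.L B))
                  (D.comp (D.tmap (D.symm (D.L A) (D.L B)) (D.id (D.L B)))
                    (D.assoc (D.L B) (D.L A) (D.L B)))))
                (D.assocInv (D.L A) (D.L B) (D.tens (D.L A) (D.L B)))))
            (D.tmap (D.m2 A B) (D.m2 A B)))
  dup_monoidal_unit :
    D.comp D.m0 (D.dup D.unit) = D.comp (D.lunitInv D.unit) (D.tmap D.m0 D.m0)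
  disc_monoidal : ∀ A B,
    D.comp (D.m2 A B) (D.disc (D.tens A B))
      = D.comp (D.tmap (D.disc A) (D.disc B)) (D.lunit D.unit)
  disc_monoidal_unit : D.comp D.m0 (D.disc D.unit) = D.id D.unit
  /- △ and ◇ are L-coalgebra morphisms (Table 3, second group) -/
  dup_coalgebra : ∀ A,
    D.comp (D.delta A) (D.Lmap (D.dup A))
      = D.comp (D.dup A) (D.comp (D.tmap (D.delta A) (D.delta A)) (D.m2 (D.L A) (D.L A)))
  disc_coalgebra : ∀ A,
    D.comp (D.delta A) (D.Lmap (D.disc A)) = D.comp (D.disc A) D.m0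
  /- δ is a comonoid morphism (Table 3, third group) -/
  delta_comonoid_dup : ∀ A,
    D.comp (D.delta A) (D.dup (D.L A)) = D.comp (D.dup A) (D.tmap (D.delta A) (D.delta A))
  delta_comonoid_disc : ∀ A,
    D.comp (D.delta A) (D.disc (D.L A)) = D.disc A
  /- the monad T -/
  Tmap_id : ∀ A, D.Tmap (D.id A) = D.id (D.T A)
  Tmap_comp : ∀ {A B C} (f : D.Hom A B) (g : D.Hom B C),
    D.Tmap (D.comp f g) = D.comp (D.Tmap f) (D.Tmap g)
  eta_natural : ∀ {A B} (f : D.Hom A B),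
    D.comp f (D.eta B) = D.comp (D.eta A) (D.Tmap f)
  mu_natural : ∀ {A B} (f : D.Hom A B),
    D.comp (D.Tmap (D.Tmap f)) (D.mu B) = D.comp (D.mu A) (D.Tmap f)
  mu_assoc : ∀ A, D.comp (D.Tmap (D.mu A)) (D.mu A) = D.comp (D.mu (D.T A)) (D.mu A)
  mu_unit_left : ∀ A, D.comp (D.eta (D.T A)) (D.mu A) = D.id (D.T A)
  mu_unit_right : ∀ A, D.comp (D.Tmap (D.eta A)) (D.mu A) = D.id (D.T A)
  /- tensorial strength -/
  str_natural : ∀ {A A' B B'} (f : D.Hom A A') (g : D.Hom B B'),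
    D.comp (D.tmap f (D.Tmap g)) (D.str A' B') = D.comp (D.str A B) (D.Tmap (D.tmap f g))
  str_lunit : ∀ B,
    D.comp (D.str D.unit B) (D.Tmap (D.lunit B)) = D.lunit (D.T B)
  str_assoc : ∀ A B X,
    D.comp (D.assoc A B (D.T X)) (D.comp (D.tmap (D.id A) (D.str B X)) (D.str A (D.tens B X)))
      = D.comp (D.str (D.tens A B) X) (D.Tmap (D.assoc A B X))
  str_eta : ∀ A B, D.comp (D.tmap (D.id A) (D.eta B)) (D.str A B) = D.eta (D.tens A B)
  str_mu : ∀ A B,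
    D.comp (D.tmap (D.id A) (D.mu B)) (D.str A B)
      = D.comp (D.str A (D.T B)) (D.comp (D.Tmap (D.str A B)) (D.mu (D.tens A B)))
  /- Kleisli exponentials -/
  lolliL_id : ∀ A B, D.lolliL (D.id A) B = D.id (D.lolli A B)
  lolliR_id : ∀ A B, D.lolliR A (D.id B) = D.id (D.lolli A B)
  lolliL_comp : ∀ {A'' A' A} (f : D.Hom A'' A') (g : D.Hom A' A) (B : D.Obj),
    D.lolliL (D.comp f g) B = D.comp (D.lolliL g B) (D.lolliL f B)
  lolliR_comp : ∀ (A : D.Obj) {B B' B''} (f : D.Hom B B') (g : D.Hom B' B''),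
    D.lolliR A (D.comp f g) = D.comp (D.lolliR A f) (D.lolliR A g)
  Phi_iso₁ : ∀ {X A B} (f : D.Hom X (D.lolli A B)), D.PhiInv (D.Phi f) = f
  Phi_iso₂ : ∀ {X A B} (g : D.Hom (D.tens X A) (D.T B)), D.Phi (D.PhiInv g) = g
  Phi_natural_left : ∀ {X' X A B} (f : D.Hom X' X) (g : D.Hom X (D.lolli A B)),
    D.Phi (D.comp f g) = D.comp (D.tmap f (D.id A)) (D.Phi g)
  Phi_natural_right : ∀ {X A B B'} (g : D.Hom X (D.lolli A B)) (h : D.Hom B B'),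
    D.Phi (D.comp g (D.lolliR A h)) = D.comp (D.Phi g) (D.Tmap h)
  Phi_natural_arg : ∀ {X A' A B} (f : D.Hom A' A) (g : D.Hom X (D.lolli A B)),
    D.Phi (D.comp g (D.lolliL f B)) = D.comp (D.tmap (D.id X) f) (D.Phi g)

end QLamSem

namespace QLamSem

variable (D : LCDData)

/-- `Ln n X = Lⁿ X`. -/
def Ln : ℕ → D.Obj → D.Obj
  | 0, X => X
  | n + 1, X => D.L (Ln n X)

/-- `Lⁿ` on morphisms. -/
def LnMap : ∀ (n : ℕ) {X Y : D.Obj}, D.Hom X Y → D.Hom (Ln D n X) (Ln D n Y)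
  | 0, _, _, f => f
  | n + 1, _, _, f => D.Lmap (LnMap n f)

/-- Iterated counit `Lⁿ X → X`. -/
def collapseL : ∀ (n : ℕ) (X : D.Obj), D.Hom (Ln D n X) X
  | 0, X => D.id X
  | n + 1, X => D.comp (D.eps (Ln D n X)) (collapseL n X)

/-- Iterated comultiplication `L X → Lᵐ⁺¹ X`. -/
def padL : ∀ (m : ℕ) (X : D.Obj), D.Hom (D.L X) (Ln D (m + 1) X)
  | 0, X => D.id (D.L X)
  | m + 1, X => D.comp (padL m X) (D.delta (Ln D m X))

/-- The canonical morphism `Lⁿ X → Lᵐ X` for `m = 0 ∨ 1 ≤ n`. -/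
def bangAdj : ∀ (n m : ℕ) (X : D.Obj), (m = 0 ∨ 1 ≤ n) → D.Hom (Ln D n X) (Ln D m X)
  | n, 0, X, _ => collapseL D n X
  | 0, m + 1, _, h => False.elim (by omega)
  | n + 1, m + 1, X, _ =>
      D.comp (D.Lmap (collapseL D n X)) (padL D m X)

/-- Iterated monoidality map `Lⁿ a ⊗ Lⁿ b → Lⁿ (a ⊗ b)`. -/
def m2n : ∀ (n : ℕ) (a b : D.Obj), D.Hom (D.tens (Ln D n a) (Ln D n b)) (Ln D n (D.tens a b))
  | 0, a, b => D.id (D.tens a b)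
  | n + 1, a, b => D.comp (D.m2 (Ln D n a) (Ln D n b)) (D.Lmap (m2n n a b))

/-- Inverse of `m2n`. -/
def m2nInv : ∀ (n : ℕ) (a b : D.Obj), D.Hom (Ln D n (D.tens a b)) (D.tens (Ln D n a) (Ln D n b))
  | 0, a, b => D.id (D.tens a b)
  | n + 1, a, b => D.comp (D.Lmap (m2nInv n a b)) (D.m2Inv (Ln D n a) (Ln D n b))

variable (Θ : ℕ → D.Obj)

/-- Interpretation of types. -/
def denTy : Ty → D.Obj
  | .tconst a => Θ a
  | .arrow A B => D.lolli (denTy A) (denTy B)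
  | .tensor A B => D.tens (denTy A) (denTy B)
  | .unit => D.unit
  | .bang A => D.L (denTy A)

theorem denTy_bangN (n : ℕ) (A : Ty) : denTy D Θ (bangN n A) = Ln D n (denTy D Θ A) := by
  induction n with
  | zero => rfl
  | succ n ih => simp [bangN, denTy, Ln, ih]

/-- The identity viewed along an equality of objects. -/
def eqHom {A B : D.Obj} (h : A = B) : D.Hom A B := h ▸ D.id A

/-- Interpretation of contexts: `⟦x₁:A₁,…,xₙ:Aₙ⟧ = ⟦A₁⟧ ⊗ (… ⊗ (⟦Aₙ⟧ ⊗ ⊤))`. -/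
def denCtx : CtxL → D.Obj
  | [] => D.unit
  | p :: Γ => D.tens (denTy D Θ p.2) (denCtx Γ)

/-- Splitting `⟦Γ₁ ++ Γ₂⟧ → ⟦Γ₁⟧ ⊗ ⟦Γ₂⟧`. -/
def splitCtx : ∀ (Γ₁ Γ₂ : CtxL), D.Hom (denCtx D Θ (Γ₁ ++ Γ₂)) (D.tens (denCtx D Θ Γ₁) (denCtx D Θ Γ₂))
  | [], Γ₂ => D.lunitInv (denCtx D Θ Γ₂)
  | p :: Γ₁, Γ₂ =>
      D.comp (D.tmap (D.id (denTy D Θ p.2)) (splitCtx Γ₁ Γ₂))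
        (D.assocInv (denTy D Θ p.2) (denCtx D Θ Γ₁) (denCtx D Θ Γ₂))

/-- Joining `⟦Γ₁⟧ ⊗ ⟦Γ₂⟧ → ⟦Γ₁ ++ Γ₂⟧`. -/
def joinCtx : ∀ (Γ₁ Γ₂ : CtxL), D.Hom (D.tens (denCtx D Θ Γ₁) (denCtx D Θ Γ₂)) (denCtx D Θ (Γ₁ ++ Γ₂))
  | [], Γ₂ => D.lunit (denCtx D Θ Γ₂)
  | p :: Γ₁, Γ₂ =>
      D.comp (D.assoc (denTy D Θ p.2) (denCtx D Θ Γ₁) (denCtx D Θ Γ₂))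
        (D.tmap (D.id (denTy D Θ p.2)) (joinCtx Γ₁ Γ₂))

/-- The middle-four interchange `(a⊗b)⊗(c⊗d) → (a⊗c)⊗(b⊗d)`. -/
def mid4 (a b c d : D.Obj) :
    D.Hom (D.tens (D.tens a b) (D.tens c d)) (D.tens (D.tens a c) (D.tens b d)) :=
  D.comp (D.assoc a b (D.tens c d))
    (D.comp (D.tmap (D.id a)
        (D.comp (D.assocInv b c d)
          (D.comp (D.tmap (D.symm b c) (D.id d)) (D.assoc c b d))))
      (D.assocInv a c (D.tens b d)))

/-- Duplication of a `!`-context, built from the comonoid comultiplications `△`. -/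
def dupCtx : ∀ (Δ : CtxL), D.Hom (denCtx D Θ (bangify Δ)) (D.tens (denCtx D Θ (bangify Δ)) (denCtx D Θ (bangify Δ)))
  | [] => D.lunitInv D.unit
  | p :: Δ =>
      D.comp (D.tmap (D.dup (denTy D Θ p.2)) (dupCtx Δ))
        (mid4 D (D.L (denTy D Θ p.2)) (D.L (denTy D Θ p.2))
          (denCtx D Θ (bangify Δ)) (denCtx D Θ (bangify Δ)))

/-- Discarding of a `!`-context, built from the comonoid counits `◇`. -/
def discCtx : ∀ (Δ : CtxL), D.Hom (denCtx D Θ (bangify Δ)) D.unit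
  | [] => D.id D.unit
  | p :: Δ => D.comp (D.tmap (D.disc (denTy D Θ p.2)) (discCtx Δ)) (D.lunit D.unit)

/-- Promotion of a `!`-context: `⟦!Δ⟧ → L ⟦!Δ⟧`, built from `δ` and `m₂`. -/
def promCtx : ∀ (Δ : CtxL), D.Hom (denCtx D Θ (bangify Δ)) (D.L (denCtx D Θ (bangify Δ)))
  | [] => D.m0
  | p :: Δ =>
      D.comp (D.tmap (D.delta (denTy D Θ p.2)) (promCtx Δ))
        (D.m2 (D.L (denTy D Θ p.2)) (denCtx D Θ (bangify Δ)))

/-- `Split_{!Δ,Γ₁,Γ₂} : ⟦!Δ,Γ₁,Γ₂⟧ → ⟦!Δ,Γ₁⟧ ⊗ ⟦!Δ,Γ₂⟧`, duplicating the `!Δ` part. -/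
def splitDup (Δ Γ₁ Γ₂ : CtxL) :
    D.Hom (denCtx D Θ (bangify Δ ++ Γ₁ ++ Γ₂))
      (D.tens (denCtx D Θ (bangify Δ ++ Γ₁)) (denCtx D Θ (bangify Δ ++ Γ₂))) :=
  D.comp (eqHom D (congrArg (denCtx D Θ) (List.append_assoc (bangify Δ) Γ₁ Γ₂)))
  <| D.comp (splitCtx D Θ (bangify Δ) (Γ₁ ++ Γ₂))
    (D.comp (D.tmap (dupCtx D Θ Δ) (splitCtx D Θ Γ₁ Γ₂))
      (D.comp (mid4 D (denCtx D Θ (bangify Δ)) (denCtx D Θ (bangify Δ))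
          (denCtx D Θ Γ₁) (denCtx D Θ Γ₂))
        (D.tmap (joinCtx D Θ (bangify Δ) Γ₁) (joinCtx D Θ (bangify Δ) Γ₂))))

/-- `⟦Γ⟧ ⊗ ⟦A⟧ → ⟦Γ, x:A⟧`. -/
def extHom (Γ : CtxL) (x : ℕ) (A : Ty) :
    D.Hom (D.tens (denCtx D Θ Γ) (denTy D Θ A)) (denCtx D Θ (Γ ++ [(x, A)])) :=
  D.comp (D.tmap (D.id (denCtx D Θ Γ)) (D.runitInv (denTy D Θ A)))
    (joinCtx D Θ Γ [(x, A)])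

/-- `⟦Γ⟧ ⊗ (⟦A₁⟧ ⊗ ⟦A₂⟧) → ⟦Γ, x₁:A₁, x₂:A₂⟧`. -/
def ext2Hom (Γ : CtxL) (x₁ : ℕ) (A₁ : Ty) (x₂ : ℕ) (A₂ : Ty) :
    D.Hom (D.tens (denCtx D Θ Γ) (D.tens (denTy D Θ A₁) (denTy D Θ A₂)))
      (denCtx D Θ (Γ ++ [(x₁, A₁), (x₂, A₂)])) :=
  D.comp (D.tmap (D.id (denCtx D Θ Γ))
      (D.tmap (D.id (denTy D Θ A₁)) (D.runitInv (denTy D Θ A₂))))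
    (joinCtx D Θ Γ [(x₁, A₁), (x₂, A₂)])

/-- The exchange morphism interpreting the `swap` rule. -/
def swapMor (Γ₁ : CtxL) (p q : ℕ × Ty) (Γ₂ : CtxL) :
    D.Hom (denCtx D Θ (Γ₁ ++ q :: p :: Γ₂)) (denCtx D Θ (Γ₁ ++ p :: q :: Γ₂)) :=
  D.comp (splitCtx D Θ Γ₁ (q :: p :: Γ₂))
    (D.comp (D.tmap (D.id (denCtx D Θ Γ₁))
        (D.comp (D.assocInv (denTy D Θ q.2) (denTy D Θ p.2) (denCtx D Θ Γ₂))
          (D.comp (D.tmap (D.symm (denTy D Θ q.2) (denTy D Θ p.2)) (D.id (denCtx D Θ Γ₂)))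
            (D.assoc (denTy D Θ p.2) (denTy D Θ q.2) (denCtx D Θ Γ₂)))))
      (joinCtx D Θ Γ₁ (p :: q :: Γ₂)))

/-- The canonical arrow `I_{A,B} : ⟦A⟧ → ⟦B⟧` interpreting a subtyping `A <: B`. -/
def Isub : ∀ {A B : Ty}, SubD A B → D.Hom (denTy D Θ A) (denTy D Θ B)
  | _, _, .tconst n m a h =>
      D.castHom (denTy_bangN D Θ n (Ty.tconst a)).symm (denTy_bangN D Θ m (Ty.tconst a)).symm
        (bangAdj D n m (denTy D Θ (Ty.tconst a)) h)
  | _, _, .unit n m h =>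
      D.castHom (denTy_bangN D Θ n Ty.unit).symm (denTy_bangN D Θ m Ty.unit).symm
        (bangAdj D n m (denTy D Θ Ty.unit) h)
  | _, _, .arrow n m A A' B B' h sA sB =>
      D.castHom (denTy_bangN D Θ n (Ty.arrow A' B)).symm
        (denTy_bangN D Θ m (Ty.arrow A B')).symm
        (D.comp (bangAdj D n m (denTy D Θ (Ty.arrow A' B)) h)
          (LnMap D m (D.comp (D.lolliL (Isub sA) (denTy D Θ B)) (D.lolliR (denTy D Θ A) (Isub sB)))))
  | _, _, .tensor n m A A' B B' h sA sB =>
      D.castHom (denTy_bangN D Θ n (Ty.tensor A B)).symm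
        (denTy_bangN D Θ m (Ty.tensor A' B')).symm
        (D.comp (bangAdj D n m (denTy D Θ (Ty.tensor A B)) h)
          (LnMap D m (D.tmap (Isub sA) (Isub sB))))

/-- `m2n` expressed on interpretations of types. -/
def m2nD (n : ℕ) (A B : Ty) :
    D.Hom (D.tens (denTy D Θ (bangN n A)) (denTy D Θ (bangN n B)))
      (denTy D Θ (bangN n (Ty.tensor A B))) :=
  D.castHom
    (show D.tens (Ln D n (denTy D Θ A)) (Ln D n (denTy D Θ B))
        = D.tens (denTy D Θ (bangN n A)) (denTy D Θ (bangN n B)) by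
      rw [denTy_bangN, denTy_bangN])
    (denTy_bangN D Θ n (Ty.tensor A B)).symm
    (m2n D n (denTy D Θ A) (denTy D Θ B))

/-- Inverse of `m2nD`. -/
def m2nDInv (n : ℕ) (A B : Ty) :
    D.Hom (denTy D Θ (bangN n (Ty.tensor A B)))
      (D.tens (denTy D Θ (bangN n A)) (denTy D Θ (bangN n B))) :=
  D.castHom (denTy_bangN D Θ n (Ty.tensor A B)).symm
    (show D.tens (Ln D n (denTy D Θ A)) (Ln D n (denTy D Θ B))
        = D.tens (denTy D Θ (bangN n A)) (denTy D Θ (bangN n B)) by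
      rw [denTy_bangN, denTy_bangN])
    (m2nInv D n (denTy D Θ A) (denTy D Θ B))

/-- `⊤ → ⟦!ⁿ⊤⟧`. -/
def starMap : ∀ n : ℕ, D.Hom D.unit (denTy D Θ (bangN n Ty.unit))
  | 0 => D.id D.unit
  | n + 1 =>
      D.comp D.m0 (D.castHom rfl (denTy_bangN D Θ (n + 1) Ty.unit).symm (padL D n D.unit))

/-- An interpretation `Θ` of the language: an object for each type constant and an
arrow `⊤ → ⟦!A_c⟧` for each constant `c` (whose assigned type is `!A_c`). -/
structure Interp (cty : ℕ → Ty) : Type where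
  obj : ℕ → D.Obj
  cst : ∀ c : ℕ, D.Hom D.unit (denTy D obj (Ty.bang (cty c)))

variable {D}
variable {cty : ℕ → Ty} (I : Interp D cty)

/-- The computational interpretation `⟦π⟧^c : ⟦Γ⟧ → T ⟦A⟧` of a typing derivation
`π` of `Γ ⊢ M : A` (Table 5). -/
def denC : ∀ {Γ : CtxL} {M : Tm} {A : Ty}, TypingD cty Γ M A →
    D.Hom (denCtx D I.obj Γ) (D.T (denTy D I.obj A))
  | _, _, _, .swap (Γ₁ := Γ₁) (Γ₂ := Γ₂) (p := p) (q := q) d =>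
      D.comp (swapMor D I.obj Γ₁ p q Γ₂) (denC d)
  | _, _, _, .var (Δ := Δ) (x := x) (A := A) _ s =>
      D.comp (splitCtx D I.obj (bangify Δ) [(x, A)])
        (D.comp (D.tmap (discCtx D I.obj Δ) (D.runit (denTy D I.obj A)))
          (D.comp (D.lunit (denTy D I.obj A))
            (D.comp (Isub D I.obj s) (D.eta _))))
  | _, _, _, .cst (Δ := Δ) (c := c) s =>
      D.comp (discCtx D I.obj Δ)
        (D.comp (I.cst c) (D.comp (Isub D I.obj s) (D.eta _)))
  | _, _, _, .star (Δ := Δ) (n := n) =>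
      D.comp (discCtx D I.obj Δ) (D.comp (starMap D I.obj n) (D.eta _))
  | _, _, _, .lam0 (Δ := Δ) (x := x) (A := A) _ d =>
      D.comp (D.PhiInv (D.comp (extHom D I.obj Δ x A) (denC d))) (D.eta _)
  | _, _, _, .lamS (Δ := Δ) (n := n) (x := x) (A := A) (B := B) _ d =>
      D.comp (promCtx D I.obj Δ)
        (D.comp (D.Lmap (D.PhiInv (D.comp (extHom D I.obj (bangify Δ) x A) (denC d))))
          (D.comp (D.castHom rfl (denTy_bangN D I.obj (n + 1) (Ty.arrow A B)).symm
              (padL D n (denTy D I.obj (Ty.arrow A B))))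
            (D.eta _)))
  | _, _, _, .app (Δ := Δ) (Γ₁ := Γ₁) (Γ₂ := Γ₂) (A := A) (B := B) _ d₁ d₂ =>
      D.comp (splitDup D I.obj Δ Γ₁ Γ₂)
        (D.comp (D.tmap (denC d₁) (denC d₂))
          (D.comp (D.Psi1 (denTy D I.obj (Ty.arrow A B)) (denTy D I.obj A))
            (D.klift (D.appnt (denTy D I.obj A) (denTy D I.obj B)))))
  | _, _, _, .pair (Δ := Δ) (Γ₁ := Γ₁) (Γ₂ := Γ₂) (n := n) (A₁ := A₁) (A₂ := A₂) _ d₁ d₂ =>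
      D.comp (splitDup D I.obj Δ Γ₁ Γ₂)
        (D.comp (D.tmap (denC d₁) (denC d₂))
          (D.comp (D.Psi1 (denTy D I.obj (bangN n A₁)) (denTy D I.obj (bangN n A₂)))
            (D.Tmap (m2nD D I.obj n A₁ A₂))))
  | _, _, _, .letv (Δ := Δ) (Γ₁ := Γ₁) (Γ₂ := Γ₂) (x := x) (A := A) _ _ d₁ d₂ =>
      D.comp (splitDup D I.obj Δ Γ₁ Γ₂)
        (D.comp (D.tmap (denC d₁) (D.id _))
          (D.comp (D.symm _ _)
            (D.comp (D.str (denCtx D I.obj (bangify Δ ++ Γ₂)) (denTy D I.obj A))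
              (D.comp (D.Tmap (extHom D I.obj (bangify Δ ++ Γ₂) x A))
                (D.klift (denC d₂))))))
  | _, _, _, .letUnit (Δ := Δ) (Γ₁ := Γ₁) (Γ₂ := Γ₂) _ d₁ d₂ =>
      D.comp (splitDup D I.obj Δ Γ₁ Γ₂)
        (D.comp (D.tmap (denC d₁) (D.id _))
          (D.comp (D.symm _ _)
            (D.comp (D.str (denCtx D I.obj (bangify Δ ++ Γ₂)) D.unit)
              (D.comp (D.Tmap (D.runit _)) (D.klift (denC d₂))))))
  | _, _, _, .letPair (Δ := Δ) (Γ₁ := Γ₁) (Γ₂ := Γ₂) (n := n) (x₁ := x₁) (A₁ := A₁)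
      (x₂ := x₂) (A₂ := A₂) _ _ _ _ d₁ d₂ =>
      D.comp (splitDup D I.obj Δ Γ₁ Γ₂)
        (D.comp (D.tmap (denC d₁) (D.id _))
          (D.comp (D.symm _ _)
            (D.comp (D.str (denCtx D I.obj (bangify Δ ++ Γ₂))
                (denTy D I.obj (bangN n (Ty.tensor A₁ A₂))))
              (D.comp (D.Tmap (D.comp (D.tmap (D.id _) (m2nDInv D I.obj n A₁ A₂))
                  (ext2Hom D I.obj (bangify Δ ++ Γ₂) x₁ (bangN n A₁) x₂ (bangN n A₂))))
                (D.klift (denC d₂))))))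

/-- The value interpretation `⟦π⟧^v : ⟦Γ⟧ → ⟦A⟧` of a typing derivation `π` of
`Γ ⊢ V : A` with `V` a value (Table 5). -/
def denV : ∀ {Γ : CtxL} {M : Tm} {A : Ty}, TypingD cty Γ M A → isValue M = true →
    D.Hom (denCtx D I.obj Γ) (denTy D I.obj A)
  | _, _, _, .swap (Γ₁ := Γ₁) (Γ₂ := Γ₂) (p := p) (q := q) d, h =>
      D.comp (swapMor D I.obj Γ₁ p q Γ₂) (denV d h)
  | _, _, _, .var (Δ := Δ) (x := x) (A := A) _ s, _ =>
      D.comp (splitCtx D I.obj (bangify Δ) [(x, A)])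
        (D.comp (D.tmap (discCtx D I.obj Δ) (D.runit (denTy D I.obj A)))
          (D.comp (D.lunit (denTy D I.obj A)) (Isub D I.obj s)))
  | _, _, _, .cst (Δ := Δ) (c := c) s, _ =>
      D.comp (discCtx D I.obj Δ) (D.comp (I.cst c) (Isub D I.obj s))
  | _, _, _, .star (Δ := Δ) (n := n), _ =>
      D.comp (discCtx D I.obj Δ) (starMap D I.obj n)
  | _, _, _, .lam0 (Δ := Δ) (x := x) (A := A) _ d, _ =>
      D.PhiInv (D.comp (extHom D I.obj Δ x A) (denC I d))
  | _, _, _, .lamS (Δ := Δ) (n := n) (x := x) (A := A) (B := B) _ d, _ =>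
      D.comp (promCtx D I.obj Δ)
        (D.comp (D.Lmap (D.PhiInv (D.comp (extHom D I.obj (bangify Δ) x A) (denC I d))))
          (D.castHom rfl (denTy_bangN D I.obj (n + 1) (Ty.arrow A B)).symm
            (padL D n (denTy D I.obj (Ty.arrow A B)))))
  | _, _, _, .app _ _ _, h => nomatch h
  | _, _, _, .pair (Δ := Δ) (Γ₁ := Γ₁) (Γ₂ := Γ₂) (n := n) (A₁ := A₁) (A₂ := A₂) _ d₁ d₂, h =>
      D.comp (splitDup D I.obj Δ Γ₁ Γ₂)
        (D.comp (D.tmap (denV d₁ (by simp [isValue] at h; exact h.1))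
            (denV d₂ (by simp [isValue] at h; exact h.2)))
          (m2nD D I.obj n A₁ A₂))
  | _, _, _, .letv (Δ := Δ) (Γ₁ := Γ₁) (Γ₂ := Γ₂) (x := x) (A := A) _ _ d₁ d₂, h =>
      D.comp (splitDup D I.obj Δ Γ₁ Γ₂)
        (D.comp (D.tmap (denV d₁ (by simp [isValue] at h; exact h.1)) (D.id _))
          (D.comp (D.symm _ _)
            (D.comp (extHom D I.obj (bangify Δ ++ Γ₂) x A)
              (denV d₂ (by simp [isValue] at h; exact h.2)))))
  | _, _, _, .letUnit (Δ := Δ) (Γ₁ := Γ₁) (Γ₂ := Γ₂) _ d₁ d₂, h =>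
      D.comp (splitDup D I.obj Δ Γ₁ Γ₂)
        (D.comp (D.tmap (denV d₁ (by simp [isValue] at h; exact h.1)) (D.id _))
          (D.comp (D.symm _ _)
            (D.comp (D.runit _) (denV d₂ (by simp [isValue] at h; exact h.2)))))
  | _, _, _, .letPair (Δ := Δ) (Γ₁ := Γ₁) (Γ₂ := Γ₂) (n := n) (x₁ := x₁) (A₁ := A₁)
      (x₂ := x₂) (A₂ := A₂) _ _ _ _ d₁ d₂, h =>
      D.comp (splitDup D I.obj Δ Γ₁ Γ₂)
        (D.comp (D.tmap (denV d₁ (by simp [isValue] at h; exact h.1)) (D.id _))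
          (D.comp (D.symm _ _)
            (D.comp (D.tmap (D.id _) (m2nDInv D I.obj n A₁ A₂))
              (D.comp (ext2Hom D I.obj (bangify Δ ++ Γ₂) x₁ (bangN n A₁) x₂ (bangN n A₂))
                (denV d₂ (by simp [isValue] at h; exact h.2))))))

end QLamSem

namespace QLamSem

/-- Derivations of pointwise subtyping of contexts with the same variables. -/
inductive SubCtxD : CtxL → CtxL → Type where
  | nil : SubCtxD [] []
  | cons (x : ℕ) {A' A : Ty} {Γ' Γ : CtxL} :
      SubD A' A → SubCtxD Γ' Γ → SubCtxD ((x, A') :: Γ') ((x, A) :: Γ)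

/-- The canonical arrow `I_{Δ',Δ} : ⟦Δ'⟧ → ⟦Δ⟧` interpreting a context subtyping. -/
def ICtx (D : LCDData) (Θ : ℕ → D.Obj) :
    ∀ {Γ' Γ : CtxL}, SubCtxD Γ' Γ → D.Hom (denCtx D Θ Γ') (denCtx D Θ Γ)
  | _, _, .nil => D.id D.unit
  | _, _, .cons _ s σ => D.tmap (Isub D Θ s) (ICtx D Θ σ)

attribute [reducible] Ln bangN denTy denCtx

section Coherence

open CategoryTheory MonoidalCategory BraidedCategory

variable {C : Type*} [Category C] [MonoidalCategory C] [SymmetricCategory C]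

/-- Exchange of the first two factors of a right-nested tensor product. -/
def swapFront (A B W : C) : A ⊗ (B ⊗ W) ⟶ B ⊗ (A ⊗ W) :=
  (α_ A B W).inv ≫ ((β_ A B).hom ▷ W) ≫ (α_ B A W).hom

theorem swapFront_natural {A A' B B' W W' : C} (f : A ⟶ A') (g : B ⟶ B') (h : W ⟶ W') :
    (f ⊗ₘ (g ⊗ₘ h)) ≫ swapFront A' B' W' = swapFront A B W ≫ (g ⊗ₘ (f ⊗ₘ h)) := by
  simp only [swapFront, associator_inv_naturality_assoc, Category.assoc,
    ← associator_naturality]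
  rw [← tensorHom_id, ← tensorHom_id, tensorHom_comp_tensorHom_assoc,
    tensorHom_comp_tensorHom_assoc]
  simp [BraidedCategory.braiding_naturality]

theorem swapFront_swapFront (A B W : C) : swapFront A B W ≫ swapFront B A W = 𝟙 _ := by
  simp [swapFront, ← comp_whiskerRight_assoc]

theorem swapFront_unit (A W : C) :
    swapFront A (𝟙_ C) W ≫ (λ_ _).hom = A ◁ (λ_ W).hom := by
  simp only [swapFront, braiding_tensorUnit_right]
  monoidal

theorem associator_braiding_swapFront (B W A : C) :
    (α_ B W A).hom ≫ (B ◁ (β_ W A).hom) ≫ swapFront B A W = (β_ (B ⊗ W) A).hom := by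
  simp [swapFront]

theorem swapFront_tensor (B A₁ A₂ W : C) :
    (B ◁ (α_ A₁ A₂ W).hom) ≫ swapFront B A₁ (A₂ ⊗ W) ≫ (A₁ ◁ swapFront B A₂ W) =
      swapFront B (A₁ ⊗ A₂) W ≫ (α_ A₁ A₂ (B ⊗ W)).hom := by
  simp only [swapFront, braiding_tensor_right_hom]
  monoidal

theorem swapFront_braid (A B E W : C) :
    swapFront A B (E ⊗ W) ≫ (B ◁ swapFront A E W) ≫ swapFront B E (A ⊗ W) =
      (A ◁ swapFront B E W) ≫ swapFront A E (B ⊗ W) ≫ (E ◁ swapFront A B W) := by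
  have h := congrArg (fun t : (A ⊗ B) ⊗ E ⟶ (E ⊗ B) ⊗ A => (A ◁ (α_ B E W).inv) ≫ (α_ A (B ⊗ E) W).inv ≫ ((α_ A B E).inv ▷ W) ≫ (t ▷ W) ≫
    (α_ (E ⊗ B) A W).hom ≫ (α_ E B (A ⊗ W)).hom) (yang_baxter' A B E)
  beta_reduce at h
  simp only [swapFront]
  refine Eq.trans ?_ (h.trans ?_)
  · monoidal
  · monoidal

theorem braiding_tensorμ (A₁ A₂ B₁ B₂ : C) :
    (β_ (A₁ ⊗ A₂) (B₁ ⊗ B₂)).hom ≫ tensorμ B₁ B₂ A₁ A₂ =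
      tensorμ A₁ A₂ B₁ B₂ ≫ ((β_ A₁ B₁).hom ⊗ₘ (β_ A₂ B₂).hom) := by
  have h : (β_ (A₁ ⊗ A₂) (B₁ ⊗ B₂)).hom = (tensorμ A₁ A₂ B₁ B₂ ≫
      ((β_ A₁ B₁).hom ⊗ₘ (β_ A₂ B₂).hom)) ≫ tensorμ B₁ A₁ B₂ A₂ := by
    simp only [braiding_tensor_right_hom, braiding_tensor_left_hom, tensorμ,
      MonoidalCategory.tensorHom_def]
    monoidal
  rw [h]
  have h' : tensorμ B₁ A₁ B₂ A₂ ≫ tensorμ B₁ B₂ A₁ A₂ = 𝟙 _ := by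
    have h₁ := SymmetricCategory.symmetry A₁ B₂
    have h₂ : ((β_ A₁ B₂).hom ▷ A₂) ≫ ((β_ B₂ A₁).hom ▷ A₂) = 𝟙 _ := by
      rw [← comp_whiskerRight, h₁, id_whiskerRight]
    simp only [tensorμ, Category.assoc, Iso.inv_hom_id_assoc]
    simp only [← whiskerLeft_comp_assoc, Iso.hom_inv_id_assoc, reassoc_of% h₂]
    simp
  rw [Category.assoc, h', Category.comp_id]

theorem swapFront_tensorμ (A₁ A₂ B₁ B₂ W₁ W₂ : C) :
    swapFront (A₁ ⊗ A₂) (B₁ ⊗ B₂) (W₁ ⊗ W₂) ≫ ((B₁ ⊗ B₂) ◁ tensorμ A₁ A₂ W₁ W₂) ≫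
        tensorμ B₁ B₂ (A₁ ⊗ W₁) (A₂ ⊗ W₂) =
      ((A₁ ⊗ A₂) ◁ tensorμ B₁ B₂ W₁ W₂) ≫ tensorμ A₁ A₂ (B₁ ⊗ W₁) (B₂ ⊗ W₂) ≫
        (swapFront A₁ B₁ W₁ ⊗ₘ swapFront A₂ B₂ W₂) := by
  have h1 := tensor_associativity B₁ B₂ A₁ A₂ W₁ W₂
  have h2 := tensor_associativity A₁ A₂ B₁ B₂ W₁ W₂
  have h2' : ((A₁ ⊗ A₂) ◁ tensorμ B₁ B₂ W₁ W₂) ≫ tensorμ A₁ A₂ (B₁ ⊗ W₁) (B₂ ⊗ W₂) ≫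
      ((α_ A₁ B₁ W₁).inv ⊗ₘ (α_ A₂ B₂ W₂).inv) =
      (α_ (A₁ ⊗ A₂) (B₁ ⊗ B₂) (W₁ ⊗ W₂)).inv ≫ (tensorμ A₁ A₂ B₁ B₂ ▷ (W₁ ⊗ W₂)) ≫
        tensorμ (A₁ ⊗ B₁) (A₂ ⊗ B₂) W₁ W₂ := by
    rw [Iso.eq_inv_comp, ← reassoc_of% h2]
    simp
  have h3 := braiding_tensorμ A₁ A₂ B₁ B₂
  have h4 : (swapFront A₁ B₁ W₁ ⊗ₘ swapFront A₂ B₂ W₂) =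
      ((α_ A₁ B₁ W₁).inv ⊗ₘ (α_ A₂ B₂ W₂).inv) ≫
        (((β_ A₁ B₁).hom ▷ W₁) ⊗ₘ ((β_ A₂ B₂).hom ▷ W₂)) ≫
        ((α_ B₁ A₁ W₁).hom ⊗ₘ (α_ B₂ A₂ W₂).hom) := by
    simp [swapFront, tensorHom_comp_tensorHom]
  have h5 := tensorμ_natural (β_ A₁ B₁).hom (β_ A₂ B₂).hom (𝟙 W₁) (𝟙 W₂)
  simp only [tensorHom_id, id_whiskerRight] at h5
  rw [h4, reassoc_of% h2', ← reassoc_of% h5]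
  simp only [swapFront, Category.assoc]
  rw [← h1]
  rw [← comp_whiskerRight_assoc, h3, comp_whiskerRight_assoc]

theorem tensorμ_runit (A X Y : C) :
    ((ρ_ A).inv ▷ (X ⊗ Y)) ≫ tensorμ A (𝟙_ C) X Y ≫ ((A ⊗ X) ◁ (λ_ Y).hom) =
      (α_ A X Y).inv := by
  simp only [tensorμ, braiding_tensorUnit_left]
  monoidal

end Coherence

local infixr:80 "▹" => LCDData.comp _
local infixr:85 "⊠" => LCDData.tmap _

namespace LCDLaws

variable {D : LCDData} (hD : LCDLaws D)
include hD

theorem reassoc {A B E F : D.Obj} {f : D.Hom A B} {g : D.Hom B E} {h : D.Hom A E}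
    (e : f ▹ g = h) (k : D.Hom E F) : f ▹ g ▹ k = h ▹ k := by
  rw [← hD.comp_assoc, e]

theorem reassoc_id {A B F : D.Obj} {f : D.Hom A B} {g : D.Hom B A}
    (e : f ▹ g = D.id A) (k : D.Hom A F) : f ▹ g ▹ k = k := by
  rw [← hD.comp_assoc, e, hD.id_comp]

theorem tmap_tmap {A B E X Y Z : D.Obj} (f : D.Hom A B) (g : D.Hom B E)
    (h : D.Hom X Y) (k : D.Hom Y Z) : (f ⊠ h) ▹ (g ⊠ k) = (f ▹ g) ⊠ (h ▹ k) :=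
  (hD.tmap_comp f g h k).symm

theorem tmap_tmap_assoc {A B E X Y Z F : D.Obj} (f : D.Hom A B) (g : D.Hom B E)
    (h : D.Hom X Y) (k : D.Hom Y Z) (r : D.Hom (D.tens E Z) F) :
    (f ⊠ h) ▹ (g ⊠ k) ▹ r = ((f ▹ g) ⊠ (h ▹ k)) ▹ r :=
  hD.reassoc (hD.tmap_tmap f g h k) r

theorem tmap_eq_comp {A B X Y : D.Obj} (f : D.Hom A B) (g : D.Hom X Y) :
    f ⊠ g = (f ⊠ D.id X) ▹ (D.id B ⊠ g) := by
  rw [hD.tmap_tmap, hD.comp_id, hD.id_comp]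

theorem hexagon_reverse (A B E : D.Obj) :
    D.assocInv A B E ▹ D.symm (D.tens A B) E ▹ D.assocInv E A B =
      (D.id A ⊠ D.symm B E) ▹ D.assocInv A E B ▹ (D.symm A E ⊠ D.id B) := by
  have h := hD.hexagon E A B
  have h₁ : (D.assocInv A B E ▹ D.symm (D.tens A B) E ▹ D.assocInv E A B) ▹
      (D.assoc E A B ▹ D.symm E (D.tens A B) ▹ D.assoc A B E) = D.id _ := by
    simp only [hD.comp_assoc, hD.reassoc_id (hD.assoc_iso₂ _ _ _),
      hD.reassoc_id (hD.symm_symm _ _), hD.assoc_iso₂]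
  have h₂ : ((D.symm E A ⊠ D.id B) ▹ D.assoc A E B ▹ (D.id A ⊠ D.symm E B)) ▹
      ((D.id A ⊠ D.symm B E) ▹ D.assocInv A E B ▹ (D.symm A E ⊠ D.id B)) = D.id _ := by
    simp only [hD.comp_assoc, hD.tmap_tmap_assoc, hD.id_comp, hD.symm_symm, hD.tmap_id,
      hD.reassoc_id (hD.assoc_iso₁ _ _ _), hD.tmap_tmap]
  rw [← hD.id_comp ((D.id A ⊠ D.symm B E) ▹ D.assocInv A E B ▹ (D.symm A E ⊠ D.id B)),
    ← h₁, h, hD.comp_assoc, h₂, hD.comp_id]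

end LCDLaws

/-- The objects of a linear category for duplication, as a type carrying the symmetric
monoidal structure in the sense of Mathlib. -/
def SymCat {D : LCDData} (_ : LCDLaws D) : Type := D.Obj

section SymCat

open CategoryTheory

variable {D : LCDData} (hD : LCDLaws D)

instance : Category.{0} (SymCat hD) where
  Hom A B := D.Hom A B
  id A := D.id A
  comp f g := D.comp f g
  id_comp := hD.id_comp
  comp_id := hD.comp_id
  assoc := hD.comp_assoc

instance : MonoidalCategory (SymCat hD) where
  tensorObj A B := D.tens A B
  whiskerLeft X _ _ f := D.tmap (D.id X) f
  whiskerRight f Y := D.tmap f (D.id Y)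
  tensorHom f g := D.tmap f g
  tensorUnit := D.unit
  associator A B E := ⟨D.assoc A B E, D.assocInv A B E, hD.assoc_iso₁ _ _ _, hD.assoc_iso₂ _ _ _⟩
  leftUnitor A := ⟨D.lunit A, D.lunitInv A, hD.lunit_iso₁ _, hD.lunit_iso₂ _⟩
  rightUnitor A := ⟨D.runit A, D.runitInv A, hD.runit_iso₁ _, hD.runit_iso₂ _⟩
  tensorHom_def f g := by
    exact hD.tmap_eq_comp f g
  id_tensorHom_id A B := hD.tmap_id A B
  tensorHom_comp_tensorHom f g h k := (hD.tmap_comp f h g k).symm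
  whiskerLeft_id A B := hD.tmap_id A B
  id_whiskerRight A B := hD.tmap_id A B
  associator_naturality f g h := hD.assoc_natural f g h
  leftUnitor_naturality f := hD.lunit_natural f
  rightUnitor_naturality f := hD.runit_natural f
  pentagon A B E F := (hD.pentagon A B E F).symm
  triangle A B := hD.triangle A B

instance : SymmetricCategory (SymCat hD) where
  braiding A B := ⟨D.symm A B, D.symm B A, hD.symm_symm A B, hD.symm_symm B A⟩
  braiding_naturality_left f X := hD.symm_natural f (D.id X)
  braiding_naturality_right X _ _ f := hD.symm_natural (D.id X) f
  hexagon_forward A B E := hD.hexagon A B E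
  hexagon_reverse A B E := hD.hexagon_reverse A B E
  symmetry A B := hD.symm_symm A B

end SymCat

/-- Exchange of the first two factors of a right-nested tensor product. -/
def LCDData.sw (D : LCDData) (A B W : D.Obj) :
    D.Hom (D.tens A (D.tens B W)) (D.tens B (D.tens A W)) :=
  D.assocInv A B W ▹ (D.symm A B ⊠ D.id W) ▹ D.assoc B A W

namespace LCDLaws

variable {D : LCDData} (hD : LCDLaws D)
include hD

theorem sw_natural {A A' B B' W W' : D.Obj} (f : D.Hom A A') (g : D.Hom B B') (h : D.Hom W W') :
    (f ⊠ g ⊠ h) ▹ D.sw A' B' W' = D.sw A B W ▹ (g ⊠ f ⊠ h) :=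
  swapFront_natural (C := SymCat hD) f g h

theorem sw_sw (A B W : D.Obj) : D.sw A B W ▹ D.sw B A W = D.id _ :=
  swapFront_swapFront (C := SymCat hD) A B W

theorem sw_unit (A W : D.Obj) : D.sw A D.unit W ▹ D.lunit _ = D.id A ⊠ D.lunit W :=
  swapFront_unit (C := SymCat hD) A W

theorem assoc_symm_sw (B W A : D.Obj) :
    D.assoc B W A ▹ (D.id B ⊠ D.symm W A) ▹ D.sw B A W = D.symm (D.tens B W) A :=
  associator_braiding_swapFront (C := SymCat hD) B W A

theorem sw_tens (B A₁ A₂ W : D.Obj) :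
    (D.id B ⊠ D.assoc A₁ A₂ W) ▹ D.sw B A₁ (D.tens A₂ W) ▹ (D.id A₁ ⊠ D.sw B A₂ W) =
      D.sw B (D.tens A₁ A₂) W ▹ D.assoc A₁ A₂ (D.tens B W) :=
  swapFront_tensor (C := SymCat hD) B A₁ A₂ W

theorem sw_braid (A B E W : D.Obj) :
    D.sw A B (D.tens E W) ▹ (D.id B ⊠ D.sw A E W) ▹ D.sw B E (D.tens A W) =
      (D.id A ⊠ D.sw B E W) ▹ D.sw A E (D.tens B W) ▹ (D.id E ⊠ D.sw A B W) :=
  swapFront_braid (C := SymCat hD) A B E W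

theorem mid4_eq_tensorμ (A B X Y : D.Obj) :
    mid4 D A B X Y = CategoryTheory.MonoidalCategory.tensorμ (C := SymCat hD) A B X Y := by
  have h : mid4 D A B X Y = D.assoc A B (D.tens X Y) ▹ (D.id A ⊠ D.assocInv B X Y) ▹
      (D.id A ⊠ D.symm B X ⊠ D.id Y) ▹ (D.id A ⊠ D.assoc X B Y) ▹
      D.assocInv A X (D.tens B Y) := by
    simp only [mid4, hD.tmap_tmap_assoc, hD.id_comp]
  exact h

theorem sw_mid4 (A₁ A₂ B₁ B₂ W₁ W₂ : D.Obj) :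
    D.sw (D.tens A₁ A₂) (D.tens B₁ B₂) (D.tens W₁ W₂) ▹
        (D.id (D.tens B₁ B₂) ⊠ mid4 D A₁ A₂ W₁ W₂) ▹
        mid4 D B₁ B₂ (D.tens A₁ W₁) (D.tens A₂ W₂) =
      (D.id (D.tens A₁ A₂) ⊠ mid4 D B₁ B₂ W₁ W₂) ▹
        mid4 D A₁ A₂ (D.tens B₁ W₁) (D.tens B₂ W₂) ▹ (D.sw A₁ B₁ W₁ ⊠ D.sw A₂ B₂ W₂) := by
  simp only [hD.mid4_eq_tensorμ]
  exact swapFront_tensorμ (C := SymCat hD) A₁ A₂ B₁ B₂ W₁ W₂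

theorem mid4_natural {A₁ A₂ B₁ B₂ A₁' A₂' B₁' B₂' : D.Obj} (f₁ : D.Hom A₁ A₁')
    (f₂ : D.Hom A₂ A₂') (g₁ : D.Hom B₁ B₁') (g₂ : D.Hom B₂ B₂') :
    ((f₁ ⊠ f₂) ⊠ (g₁ ⊠ g₂)) ▹ mid4 D A₁' A₂' B₁' B₂' =
      mid4 D A₁ A₂ B₁ B₂ ▹ ((f₁ ⊠ g₁) ⊠ (f₂ ⊠ g₂)) := by
  simp only [hD.mid4_eq_tensorμ]
  exact CategoryTheory.MonoidalCategory.tensorμ_natural (C := SymCat hD) f₁ f₂ g₁ g₂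

theorem mid4_lunit (X Y : D.Obj) :
    (D.lunitInv D.unit ⊠ D.id (D.tens X Y)) ▹ mid4 D D.unit D.unit X Y ▹
      (D.lunit X ⊠ D.lunit Y) = D.lunit (D.tens X Y) := by
  simp only [hD.mid4_eq_tensorμ]
  exact (CategoryTheory.MonoidalCategory.tensor_left_unitality (C := SymCat hD) X Y).symm

theorem mid4_runit (A X Y : D.Obj) :
    (D.runitInv A ⊠ D.id (D.tens X Y)) ▹ mid4 D A D.unit X Y ▹
      (D.id (D.tens A X) ⊠ D.lunit Y) = D.assocInv A X Y := by
  simp only [hD.mid4_eq_tensorμ]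
  exact tensorμ_runit (C := SymCat hD) A X Y

theorem lunitInv_unit : D.lunitInv D.unit = D.runitInv D.unit :=
  CategoryTheory.MonoidalCategory.unitors_inv_equal (C := SymCat hD)

theorem symm_runit (A : D.Obj) : D.symm D.unit A ▹ D.runit A = D.lunit A :=
  CategoryTheory.braiding_rightUnitor (C := SymCat hD) A

theorem assoc_lunit (A B : D.Obj) :
    D.assoc D.unit A B ▹ D.lunit (D.tens A B) = D.lunit A ⊠ D.id B :=
  (CategoryTheory.MonoidalCategory.leftUnitor_whiskerRight (C := SymCat hD) A B).symm

theorem lunit_tens (A : D.Obj) : D.lunit (D.tens D.unit A) = D.id D.unit ⊠ D.lunit A := by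
  rw [← hD.comp_id (D.lunit (D.tens D.unit A)), ← hD.lunit_iso₁, ← hD.comp_assoc,
    ← hD.lunit_natural, hD.comp_assoc, hD.lunit_iso₁, hD.comp_id]

end LCDLaws

/-- An object carrying an invertible `L`-coalgebra structure.  As `L` is idempotent, these are
exactly the `L`-coalgebras. -/
def Coalg (D : LCDData) (X : D.Obj) : Prop :=
  ∃ c : D.Hom X (D.L X), c ▹ D.eps X = D.id X ∧ D.eps X ▹ c = D.id (D.L X)

namespace LCDLaws

variable {D : LCDData} (hD : LCDLaws D)
include hD

theorem retraction_of_epi {A B : D.Obj} {c : D.Hom A B} {d e : D.Hom B A}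
    (h : c ▹ e = D.id A) (h' : d ▹ c = D.id B) : e = d := by
  rw [← hD.comp_id d, ← h, hD.reassoc_id h']

theorem eps_bang (A : D.Obj) : D.eps (D.L A) = D.Lmap (D.eps A) :=
  (hD.retraction_of_epi (hD.delta_counit_left A) (hD.delta_iso₂ A)).trans
    (hD.retraction_of_epi (hD.delta_counit_right A) (hD.delta_iso₂ A)).symm

theorem eps_unit : D.eps D.unit = D.disc D.unit :=
  (hD.retraction_of_epi hD.eps_monoidal_unit hD.m0_iso₂).trans
    (hD.retraction_of_epi hD.disc_monoidal_unit hD.m0_iso₂).symm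

theorem coalg_bang (A : D.Obj) : Coalg D (D.L A) :=
  ⟨D.delta A, hD.delta_counit_left A, by
    rw [hD.retraction_of_epi (hD.delta_counit_left A) (hD.delta_iso₂ A), hD.delta_iso₂]⟩

theorem coalg_unit : Coalg D D.unit :=
  ⟨D.m0, hD.eps_monoidal_unit, by
    rw [hD.retraction_of_epi hD.eps_monoidal_unit hD.m0_iso₂, hD.m0_iso₂]⟩

theorem coalg_tens {X Y : D.Obj} (hX : Coalg D X) (hY : Coalg D Y) : Coalg D (D.tens X Y) := by
  obtain ⟨c, hc, hc'⟩ := hX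
  obtain ⟨d, hd, hd'⟩ := hY
  have h : ((c ⊠ d) ▹ D.m2 X Y) ▹ D.eps _ = D.id _ := by
    rw [hD.comp_assoc, hD.eps_monoidal, hD.tmap_tmap, hc, hd, hD.tmap_id]
  have h' : (D.m2Inv X Y ▹ (D.eps X ⊠ D.eps Y)) ▹ (c ⊠ d) ▹ D.m2 X Y = D.id _ := by
    rw [hD.comp_assoc, hD.tmap_tmap_assoc, hc', hd', hD.tmap_id, hD.id_comp, hD.m2_iso₂]
  exact ⟨_, h, by rw [hD.retraction_of_epi h h', h']⟩

theorem coalg_lift {X A : D.Obj} (hX : Coalg D X) (h : D.Hom X A) :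
    ∃ g : D.Hom X (D.L A), g ▹ D.eps A = h := by
  obtain ⟨c, hc, -⟩ := hX
  exact ⟨c ▹ D.Lmap h, by rw [hD.comp_assoc, hD.eps_natural, hD.reassoc_id hc]⟩

theorem coalg_hom_eq {X A : D.Obj} {c : D.Hom X (D.L X)} (hc : c ▹ D.eps X = D.id X)
    (g : D.Hom X (D.L A)) : g = c ▹ D.Lmap (g ▹ D.eps A) := by
  rw [hD.Lmap_comp, ← hD.eps_bang, hD.eps_natural, hD.reassoc_id hc]

theorem coalg_hom_ext {X A : D.Obj} (hX : Coalg D X) {g g' : D.Hom X (D.L A)}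
    (h : g ▹ D.eps A = g' ▹ D.eps A) : g = g' := by
  obtain ⟨c, hc, -⟩ := hX
  rw [hD.coalg_hom_eq hc g, h, ← hD.coalg_hom_eq hc g']

theorem coalg_unit_ext {X : D.Obj} (hX : Coalg D X) (g g' : D.Hom X D.unit) : g = g' := by
  obtain ⟨c, hc, -⟩ := hX
  have h : ∀ f : D.Hom X D.unit, f = c ▹ D.disc X := fun f => by
    rw [← hD.disc_natural f, ← hD.eps_unit, hD.eps_natural, hD.reassoc_id hc]
  rw [h g, ← h g']

theorem coalg_dup {X : D.Obj} (hX : Coalg D X) :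
    ∃ d : D.Hom X (D.tens X X), ∀ {A : D.Obj} (v : D.Hom X (D.L A)),
      v ▹ D.dup A = d ▹ (v ⊠ v) := by
  obtain ⟨c, hc, -⟩ := hX
  refine ⟨c ▹ D.dup X ▹ (D.eps X ⊠ D.eps X), fun {A} v => ?_⟩
  have h : D.Lmap (v ▹ D.eps A) = D.eps X ▹ v := by
    rw [hD.Lmap_comp, ← hD.eps_bang, hD.eps_natural]
  conv_lhs => rw [hD.coalg_hom_eq hc v]
  rw [hD.comp_assoc, hD.dup_natural, h]
  simp only [hD.comp_assoc, hD.tmap_tmap]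

end LCDLaws

section Casts

variable {D : LCDData} (hD : LCDLaws D)

theorem castHom_comp {A A' B B' E : D.Obj} (h₁ : A = A') (h₂ : B = B') (f : D.Hom A B)
    (k : D.Hom B' E) :
    D.castHom h₁ h₂ f ▹ k = D.castHom h₁ rfl (f ▹ D.castHom h₂.symm rfl k) := by
  subst h₁ h₂; rfl

theorem castHom_eps {X Y E : D.Obj} (h : X = Y) (h' : D.L X = D.L Y) (k : D.Hom X E) :
    D.castHom h' rfl (D.eps X ▹ k) = D.eps Y ▹ D.castHom h rfl k := by
  subst h; rfl

theorem castHom_castHom {A A' B B' A'' B'' : D.Obj} (h₁ : A = A') (h₂ : B = B') (h₃ : A' = A'')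
    (h₄ : B' = B'') (f : D.Hom A B) :
    D.castHom h₃ h₄ (D.castHom h₁ h₂ f) = D.castHom (h₁.trans h₃) (h₂.trans h₄) f := by
  subst h₁ h₂ h₃ h₄; rfl

theorem castHom_precomp {A A' B E : D.Obj} (h₁ : A = A') (f : D.Hom A B) (k : D.Hom B E) :
    D.castHom h₁ rfl (f ▹ k) = D.castHom h₁ rfl f ▹ k := by
  subst h₁; rfl

theorem castHom_tmap {A A' B E E' F : D.Obj} (h₁ : A = A') (h₂ : E = E')
    (h₃ : D.tens A E = D.tens A' E') (f : D.Hom A B) (k : D.Hom E F) :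
    D.castHom h₃ rfl (f ⊠ k) = D.castHom h₁ rfl f ⊠ D.castHom h₂ rfl k := by
  subst h₁ h₂; rfl

variable (Θ : ℕ → D.Obj)

/-- The iterated counit `⟦!ⁿA⟧ → ⟦A⟧`. -/
def collD : ∀ (n : ℕ) (A : Ty), D.Hom (denTy D Θ (bangN n A)) (denTy D Θ A)
  | 0, _ => D.id _
  | n + 1, A => D.eps (denTy D Θ (bangN n A)) ▹ collD n A

theorem castHom_collapseL (n : ℕ) (A : Ty) (h : Ln D n (denTy D Θ A) = denTy D Θ (bangN n A)) :
    D.castHom h rfl (collapseL D n (denTy D Θ A)) = collD Θ n A := by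
  induction n with
  | zero => rfl
  | succ n ih =>
    rw [collapseL, collD, castHom_eps (denTy_bangN D Θ n A).symm h, ih]

theorem castHom_collD (n : ℕ) (A : Ty) (h : denTy D Θ (bangN n A) = Ln D n (denTy D Θ A)) :
    D.castHom h rfl (collD Θ n A) = collapseL D n (denTy D Θ A) := by
  rw [← castHom_collapseL Θ n A h.symm, castHom_castHom]; rfl

include hD

theorem padL_collapseL (m : ℕ) (X : D.Obj) :
    padL D m X ▹ collapseL D (m + 1) X = D.eps X := by
  induction m with
  | zero => exact (hD.id_comp _).trans (hD.comp_id _)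
  | succ m ih =>
    rw [padL, hD.comp_assoc, collapseL]
    exact (congrArg _ (hD.reassoc_id (hD.delta_counit_left _) _)).trans ih

theorem bangAdj_collapseL (n m : ℕ) (X : D.Obj) (h : m = 0 ∨ 1 ≤ n) :
    bangAdj D n m X h ▹ collapseL D m X = collapseL D n X := by
  match n, m, h with
  | 0, 0, _ => exact hD.comp_id _
  | n + 1, 0, _ => exact hD.comp_id _
  | 0, m + 1, h => omega
  | n + 1, m + 1, _ =>
    rw [bangAdj, hD.comp_assoc, padL_collapseL hD, collapseL]
    exact hD.eps_natural _

theorem LnMap_collapseL (m : ℕ) {X Y : D.Obj} (f : D.Hom X Y) :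
    LnMap D m f ▹ collapseL D m Y = collapseL D m X ▹ f := by
  induction m with
  | zero => exact (hD.comp_id _).trans (hD.id_comp _).symm
  | succ m ih =>
    rw [collapseL, collapseL, hD.comp_assoc, ← ih, LnMap]
    exact hD.reassoc (hD.eps_natural _) _ |>.trans (hD.comp_assoc _ _ _)

theorem castHom_bangAdj_collD (n m : ℕ) (A : Ty) (h : m = 0 ∨ 1 ≤ n) :
    D.castHom (denTy_bangN D Θ n A).symm (denTy_bangN D Θ m A).symm
      (bangAdj D n m (denTy D Θ A) h) ▹ collD Θ m A = collD Θ n A := by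
  rw [castHom_comp, castHom_collD, bangAdj_collapseL hD, castHom_collapseL]

theorem castHom_bangAdj_LnMap_collD (n m : ℕ) (A B : Ty) (h : m = 0 ∨ 1 ≤ n)
    (f : D.Hom (denTy D Θ A) (denTy D Θ B)) :
    D.castHom (denTy_bangN D Θ n A).symm (denTy_bangN D Θ m B).symm
      (bangAdj D n m (denTy D Θ A) h ▹ LnMap D m f) ▹ collD Θ m B = collD Θ n A ▹ f := by
  rw [castHom_comp, castHom_collD, hD.comp_assoc, LnMap_collapseL hD,
    hD.reassoc (bangAdj_collapseL hD n m _ h), castHom_precomp, castHom_collapseL]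

theorem castHom_padL_collD (n : ℕ) (A : Ty) :
    D.castHom rfl (denTy_bangN D Θ (n + 1) A).symm (padL D n (denTy D Θ A)) ▹
      collD Θ (n + 1) A = D.eps (denTy D Θ A) := by
  rw [castHom_comp, castHom_collD, padL_collapseL hD]; rfl

theorem starMap_collD (n : ℕ) : starMap D Θ n ▹ collD Θ n Ty.unit = D.id D.unit := by
  cases n with
  | zero => exact hD.comp_id _
  | succ n =>
    rw [starMap, hD.comp_assoc]
    exact (congrArg _ (castHom_padL_collD hD Θ n Ty.unit)).trans hD.eps_monoidal_unit

theorem m2n_collapseL (n : ℕ) (a b : D.Obj) :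
    m2n D n a b ▹ collapseL D n _ = collapseL D n a ⊠ collapseL D n b := by
  induction n with
  | zero => exact (hD.comp_id _).trans (hD.tmap_id _ _).symm
  | succ n ih =>
    rw [m2n, collapseL, hD.comp_assoc, hD.reassoc (hD.eps_natural _), hD.comp_assoc, ih,
      hD.reassoc (hD.eps_monoidal _ _), hD.tmap_tmap]
    rfl

theorem m2nInv_collapseL (n : ℕ) (a b : D.Obj) :
    m2nInv D n a b ▹ (collapseL D n a ⊠ collapseL D n b) = collapseL D n _ := by
  induction n with
  | zero => exact (congrArg _ (hD.tmap_id _ _)).trans (hD.comp_id _)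
  | succ n ih =>
    rw [m2nInv, collapseL, collapseL, hD.comp_assoc, ← hD.tmap_tmap, ← hD.eps_monoidal,
      hD.comp_assoc, hD.reassoc_id (hD.m2_iso₂ _ _), hD.reassoc (hD.eps_natural _),
      hD.comp_assoc, ih]
    rfl

theorem m2nD_collD (n : ℕ) (A B : Ty) :
    m2nD D Θ n A B ▹ collD Θ n (Ty.tensor A B) = collD Θ n A ⊠ collD Θ n B := by
  rw [m2nD, castHom_comp, castHom_collD]
  exact (congrArg _ (m2n_collapseL hD n _ _)).trans <| by
    rw [castHom_tmap (denTy_bangN D Θ n A).symm (denTy_bangN D Θ n B).symm, castHom_collapseL,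
      castHom_collapseL]

theorem m2nDInv_collD (n : ℕ) (A B : Ty) :
    m2nDInv D Θ n A B ▹ (collD Θ n A ⊠ collD Θ n B) = collD Θ n (Ty.tensor A B) := by
  rw [m2nDInv, castHom_comp, castHom_tmap (denTy_bangN D Θ n A) (denTy_bangN D Θ n B),
    castHom_collD, castHom_collD, m2nInv_collapseL hD]
  exact castHom_collapseL Θ n (Ty.tensor A B) _

theorem collD_ext {n : ℕ} {A : Ty} {X : D.Obj} (hX : 0 < n → Coalg D X)
    {f g : D.Hom X (denTy D Θ (bangN n A))} (h : f ▹ collD Θ n A = g ▹ collD Θ n A) : f = g := by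
  induction n with
  | zero => simpa only [collD, hD.comp_id] using h
  | succ n ih =>
    refine hD.coalg_hom_ext (hX (Nat.succ_pos _)) (ih (fun _ => hX (Nat.succ_pos _)) ?_)
    simpa only [collD, ← hD.comp_assoc] using h

theorem collD_lift {n : ℕ} {A : Ty} {X : D.Obj} (hX : 0 < n → Coalg D X)
    (f : D.Hom X (denTy D Θ A)) : ∃ g : D.Hom X (denTy D Θ (bangN n A)), g ▹ collD Θ n A = f := by
  induction n with
  | zero => exact ⟨f, hD.comp_id _⟩
  | succ n ih =>
    obtain ⟨g, hg⟩ := ih (fun _ => hX (Nat.succ_pos _))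
    obtain ⟨k, hk⟩ := hD.coalg_lift (hX (Nat.succ_pos _)) g
    exact ⟨k, by rw [collD, ← hD.comp_assoc]; exact (congrArg (· ▹ _) hk).trans hg⟩

end Casts

section Subtyping

variable {D : LCDData} (hD : LCDLaws D) (Θ : ℕ → D.Obj)
include hD

theorem Isub_tconst_collD (n m a : ℕ) (h : m = 0 ∨ 1 ≤ n) :
    Isub D Θ (.tconst n m a h) ▹ collD Θ m (.tconst a) = collD Θ n (.tconst a) := by
  rw [Isub]; exact castHom_bangAdj_collD hD Θ n m (.tconst a) h

theorem Isub_unit_collD (n m : ℕ) (h : m = 0 ∨ 1 ≤ n) :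
    Isub D Θ (.unit n m h) ▹ collD Θ m .unit = collD Θ n .unit := by
  rw [Isub]; exact castHom_bangAdj_collD hD Θ n m .unit h

theorem Isub_arrow_collD (n m : ℕ) {A A' B B' : Ty} (h : m = 0 ∨ 1 ≤ n) (s : SubD A A')
    (t : SubD B B') :
    Isub D Θ (.arrow n m A A' B B' h s t) ▹ collD Θ m (.arrow A B') =
      collD Θ n (.arrow A' B) ▹ D.lolliL (Isub D Θ s) (denTy D Θ B) ▹
        D.lolliR (denTy D Θ A) (Isub D Θ t) := by
  rw [Isub]; exact castHom_bangAdj_LnMap_collD hD Θ n m (.arrow A' B) (.arrow A B') h _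

theorem Isub_tensor_collD (n m : ℕ) {A A' B B' : Ty} (h : m = 0 ∨ 1 ≤ n) (s : SubD A A')
    (t : SubD B B') :
    Isub D Θ (.tensor n m A A' B B' h s t) ▹ collD Θ m (.tensor A' B') =
      collD Θ n (.tensor A B) ▹ (Isub D Θ s ⊠ Isub D Θ t) := by
  rw [Isub]; exact castHom_bangAdj_LnMap_collD hD Θ n m (.tensor A B) (.tensor A' B') h _

theorem coalg_bangN {n : ℕ} (A : Ty) (h : 0 < n) : Coalg D (denTy D Θ (bangN n A)) := by
  cases n with
  | zero => omega
  | succ n => exact hD.coalg_bang _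

omit hD in
theorem bangN_bang (n : ℕ) (A : Ty) : bangN n (.bang A) = bangN (n + 1) A := by
  induction n with
  | zero => rfl
  | succ n ih => rw [bangN, ih, bangN]

theorem exists_Isub_bangN_refl (A : Ty) (n : ℕ) :
    ∃ s : SubD (bangN n A) (bangN n A), Isub D Θ s = D.id _ := by
  have h : n = 0 ∨ 1 ≤ n := by omega
  induction A generalizing n with
  | tconst a =>
    refine ⟨.tconst n n a h, collD_ext hD Θ (coalg_bangN hD Θ (.tconst a)) ?_⟩
    rw [Isub_tconst_collD hD, hD.id_comp]
  | unit =>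
    refine ⟨.unit n n h, collD_ext hD Θ (coalg_bangN hD Θ .unit) ?_⟩
    rw [Isub_unit_collD hD, hD.id_comp]
  | arrow A B ihA ihB =>
    obtain ⟨s, hs⟩ := ihA 0 (.inl rfl)
    obtain ⟨t, ht⟩ := ihB 0 (.inl rfl)
    refine ⟨.arrow n n A A B B h s t, collD_ext hD Θ (coalg_bangN hD Θ (.arrow A B)) ?_⟩
    rw [Isub_arrow_collD hD, hs, ht]
    exact (congrArg _ ((congrArg₂ _ (hD.lolliL_id _ _) (hD.lolliR_id _ _)).trans
      (hD.id_comp _))).trans ((hD.comp_id _).trans (hD.id_comp _).symm)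
  | tensor A B ihA ihB =>
    obtain ⟨s, hs⟩ := ihA 0 (.inl rfl)
    obtain ⟨t, ht⟩ := ihB 0 (.inl rfl)
    refine ⟨.tensor n n A A B B h s t, collD_ext hD Θ (coalg_bangN hD Θ (.tensor A B)) ?_⟩
    rw [Isub_tensor_collD hD, hs, ht]
    exact (congrArg _ (hD.tmap_id _ _)).trans ((hD.comp_id _).trans (hD.id_comp _).symm)
  | bang A ih =>
    have := ih (n + 1) (by omega)
    rw [← bangN_bang] at this
    exact this

/-- Subtyping is reflexive, witnessed by the identity. -/
theorem exists_Isub_refl (A : Ty) : ∃ s : SubD A A, Isub D Θ s = D.id _ :=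
  exists_Isub_bangN_refl hD Θ A 0

end Subtyping

section Relation

variable {D : LCDData}

/-- The data of a strong monad on `D`, used to treat the computational and the value
interpretation uniformly. -/
structure StrongMon (D : LCDData) where
  obj : D.Obj → D.Obj
  map : ∀ {A B}, D.Hom A B → D.Hom (obj A) (obj B)
  eta : ∀ A, D.Hom A (obj A)
  mu : ∀ A, D.Hom (obj (obj A)) (obj A)
  str : ∀ A B, D.Hom (D.tens A (obj B)) (obj (D.tens A B))

variable (D) in
/-- The monad `T` of `D` (for `true`) and the identity monad (for `false`). -/
@[reducible] def mon : Bool → StrongMon D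
  | true => ⟨D.T, D.Tmap, D.eta, D.mu, D.str⟩
  | false => ⟨fun A => A, fun f => f, D.id, D.id, fun A B => D.id (D.tens A B)⟩

/-- Lifting of a relation along `mon D b`. -/
def LiftRel (b : Bool) {P Q : D.Obj} (R : ∀ Y, D.Hom Y P → D.Hom Y Q → Prop) (X : D.Obj)
    (f : D.Hom X ((mon D b).obj P)) (g : D.Hom X ((mon D b).obj Q)) : Prop :=
  ∃ (Y : D.Obj) (u : D.Hom X ((mon D b).obj Y)) (v : D.Hom Y P) (w : D.Hom Y Q),
    f = u ▹ (mon D b).map v ∧ g = u ▹ (mon D b).map w ∧ R Y v w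

/-- The clause of the logical relation for a `!` on the left. -/
def BangRel {P Q : D.Obj} (R : ∀ Y, D.Hom Y P → D.Hom Y Q → Prop) (X : D.Obj)
    (f : D.Hom X (D.L P)) (g : D.Hom X Q) : Prop :=
  ∃ (Y : D.Obj) (u : D.Hom X Y) (v : D.Hom Y (D.L P)) (w : D.Hom Y Q),
    Coalg D Y ∧ f = u ▹ v ∧ g = u ▹ w ∧ R Y (v ▹ D.eps P) w

/-- The clause of the logical relation for a `!` on the right. -/
def BangRelRight {P Q : D.Obj} (R : ∀ Y, D.Hom Y P → D.Hom Y Q → Prop) (X : D.Obj)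
    (f : D.Hom X P) (g : D.Hom X (D.L Q)) : Prop :=
  ∃ (Y : D.Obj) (u : D.Hom X Y) (v : D.Hom Y P) (w : D.Hom Y (D.L Q)),
    Coalg D Y ∧ f = u ▹ v ∧ g = u ▹ w ∧ R Y v (w ▹ D.eps Q)

/-- A Kripke logical relation between the generalized elements of the interpretations of two
types, which relates the elements that are obtained from one another by type casts. -/
def LogRel (Θ : ℕ → D.Obj) : (A B : Ty) → (X : D.Obj) → D.Hom X (denTy D Θ A) →
    D.Hom X (denTy D Θ B) → Prop
  | .bang A, B => BangRel (LogRel Θ A B)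
  | .tconst a, .bang B => BangRelRight (LogRel Θ (.tconst a) B)
  | .unit, .bang B => BangRelRight (LogRel Θ .unit B)
  | .arrow A₁ A₂, .bang B => BangRelRight (LogRel Θ (.arrow A₁ A₂) B)
  | .tensor A₁ A₂, .bang B => BangRelRight (LogRel Θ (.tensor A₁ A₂) B)
  | .tconst a, .tconst b => fun _ f g => ∃ h : a = b, D.castHom rfl (congrArg Θ h) f = g
  | .unit, .unit => fun _ f g => f = g
  | .arrow A₁ A₂, .arrow B₁ B₂ => fun X f g =>
      ∀ (Y : D.Obj) (a : D.Hom Y (denTy D Θ A₁)) (b : D.Hom Y (denTy D Θ B₁)),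
        LogRel Θ A₁ B₁ Y a b →
        LiftRel true (LogRel Θ A₂ B₂) (D.tens X Y) ((f ⊠ a) ▹ D.appnt _ _)
          ((g ⊠ b) ▹ D.appnt _ _)
  | .tensor A₁ A₂, .tensor B₁ B₂ => fun X f g =>
      ∃ (Y Z : D.Obj) (u : D.Hom X (D.tens Y Z)) (f₁ : D.Hom Y (denTy D Θ A₁))
        (f₂ : D.Hom Z (denTy D Θ A₂)) (g₁ : D.Hom Y (denTy D Θ B₁))
        (g₂ : D.Hom Z (denTy D Θ B₂)),
        f = u ▹ (f₁ ⊠ f₂) ∧ g = u ▹ (g₁ ⊠ g₂) ∧ LogRel Θ A₁ B₁ Y f₁ g₁ ∧ LogRel Θ A₂ B₂ Z f₂ g₂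
  | .tconst _, .unit => fun _ _ _ => False
  | .tconst _, .arrow _ _ => fun _ _ _ => False
  | .tconst _, .tensor _ _ => fun _ _ _ => False
  | .unit, .tconst _ => fun _ _ _ => False
  | .unit, .arrow _ _ => fun _ _ _ => False
  | .unit, .tensor _ _ => fun _ _ _ => False
  | .arrow _ _, .tconst _ => fun _ _ _ => False
  | .arrow _ _, .unit => fun _ _ _ => False
  | .arrow _ _, .tensor _ _ => fun _ _ _ => False
  | .tensor _ _, .tconst _ => fun _ _ _ => False
  | .tensor _ _, .unit => fun _ _ _ => False
  | .tensor _ _, .arrow _ _ => fun _ _ _ => False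
termination_by A B => sizeOf A + sizeOf B

end Relation

namespace Ty

/-- The types of the form `!A`. -/
def IsBang : Ty → Prop
  | .bang _ => True
  | _ => False

end Ty

section Relation

variable {D : LCDData} (hD : LCDLaws D) (Θ : ℕ → D.Obj)
include hD

theorem LiftRel.precomp {b : Bool} {P Q : D.Obj} {R : ∀ Y, D.Hom Y P → D.Hom Y Q → Prop}
    {X X' : D.Obj} (w : D.Hom X' X) {f : D.Hom X ((mon D b).obj P)}
    {g : D.Hom X ((mon D b).obj Q)} (h : LiftRel b R X f g) : LiftRel b R X' (w ▹ f) (w ▹ g) := by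
  obtain ⟨Y, u, v, v', rfl, rfl, hR⟩ := h
  exact ⟨Y, w ▹ u, v, v', (hD.comp_assoc _ _ _).symm, (hD.comp_assoc _ _ _).symm, hR⟩

theorem BangRel.precomp {P Q : D.Obj} {R : ∀ Y, D.Hom Y P → D.Hom Y Q → Prop}
    {X X' : D.Obj} (w : D.Hom X' X) {f : D.Hom X (D.L P)} {g : D.Hom X Q}
    (h : BangRel R X f g) : BangRel R X' (w ▹ f) (w ▹ g) := by
  obtain ⟨Y, u, v, v', hY, rfl, rfl, hR⟩ := h
  exact ⟨Y, w ▹ u, v, v', hY, (hD.comp_assoc _ _ _).symm, (hD.comp_assoc _ _ _).symm, hR⟩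

theorem BangRelRight.precomp {P Q : D.Obj} {R : ∀ Y, D.Hom Y P → D.Hom Y Q → Prop}
    {X X' : D.Obj} (w : D.Hom X' X) {f : D.Hom X P} {g : D.Hom X (D.L Q)}
    (h : BangRelRight R X f g) : BangRelRight R X' (w ▹ f) (w ▹ g) := by
  obtain ⟨Y, u, v, v', hY, rfl, rfl, hR⟩ := h
  exact ⟨Y, w ▹ u, v, v', hY, (hD.comp_assoc _ _ _).symm, (hD.comp_assoc _ _ _).symm, hR⟩

variable {Θ}

theorem LogRel.precomp {A B : Ty} {X X' : D.Obj} (w : D.Hom X' X) {f : D.Hom X (denTy D Θ A)}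
    {g : D.Hom X (denTy D Θ B)} (h : LogRel Θ A B X f g) :
    LogRel Θ A B X' (w ▹ f) (w ▹ g) := by
  cases A <;> cases B <;> rw [LogRel] at h ⊢ <;>
    first
    | exact h
    | exact BangRel.precomp hD w h
    | exact BangRelRight.precomp hD w h
    | skip
  case tconst.tconst =>
    obtain ⟨rfl, h⟩ := h
    exact ⟨rfl, congrArg (w ▹ ·) h⟩
  case arrow.arrow =>
    intro Y a b hab
    have := (h Y a b hab).precomp hD (w ⊠ D.id Y)
    simpa only [← hD.comp_assoc, hD.tmap_tmap, hD.id_comp] using this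
  case tensor.tensor =>
    obtain ⟨Y, Z, u, f₁, f₂, g₁, g₂, rfl, rfl, h₁, h₂⟩ := h
    exact ⟨Y, Z, w ▹ u, f₁, f₂, g₁, g₂, (hD.comp_assoc _ _ _).symm, (hD.comp_assoc _ _ _).symm,
      h₁, h₂⟩
  case unit.unit => rw [h]

theorem logRel_bang_left {A B : Ty} {X : D.Obj} (hX : Coalg D X) (f : D.Hom X (D.L (denTy D Θ A)))
    (g : D.Hom X (denTy D Θ B)) :
    LogRel Θ (.bang A) B X f g ↔ LogRel Θ A B X (f ▹ D.eps _) g := by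
  rw [LogRel]
  constructor
  · rintro ⟨Y, u, f', g', -, rfl, rfl, h⟩
    simpa only [hD.comp_assoc] using h.precomp hD u
  · exact fun h => ⟨X, D.id X, f, g, hX, (hD.id_comp _).symm, (hD.id_comp _).symm, h⟩

theorem bangRelRight_iff {A B : Ty} {X : D.Obj} (hX : Coalg D X) (f : D.Hom X (denTy D Θ A))
    (g : D.Hom X (D.L (denTy D Θ B))) :
    BangRelRight (LogRel Θ A B) X f g ↔ LogRel Θ A B X f (g ▹ D.eps _) := by
  constructor
  · rintro ⟨Y, u, f', g', -, rfl, rfl, h⟩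
    simpa only [hD.comp_assoc] using h.precomp hD u
  · exact fun h => ⟨X, D.id X, f, g, hX, (hD.id_comp _).symm, (hD.id_comp _).symm, h⟩

theorem logRel_bang_right {A B : Ty} {X : D.Obj} (hX : Coalg D X) (f : D.Hom X (denTy D Θ A))
    (g : D.Hom X (D.L (denTy D Θ B))) :
    LogRel Θ A (.bang B) X f g ↔ LogRel Θ A B X f (g ▹ D.eps _) := by
  induction A with
  | bang A ih => rw [logRel_bang_left hD hX, logRel_bang_left hD hX, ih]
  | tconst a => rw [LogRel, bangRelRight_iff hD hX]
  | unit => rw [LogRel, bangRelRight_iff hD hX]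
  | arrow A₁ A₂ => rw [LogRel, bangRelRight_iff hD hX]
  | tensor A₁ A₂ => rw [LogRel, bangRelRight_iff hD hX]

theorem logRel_bangN {A B : Ty} {n m : ℕ} {X : D.Obj} (hX : 0 < n + m → Coalg D X)
    (f : D.Hom X (denTy D Θ (bangN n A))) (g : D.Hom X (denTy D Θ (bangN m B))) :
    LogRel Θ (bangN n A) (bangN m B) X f g ↔
      LogRel Θ A B X (f ▹ collD Θ n A) (g ▹ collD Θ m B) := by
  induction n with
  | zero =>
    induction m with
    | zero => simp only [collD, hD.comp_id]
    | succ m ih =>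
      refine (logRel_bang_right hD (hX (by omega)) f g).trans
        ((ih _ fun _ => hX (by omega)).trans ?_)
      simp only [collD, hD.comp_assoc]
  | succ n ih =>
    refine (logRel_bang_left hD (hX (by omega)) f g).trans
      ((ih (fun _ => hX (by omega)) _).trans ?_)
    simp only [collD, hD.comp_assoc]

/-- Related elements arise from related elements over a context which is a coalgebra if one of
the two types is a `!`-type. -/
theorem LogRel.factor {A B : Ty} {X : D.Obj} {f : D.Hom X (denTy D Θ A)}
    {g : D.Hom X (denTy D Θ B)} (h : LogRel Θ A B X f g) :
    ∃ (Y : D.Obj) (u : D.Hom X Y) (f' : D.Hom Y (denTy D Θ A)) (g' : D.Hom Y (denTy D Θ B)),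
      f = u ▹ f' ∧ g = u ▹ g' ∧ LogRel Θ A B Y f' g' ∧ (A.IsBang ∨ B.IsBang → Coalg D Y) := by
  have hR : ∀ {A B : Ty} {f : D.Hom X (denTy D Θ A)} {g : D.Hom X (denTy D Θ (.bang B))},
      BangRelRight (LogRel Θ A B) X f g →
      ∃ (Y : D.Obj) (u : D.Hom X Y) (f' : D.Hom Y (denTy D Θ A)) (g' : D.Hom Y (D.L (denTy D Θ B))),
        f = u ▹ f' ∧ g = u ▹ g' ∧ LogRel Θ A (.bang B) Y f' g' ∧ Coalg D Y := by
    rintro A B f g ⟨Y, u, f', g', hY, hf, hg, h⟩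
    exact ⟨Y, u, f', g', hf, hg, (logRel_bang_right hD hY _ _).2 h, hY⟩
  have hid : ¬ (A.IsBang ∨ B.IsBang) → ∃ (Y : D.Obj) (u : D.Hom X Y) (f' : D.Hom Y (denTy D Θ A))
      (g' : D.Hom Y (denTy D Θ B)),
      f = u ▹ f' ∧ g = u ▹ g' ∧ LogRel Θ A B Y f' g' ∧ (A.IsBang ∨ B.IsBang → Coalg D Y) :=
    fun hn => ⟨X, D.id X, f, g, (hD.id_comp _).symm, (hD.id_comp _).symm, h, fun h' => (hn h').elim⟩
  cases A
  case bang A =>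
    rw [LogRel] at h
    obtain ⟨Y, u, f', g', hY, hf, hg, h⟩ := h
    exact ⟨Y, u, f', g', hf, hg, (logRel_bang_left hD hY _ _).2 h, fun _ => hY⟩
  all_goals
    cases B
    case bang B =>
      rw [LogRel] at h
      obtain ⟨Y, u, f', g', hf, hg, h, hY⟩ := hR h
      exact ⟨Y, u, f', g', hf, hg, h, fun _ => hY⟩
    all_goals exact hid (by simp [Ty.IsBang])

omit hD in
theorem isBang_bangN {n : ℕ} (A : Ty) (h : 0 < n) : (bangN n A).IsBang := by
  cases n with
  | zero => omega
  | succ n => trivial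

theorem appnt_eq {A B X Y : D.Obj} (f : D.Hom X (D.lolli A B)) (a : D.Hom Y A) :
    (f ⊠ a) ▹ D.appnt A B = (D.id X ⊠ a) ▹ D.Phi f := by
  have := hD.Phi_natural_left f (D.id _)
  rw [hD.comp_id] at this
  rw [this, LCDData.appnt, hD.tmap_tmap_assoc, hD.id_comp, hD.comp_id]

theorem cast_appnt {A A' B B' X Y : D.Obj} (f : D.Hom X (D.lolli A B)) (s : D.Hom A' A)
    (t : D.Hom B B') (a : D.Hom Y A') :
    ((f ▹ D.lolliL s B ▹ D.lolliR A' t) ⊠ a) ▹ D.appnt A' B' =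
      ((f ⊠ (a ▹ s)) ▹ D.appnt A B) ▹ D.Tmap t := by
  rw [appnt_eq hD, appnt_eq hD, ← hD.comp_assoc, hD.Phi_natural_right, hD.Phi_natural_arg]
  simp only [hD.comp_assoc, hD.tmap_tmap_assoc, hD.id_comp]

theorem mon_map_comp (b : Bool) {P Q S : D.Obj} (f : D.Hom P Q) (g : D.Hom Q S) :
    (mon D b).map (f ▹ g) = (mon D b).map f ▹ (mon D b).map g := by
  cases b
  · rfl
  · exact hD.Tmap_comp f g

theorem mon_map_id (b : Bool) (P : D.Obj) : (mon D b).map (D.id P) = D.id _ := by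
  cases b
  · rfl
  · exact hD.Tmap_id P

theorem LiftRel.map {b : Bool} {P Q P' Q' : D.Obj} {R : ∀ Y, D.Hom Y P → D.Hom Y Q → Prop}
    {R' : ∀ Y, D.Hom Y P' → D.Hom Y Q' → Prop} {p : D.Hom P P'} {q : D.Hom Q Q'}
    (hR : ∀ Y v w, R Y v w → R' Y (v ▹ p) (w ▹ q)) {X : D.Obj} {f : D.Hom X ((mon D b).obj P)}
    {g : D.Hom X ((mon D b).obj Q)} (h : LiftRel b R X f g) :
    LiftRel b R' X (f ▹ (mon D b).map p) (g ▹ (mon D b).map q) := by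
  obtain ⟨Y, u, v, v', rfl, rfl, h⟩ := h
  exact ⟨Y, u, v ▹ p, v' ▹ q, by rw [hD.comp_assoc, mon_map_comp hD],
    by rw [hD.comp_assoc, mon_map_comp hD], hR _ _ _ h⟩

theorem LogRel.cast_of_core {A B A' B' : Ty} {n m p q : ℕ} (hn : m = 0 ∨ 1 ≤ n)
    (hp : q = 0 ∨ 1 ≤ p) {i : D.Hom (denTy D Θ (bangN n A)) (denTy D Θ (bangN m A'))}
    {j : D.Hom (denTy D Θ (bangN p B)) (denTy D Θ (bangN q B'))}
    {k : D.Hom (denTy D Θ A) (denTy D Θ A')} {l : D.Hom (denTy D Θ B) (denTy D Θ B')}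
    (hi : i ▹ collD Θ m A' = collD Θ n A ▹ k) (hj : j ▹ collD Θ q B' = collD Θ p B ▹ l)
    (hcore : ∀ Y (a : D.Hom Y (denTy D Θ A)) (b : D.Hom Y (denTy D Θ B)),
      LogRel Θ A B Y a b → LogRel Θ A' B' Y (a ▹ k) (b ▹ l))
    {X : D.Obj} {f : D.Hom X (denTy D Θ (bangN n A))} {g : D.Hom X (denTy D Θ (bangN p B))}
    (h : LogRel Θ (bangN n A) (bangN p B) X f g) :
    LogRel Θ (bangN m A') (bangN q B') X (f ▹ i) (g ▹ j) := by
  obtain ⟨Y, u, f', g', rfl, rfl, h, hY⟩ := h.factor hD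
  have hc : 0 < n + p → Coalg D Y := fun h => hY <| by
    rcases Nat.eq_zero_or_pos n with h' | h'
    · exact .inr (isBang_bangN _ (by omega))
    · exact .inl (isBang_bangN _ h')
  rw [hD.comp_assoc, hD.comp_assoc]
  refine LogRel.precomp hD u ((logRel_bangN hD (fun _ => hc (by omega)) _ _).2 ?_)
  rw [hD.comp_assoc, hD.comp_assoc, hi, hj, ← hD.comp_assoc, ← hD.comp_assoc]
  exact hcore _ _ _ ((logRel_bangN hD hc _ _).1 h)

/-- Type casts preserve the logical relation. -/
theorem LogRel.cast {A A' B B' : Ty} (s : SubD A A') (t : SubD B B') {X : D.Obj}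
    {f : D.Hom X (denTy D Θ A)} {g : D.Hom X (denTy D Θ B)} (h : LogRel Θ A B X f g) :
    LogRel Θ A' B' X (f ▹ Isub D Θ s) (g ▹ Isub D Θ t) := by
  induction s generalizing B B' X with
  | tconst n m a hn =>
    have hi := (Isub_tconst_collD hD Θ n m a hn).trans (hD.comp_id _).symm
    cases t with
    | tconst p q b hp =>
      refine h.cast_of_core hD hn hp hi
        ((Isub_tconst_collD hD Θ p q b hp).trans (hD.comp_id _).symm) fun Y a b h => ?_
      simpa only [hD.comp_id] using h
    | unit p q hp =>
      exact h.cast_of_core hD hn hp hi ((Isub_unit_collD hD Θ p q hp).trans (hD.comp_id _).symm)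
        fun Y a b h => by rw [LogRel] at h; exact h.elim
    | arrow p q _ _ _ _ hp s' t' =>
      exact h.cast_of_core hD hn hp hi (Isub_arrow_collD hD Θ p q hp s' t')
        fun Y a b h => by rw [LogRel] at h; exact h.elim
    | tensor p q _ _ _ _ hp s' t' =>
      exact h.cast_of_core hD hn hp hi (Isub_tensor_collD hD Θ p q hp s' t')
        fun Y a b h => by rw [LogRel] at h; exact h.elim
  | unit n m hn =>
    have hi := (Isub_unit_collD hD Θ n m hn).trans (hD.comp_id _).symm
    cases t with
    | tconst p q b hp =>
      exact h.cast_of_core hD hn hp hi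
        ((Isub_tconst_collD hD Θ p q b hp).trans (hD.comp_id _).symm)
        fun Y a b h => by rw [LogRel] at h; exact h.elim
    | unit p q hp =>
      refine h.cast_of_core hD hn hp hi ((Isub_unit_collD hD Θ p q hp).trans (hD.comp_id _).symm)
        fun Y a b h => ?_
      simpa only [hD.comp_id] using h
    | arrow p q _ _ _ _ hp s' t' =>
      exact h.cast_of_core hD hn hp hi (Isub_arrow_collD hD Θ p q hp s' t')
        fun Y a b h => by rw [LogRel] at h; exact h.elim
    | tensor p q _ _ _ _ hp s' t' =>
      exact h.cast_of_core hD hn hp hi (Isub_tensor_collD hD Θ p q hp s' t')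
        fun Y a b h => by rw [LogRel] at h; exact h.elim
  | arrow n m A₁ A₂ B₁ B₂ hn s₁ s₂ ih₁ ih₂ =>
    have hi := Isub_arrow_collD hD Θ n m hn s₁ s₂
    cases t with
    | tconst p q b hp =>
      exact h.cast_of_core hD hn hp hi
        ((Isub_tconst_collD hD Θ p q b hp).trans (hD.comp_id _).symm)
        fun Y a b h => by rw [LogRel] at h; exact h.elim
    | unit p q hp =>
      exact h.cast_of_core hD hn hp hi ((Isub_unit_collD hD Θ p q hp).trans (hD.comp_id _).symm)
        fun Y a b h => by rw [LogRel] at h; exact h.elim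
    | arrow p q _ _ _ _ hp t₁ t₂ =>
      refine h.cast_of_core hD hn hp hi (Isub_arrow_collD hD Θ p q hp t₁ t₂) fun Y a b h => ?_
      rw [LogRel] at h ⊢
      intro Z c d hcd
      rw [cast_appnt hD, cast_appnt hD]
      exact (h Z _ _ (ih₁ t₁ hcd)).map hD fun _ _ _ h => ih₂ t₂ h
    | tensor p q _ _ _ _ hp t₁ t₂ =>
      exact h.cast_of_core hD hn hp hi (Isub_tensor_collD hD Θ p q hp t₁ t₂)
        fun Y a b h => by rw [LogRel] at h; exact h.elim
  | tensor n m A₁ A₂ B₁ B₂ hn s₁ s₂ ih₁ ih₂ =>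
    have hi := Isub_tensor_collD hD Θ n m hn s₁ s₂
    cases t with
    | tconst p q b hp =>
      exact h.cast_of_core hD hn hp hi
        ((Isub_tconst_collD hD Θ p q b hp).trans (hD.comp_id _).symm)
        fun Y a b h => by rw [LogRel] at h; exact h.elim
    | unit p q hp =>
      exact h.cast_of_core hD hn hp hi ((Isub_unit_collD hD Θ p q hp).trans (hD.comp_id _).symm)
        fun Y a b h => by rw [LogRel] at h; exact h.elim
    | arrow p q _ _ _ _ hp t₁ t₂ =>
      exact h.cast_of_core hD hn hp hi (Isub_arrow_collD hD Θ p q hp t₁ t₂)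
        fun Y a b h => by rw [LogRel] at h; exact h.elim
    | tensor p q _ _ _ _ hp t₁ t₂ =>
      refine h.cast_of_core hD hn hp hi (Isub_tensor_collD hD Θ p q hp t₁ t₂) fun Y a b h => ?_
      rw [LogRel] at h ⊢
      obtain ⟨Y, Z, u, f₁, f₂, g₁, g₂, rfl, rfl, h₁, h₂⟩ := h
      exact ⟨Y, Z, u, _, _, _, _, (hD.comp_assoc _ _ _).trans (congrArg _ (hD.tmap_tmap _ _ _ _)),
        (hD.comp_assoc _ _ _).trans (congrArg _ (hD.tmap_tmap _ _ _ _)), ih₁ t₁ h₁, ih₂ t₂ h₂⟩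

/-- The logical relation on a single type is equality. -/
theorem logRel_self (A : Ty) {X : D.Obj} (f g : D.Hom X (denTy D Θ A)) :
    LogRel Θ A A X f g ↔ f = g := by
  induction A generalizing X with
  | tconst a =>
    rw [LogRel]
    exact ⟨fun ⟨_, h⟩ => h, fun h => ⟨rfl, h⟩⟩
  | unit => rw [LogRel]
  | arrow A B ihA ihB =>
    rw [LogRel]
    constructor
    · intro h
      obtain ⟨Y, u, v, w, hf, hg, hvw⟩ := h _ (D.id _) (D.id _) ((ihA _ _).2 rfl)
      rw [(ihB _ _).1 hvw, ← hg, appnt_eq hD, appnt_eq hD, hD.tmap_id, hD.id_comp,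
        hD.id_comp] at hf
      rw [← hD.Phi_iso₁ f, hf, hD.Phi_iso₁]
    · rintro rfl Y a b hab
      rw [(ihA _ _).1 hab]
      refine ⟨_, (f ⊠ b) ▹ D.appnt _ _, D.id _, D.id _, ?_, ?_, (ihB _ _).2 rfl⟩
      · rw [mon_map_id hD, hD.comp_id]
      · rw [mon_map_id hD, hD.comp_id]
  | tensor A B ihA ihB =>
    rw [LogRel]
    constructor
    · rintro ⟨Y, Z, u, f₁, f₂, g₁, g₂, rfl, rfl, h₁, h₂⟩
      rw [(ihA _ _).1 h₁, (ihB _ _).1 h₂]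
    · rintro rfl
      refine ⟨_, _, f, D.id _, D.id _, D.id _, D.id _, ?_, ?_, (ihA _ _).2 rfl, (ihB _ _).2 rfl⟩ <;>
      rw [hD.tmap_id, hD.comp_id]
  | bang A ih =>
    constructor
    · intro h
      obtain ⟨Y, u, f', g', rfl, rfl, h, hY⟩ := h.factor hD
      have hY := hY (.inl trivial)
      rw [logRel_bang_left hD hY, logRel_bang_right hD hY, ih] at h
      rw [hD.coalg_hom_ext hY h]
    · rintro rfl
      have := hD.coalg_bang (denTy D Θ A)
      have h : LogRel Θ (.bang A) (.bang A) _ (D.id _) (D.id _) := by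
        rw [logRel_bang_left hD this, logRel_bang_right hD this, ih]
      have := h.precomp hD f
      rwa [hD.comp_id] at this

theorem liftRel_self {b : Bool} (A : Ty) {X : D.Obj} {f g : D.Hom X ((mon D b).obj (denTy D Θ A))}
    (h : LiftRel b (LogRel Θ A A) X f g) : f = g := by
  obtain ⟨Y, u, v, w, rfl, rfl, h⟩ := h
  rw [(logRel_self hD A _ _).1 h]

end Relation

section Monad

/-- Sequencing of a computation with one that depends on its result. -/
def monLet (D : LCDData) (b : Bool) {P W C : D.Obj} (h : D.Hom (D.tens P W) ((mon D b).obj C)) :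
    D.Hom (D.tens ((mon D b).obj P) W) ((mon D b).obj C) :=
  D.symm _ W ▹ (mon D b).str W P ▹ (mon D b).map (D.symm W P ▹ h) ▹ (mon D b).mu C

/-- Pairing of two computations, the first of which is run first. -/
def monPair (D : LCDData) (b : Bool) (P Q : D.Obj) :
    D.Hom (D.tens ((mon D b).obj P) ((mon D b).obj Q)) ((mon D b).obj (D.tens P Q)) :=
  monLet D b ((mon D b).str P Q)

variable {D : LCDData}

namespace LCDLaws

variable (hD : LCDLaws D)
include hD

theorem monLet_false {P W C : D.Obj} (h : D.Hom (D.tens P W) C) : monLet D false h = h := by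
  show D.symm P W ▹ D.id _ ▹ (D.symm W P ▹ h) ▹ D.id _ = h
  rw [hD.id_comp, hD.comp_id, hD.reassoc_id (hD.symm_symm _ _)]

theorem monPair_false (P Q : D.Obj) : monPair D false P Q = D.id _ := monLet_false hD _

theorem mon_eta_natural (b : Bool) {P Q : D.Obj} (f : D.Hom P Q) :
    f ▹ (mon D b).eta Q = (mon D b).eta P ▹ (mon D b).map f := by
  cases b
  · exact (hD.comp_id f).trans (hD.id_comp f).symm
  · exact hD.eta_natural f

theorem mon_mu_natural (b : Bool) {P Q : D.Obj} (f : D.Hom P Q) :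
    (mon D b).map ((mon D b).map f) ▹ (mon D b).mu Q = (mon D b).mu P ▹ (mon D b).map f := by
  cases b
  · exact (hD.comp_id f).trans (hD.id_comp f).symm
  · exact hD.mu_natural f

theorem mon_str_natural (b : Bool) {P P' Q Q' : D.Obj} (f : D.Hom P P') (g : D.Hom Q Q') :
    (f ⊠ (mon D b).map g) ▹ (mon D b).str P' Q' = (mon D b).str P Q ▹ (mon D b).map (f ⊠ g) := by
  cases b
  · exact (hD.comp_id _).trans (hD.id_comp _).symm
  · exact hD.str_natural f g

theorem tmap_monLet (b : Bool) {P P' W W' C : D.Obj} (v : D.Hom P P') (e : D.Hom W W')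
    (h : D.Hom (D.tens P' W') ((mon D b).obj C)) :
    ((mon D b).map v ⊠ e) ▹ monLet D b h = monLet D b ((v ⊠ e) ▹ h) := by
  rw [monLet, monLet, hD.reassoc (hD.symm_natural _ _), hD.comp_assoc,
    hD.reassoc (hD.mon_str_natural b e v), hD.comp_assoc, ← hD.comp_assoc ((mon D b).map (e ⊠ v)),
    ← mon_map_comp hD, hD.reassoc (hD.symm_natural _ _), hD.comp_assoc]

theorem id_tmap_monLet (b : Bool) {P W W' C : D.Obj} (e : D.Hom W W')
    (h : D.Hom (D.tens P W') ((mon D b).obj C)) :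
    (D.id _ ⊠ e) ▹ monLet D b h = monLet D b ((D.id _ ⊠ e) ▹ h) := by
  rw [← hD.tmap_monLet, mon_map_id hD]

theorem monLet_map (b : Bool) {P W C C' : D.Obj} (h : D.Hom (D.tens P W) ((mon D b).obj C))
    (f : D.Hom C C') : monLet D b (h ▹ (mon D b).map f) = monLet D b h ▹ (mon D b).map f := by
  simp only [monLet, hD.comp_assoc, mon_map_comp hD, hD.mon_mu_natural]

theorem tmap_monPair (b : Bool) {P P' Q Q' : D.Obj} (v : D.Hom P P') (w : D.Hom Q Q') :
    ((mon D b).map v ⊠ (mon D b).map w) ▹ monPair D b P' Q' =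
      monPair D b P Q ▹ (mon D b).map (v ⊠ w) := by
  rw [monPair, monPair, hD.tmap_monLet, hD.mon_str_natural, hD.monLet_map]

end LCDLaws

section Lift

variable (hD : LCDLaws D)
include hD

theorem LiftRel.ret {b : Bool} {P Q : D.Obj} {R : ∀ Y, D.Hom Y P → D.Hom Y Q → Prop} {X : D.Obj}
    {f : D.Hom X P} {g : D.Hom X Q} (h : R X f g) :
    LiftRel b R X (f ▹ (mon D b).eta P) (g ▹ (mon D b).eta Q) :=
  ⟨X, (mon D b).eta X, f, g, hD.mon_eta_natural b f, hD.mon_eta_natural b g, h⟩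

theorem LiftRel.monLet {b : Bool} {P Q C C' W W' : D.Obj}
    {R : ∀ Y, D.Hom Y P → D.Hom Y Q → Prop} {R' : ∀ Y, D.Hom Y C → D.Hom Y C' → Prop}
    {X₁ X₂ : D.Obj} {f : D.Hom X₁ ((mon D b).obj P)} {g : D.Hom X₁ ((mon D b).obj Q)}
    {e : D.Hom X₂ W} {e' : D.Hom X₂ W'} {h : D.Hom (D.tens P W) ((mon D b).obj C)}
    {h' : D.Hom (D.tens Q W') ((mon D b).obj C')} (hf : LiftRel b R X₁ f g)
    (hh : ∀ Y v w, R Y v w → LiftRel b R' (D.tens Y X₂) ((v ⊠ e) ▹ h) ((w ⊠ e') ▹ h')) :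
    LiftRel b R' (D.tens X₁ X₂) ((f ⊠ e) ▹ monLet D b h) ((g ⊠ e') ▹ monLet D b h') := by
  obtain ⟨Y, u, v, w, rfl, rfl, hR⟩ := hf
  obtain ⟨Z, u', v', w', e₁, e₂, hR'⟩ := hh Y v w hR
  refine ⟨Z, (u ⊠ D.id _) ▹ QLamSem.monLet D b u', v', w', ?_, ?_, hR'⟩
  · rw [hD.comp_assoc, ← hD.monLet_map, ← e₁, ← hD.tmap_monLet, hD.tmap_tmap_assoc, hD.id_comp]
  · rw [hD.comp_assoc, ← hD.monLet_map, ← e₂, ← hD.tmap_monLet, hD.tmap_tmap_assoc, hD.id_comp]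

theorem LiftRel.monPair {b : Bool} {P₁ P₂ Q₁ Q₂ : D.Obj}
    {R₁ : ∀ Y, D.Hom Y P₁ → D.Hom Y Q₁ → Prop} {R₂ : ∀ Y, D.Hom Y P₂ → D.Hom Y Q₂ → Prop}
    {R : ∀ Y, D.Hom Y (D.tens P₁ P₂) → D.Hom Y (D.tens Q₁ Q₂) → Prop}
    {X₁ X₂ : D.Obj} {f₁ : D.Hom X₁ ((mon D b).obj P₁)} {g₁ : D.Hom X₁ ((mon D b).obj Q₁)}
    {f₂ : D.Hom X₂ ((mon D b).obj P₂)} {g₂ : D.Hom X₂ ((mon D b).obj Q₂)}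
    (h₁ : LiftRel b R₁ X₁ f₁ g₁) (h₂ : LiftRel b R₂ X₂ f₂ g₂)
    (hR : ∀ Y Z v v' w w', R₁ Y v v' → R₂ Z w w' → R (D.tens Y Z) (v ⊠ w) (v' ⊠ w')) :
    LiftRel b R (D.tens X₁ X₂) ((f₁ ⊠ f₂) ▹ monPair D b P₁ P₂)
      ((g₁ ⊠ g₂) ▹ monPair D b Q₁ Q₂) := by
  obtain ⟨Y, u, v, v', rfl, rfl, hv⟩ := h₁
  obtain ⟨Z, t, w, w', rfl, rfl, hw⟩ := h₂
  refine ⟨_, (u ⊠ t) ▹ QLamSem.monPair D b Y Z, v ⊠ w, v' ⊠ w', ?_, ?_, hR _ _ _ _ _ _ hv hw⟩ <;>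
  rw [hD.comp_assoc, ← hD.tmap_monPair, hD.tmap_tmap_assoc]

theorem LiftRel.bind {b : Bool} {P Q C C' : D.Obj}
    {R : ∀ Y, D.Hom Y P → D.Hom Y Q → Prop} {R' : ∀ Y, D.Hom Y C → D.Hom Y C' → Prop}
    {X : D.Obj} {f : D.Hom X ((mon D b).obj P)} {g : D.Hom X ((mon D b).obj Q)}
    {h : D.Hom P ((mon D b).obj C)} {h' : D.Hom Q ((mon D b).obj C')} (hf : LiftRel b R X f g)
    (hh : ∀ Y v w, R Y v w → LiftRel b R' Y (v ▹ h) (w ▹ h')) :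
    LiftRel b R' X (f ▹ (mon D b).map h ▹ (mon D b).mu C)
      (g ▹ (mon D b).map h' ▹ (mon D b).mu C') := by
  obtain ⟨Y, u, v, w, rfl, rfl, hR⟩ := hf
  obtain ⟨Z, u', v', w', e₁, e₂, hR'⟩ := hh Y v w hR
  refine ⟨Z, u ▹ (mon D b).map u' ▹ (mon D b).mu Z, v', w', ?_, ?_, hR'⟩
  · rw [hD.comp_assoc, ← hD.comp_assoc ((mon D b).map v), ← mon_map_comp hD, e₁,
      mon_map_comp hD, hD.comp_assoc, hD.mon_mu_natural]; simp only [hD.comp_assoc]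
  · rw [hD.comp_assoc, ← hD.comp_assoc ((mon D b).map w), ← mon_map_comp hD, e₂,
      mon_map_comp hD, hD.comp_assoc, hD.mon_mu_natural]; simp only [hD.comp_assoc]

end Lift

end Monad

section Tensor

variable {D : LCDData} (hD : LCDLaws D) {Θ : ℕ → D.Obj}
include hD

theorem LogRel.tensor {n m : ℕ} {A₁ A₂ B₁ B₂ : Ty} {Y Z : D.Obj}
    {f₁ : D.Hom Y (denTy D Θ (bangN n A₁))} {g₁ : D.Hom Y (denTy D Θ (bangN m B₁))}
    {f₂ : D.Hom Z (denTy D Θ (bangN n A₂))} {g₂ : D.Hom Z (denTy D Θ (bangN m B₂))}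
    (h₁ : LogRel Θ _ _ Y f₁ g₁) (h₂ : LogRel Θ _ _ Z f₂ g₂) :
    LogRel Θ (bangN n (.tensor A₁ A₂)) (bangN m (.tensor B₁ B₂)) (D.tens Y Z)
      ((f₁ ⊠ f₂) ▹ m2nD D Θ n A₁ A₂) ((g₁ ⊠ g₂) ▹ m2nD D Θ m B₁ B₂) := by
  obtain ⟨Y, u, f₁, g₁, rfl, rfl, h₁, hY⟩ := h₁.factor hD
  obtain ⟨Z, t, f₂, g₂, rfl, rfl, h₂, hZ⟩ := h₂.factor hD
  have hb : 0 < n + m → ∀ A B, (bangN n A).IsBang ∨ (bangN m B).IsBang := fun h A B =>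
    (Nat.eq_zero_or_pos n).elim (fun hn => .inr (isBang_bangN B (by omega)))
      (fun hn => .inl (isBang_bangN A hn))
  have hY' : 0 < n + m → Coalg D Y := fun h => hY (hb h _ _)
  have hZ' : 0 < n + m → Coalg D Z := fun h => hZ (hb h _ _)
  rw [← hD.tmap_tmap, ← hD.tmap_tmap, hD.comp_assoc, hD.comp_assoc]
  refine LogRel.precomp hD _ ((logRel_bangN hD (fun h => hD.coalg_tens (hY' h) (hZ' h)) _ _).2 ?_)
  rw [hD.comp_assoc, hD.comp_assoc, m2nD_collD hD, m2nD_collD hD, LogRel]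
  refine ⟨Y, Z, D.id _, f₁ ▹ collD Θ n A₁, f₂ ▹ collD Θ n A₂, g₁ ▹ collD Θ m B₁,
    g₂ ▹ collD Θ m B₂, ?_, ?_, (logRel_bangN hD hY' _ _).1 h₁, (logRel_bangN hD hZ' _ _).1 h₂⟩ <;>
  rw [hD.id_comp, hD.tmap_tmap]

theorem m2n_m2nInv (n : ℕ) (X Y : D.Obj) : m2n D n X Y ▹ m2nInv D n X Y = D.id _ := by
  induction n with
  | zero => exact hD.id_comp _
  | succ n ih =>
    rw [m2n, m2nInv, hD.comp_assoc, hD.reassoc (hD.Lmap_comp _ _).symm, ih, hD.Lmap_id,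
      hD.id_comp, hD.m2_iso₁]

theorem m2nD_m2nDInv (n : ℕ) (A B : Ty) : m2nD D Θ n A B ▹ m2nDInv D Θ n A B = D.id _ := by
  have h : ∀ {P P' Q Q' : D.Obj} (e : P = P') (e' : Q = Q') (f : D.Hom P Q) (g : D.Hom Q P),
      f ▹ g = D.id P → D.castHom e e' f ▹ D.castHom e' e g = D.id P' := by
    intro P P' Q Q' e e' f g h
    subst e e'
    exact h
  exact h _ _ _ _ (m2n_m2nInv hD n _ _)

theorem collD_tmap_ext {n : ℕ} {A B : Ty} {X : D.Obj} (hX : 0 < n → Coalg D X)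
    {f g : D.Hom X (D.tens (denTy D Θ (bangN n A)) (denTy D Θ (bangN n B)))}
    (h : f ▹ (collD Θ n A ⊠ collD Θ n B) = g ▹ (collD Θ n A ⊠ collD Θ n B)) : f = g := by
  have e : f ▹ m2nD D Θ n A B = g ▹ m2nD D Θ n A B := by
    refine collD_ext hD Θ hX ?_
    rw [hD.comp_assoc, hD.comp_assoc, m2nD_collD hD, h]
  rw [← hD.comp_id f, ← m2nD_m2nDInv hD, ← hD.comp_assoc, e, hD.comp_assoc, m2nD_m2nDInv hD,
    hD.comp_id]

theorem LogRel.tensor_elim {n m : ℕ} {A₁ A₂ B₁ B₂ : Ty} {X : D.Obj}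
    {f : D.Hom X (denTy D Θ (bangN n (.tensor A₁ A₂)))}
    {g : D.Hom X (denTy D Θ (bangN m (.tensor B₁ B₂)))} (h : LogRel Θ _ _ X f g) :
    ∃ (Y Z : D.Obj) (u : D.Hom X (D.tens Y Z)) (f₁ : D.Hom Y (denTy D Θ (bangN n A₁)))
      (f₂ : D.Hom Z (denTy D Θ (bangN n A₂))) (g₁ : D.Hom Y (denTy D Θ (bangN m B₁)))
      (g₂ : D.Hom Z (denTy D Θ (bangN m B₂))),
      f ▹ m2nDInv D Θ n A₁ A₂ = u ▹ (f₁ ⊠ f₂) ∧ g ▹ m2nDInv D Θ m B₁ B₂ = u ▹ (g₁ ⊠ g₂) ∧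
      LogRel Θ _ _ Y f₁ g₁ ∧ LogRel Θ _ _ Z f₂ g₂ := by
  obtain ⟨X', w, f, g, rfl, rfl, h, hX⟩ := h.factor hD
  have hX' : 0 < n + m → Coalg D X' := fun h => hX <|
    (Nat.eq_zero_or_pos n).elim (fun hn => .inr (isBang_bangN _ (by omega)))
      (fun hn => .inl (isBang_bangN _ hn))
  have hc := (logRel_bangN hD hX' _ _).1 h
  rw [LogRel] at hc
  obtain ⟨Y, Z, u, a₁, a₂, b₁, b₂, ha, hb, h₁, h₂⟩ := hc
  obtain ⟨Y', Z', u', y, z, rfl, hY, hZ⟩ : ∃ (Y' Z' : D.Obj) (u' : D.Hom X' (D.tens Y' Z'))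
      (y : D.Hom Y' Y) (z : D.Hom Z' Z), u = u' ▹ (y ⊠ z) ∧ (0 < n + m → Coalg D Y') ∧
      (0 < n + m → Coalg D Z') := by
    by_cases hp : 0 < n + m
    · obtain ⟨t, rfl⟩ := hD.coalg_lift (hX' hp) u
      refine ⟨_, _, t ▹ D.m2Inv Y Z, D.eps Y, D.eps Z, ?_, fun _ => hD.coalg_bang Y,
        fun _ => hD.coalg_bang Z⟩
      rw [← hD.eps_monoidal, hD.comp_assoc, hD.reassoc_id (hD.m2_iso₂ Y Z)]
    · exact ⟨Y, Z, u, D.id Y, D.id Z, by rw [hD.tmap_id, hD.comp_id], fun h => absurd h hp,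
        fun h => absurd h hp⟩
  obtain ⟨f₁, hf₁⟩ := collD_lift hD Θ (n := n) (fun hn => hY (by omega)) (y ▹ a₁)
  obtain ⟨f₂, hf₂⟩ := collD_lift hD Θ (n := n) (fun hn => hZ (by omega)) (z ▹ a₂)
  obtain ⟨g₁, hg₁⟩ := collD_lift hD Θ (n := m) (fun hn => hY (by omega)) (y ▹ b₁)
  obtain ⟨g₂, hg₂⟩ := collD_lift hD Θ (n := m) (fun hn => hZ (by omega)) (z ▹ b₂)
  refine ⟨Y', Z', w ▹ u', f₁, f₂, g₁, g₂, ?_, ?_, ?_, ?_⟩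
  · rw [hD.comp_assoc, hD.comp_assoc]
    congr 1
    refine collD_tmap_ext hD (fun hn => hX' (by omega)) ?_
    rw [hD.comp_assoc, m2nDInv_collD hD, ha, hD.comp_assoc, hD.comp_assoc, hD.tmap_tmap,
      hD.tmap_tmap, hf₁, hf₂]
  · rw [hD.comp_assoc, hD.comp_assoc]
    congr 1
    refine collD_tmap_ext hD (fun hn => hX' (by omega)) ?_
    rw [hD.comp_assoc, m2nDInv_collD hD, hb, hD.comp_assoc, hD.comp_assoc, hD.tmap_tmap,
      hD.tmap_tmap, hg₁, hg₂]
  · rw [logRel_bangN hD hY, hf₁, hg₁]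
    exact h₁.precomp hD y
  · rw [logRel_bangN hD hZ, hf₂, hg₂]
    exact h₂.precomp hD z

end Tensor

/-- The interpretation of a variable that is used (`some A`) or not (`none`). -/
@[reducible] def denSlot (D : LCDData) (Θ : ℕ → D.Obj) : Option Ty → D.Obj
  | none => D.unit
  | some A => denTy D Θ A

/-- The interpretation of the used part of an environment. -/
@[reducible] def denSlots (D : LCDData) (Θ : ℕ → D.Obj) : List (Option Ty) → D.Obj
  | [] => D.unit
  | o :: S => D.tens (denSlot D Θ o) (denSlots D Θ S)

section Judgement

variable {D : LCDData}

/-- None of the variables is used; the arrows are the two canonical isomorphisms with `⊤`. -/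
inductive Unused (Θ : ℕ → D.Obj) : List ℕ → (S : List (Option Ty)) →
    D.Hom D.unit (denSlots D Θ S) → D.Hom (denSlots D Θ S) D.unit → Prop
  | nil : Unused Θ [] [] (D.id D.unit) (D.id D.unit)
  | cons (x : ℕ) {N : List ℕ} {S : List (Option Ty)} {u : D.Hom D.unit (denSlots D Θ S)}
      {c : D.Hom (denSlots D Θ S) D.unit} : Unused Θ N S u c →
      Unused Θ (x :: N) (none :: S) (D.lunitInv D.unit ▹ (D.id D.unit ⊠ u))
        ((D.id D.unit ⊠ c) ▹ D.lunit D.unit)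

/-- Only the innermost variable named `x` is used, with the given projection. -/
inductive Select (Θ : ℕ → D.Obj) (x : ℕ) (A : Ty) : List ℕ → (S : List (Option Ty)) →
    D.Hom (denSlots D Θ S) (denTy D Θ A) → Prop
  | here {N : List ℕ} {S : List (Option Ty)} {u : D.Hom D.unit (denSlots D Θ S)}
      {c : D.Hom (denSlots D Θ S) D.unit} : Unused Θ N S u c →
      Select Θ x A (x :: N) (some A :: S) ((D.id _ ⊠ c) ▹ D.runit _)
  | there {y : ℕ} {N : List ℕ} {S : List (Option Ty)}
      {p : D.Hom (denSlots D Θ S) (denTy D Θ A)} : y ≠ x → Select Θ x A N S p →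
      Select Θ x A (y :: N) (none :: S) (D.lunit _ ▹ p)

/-- The distribution of a variable over two subterms. -/
inductive SplitSlot (Θ : ℕ → D.Obj) : (o₁ o₂ o : Option Ty) →
    D.Hom (denSlot D Θ o) (D.tens (denSlot D Θ o₁) (denSlot D Θ o₂)) → Prop
  | neither : SplitSlot Θ none none none (D.lunitInv D.unit)
  | left (A : Ty) : SplitSlot Θ (some A) none (some A) (D.runitInv _)
  | right (A : Ty) : SplitSlot Θ none (some A) (some A) (D.lunitInv _)
  | both (A : Ty) : SplitSlot Θ (some (.bang A)) (some (.bang A)) (some (.bang A)) (D.dup _)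

/-- The distribution of an environment over two subterms. -/
inductive SplitSlots (Θ : ℕ → D.Obj) : (S₁ S₂ S : List (Option Ty)) →
    D.Hom (denSlots D Θ S) (D.tens (denSlots D Θ S₁) (denSlots D Θ S₂)) → Prop
  | nil : SplitSlots Θ [] [] [] (D.lunitInv D.unit)
  | cons {o₁ o₂ o : Option Ty}
      {k : D.Hom (denSlot D Θ o) (D.tens (denSlot D Θ o₁) (denSlot D Θ o₂))}
      {S₁ S₂ S : List (Option Ty)}
      {m : D.Hom (denSlots D Θ S) (D.tens (denSlots D Θ S₁) (denSlots D Θ S₂))} :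
      SplitSlot Θ o₁ o₂ o k → SplitSlots Θ S₁ S₂ S m →
      SplitSlots Θ (o₁ :: S₁) (o₂ :: S₂) (o :: S) ((k ⊠ m) ▹ mid4 D _ _ _ _)

/-- The use of a variable of type `A`, which may be dropped if `A` is a `!`-type. -/
inductive BindSlot (Θ : ℕ → D.Obj) : (A : Ty) → (o : Option Ty) →
    D.Hom (denTy D Θ A) (denSlot D Θ o) → Prop
  | use (A : Ty) : BindSlot Θ A (some A) (D.id _)
  | drop (A : Ty) : BindSlot Θ (.bang A) none (D.disc _)

/-- All used variables have `!`-types. -/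
def Banged (S : List (Option Ty)) : Prop := ∀ A, some A ∈ S → A.IsBang

/-- `Den I b N P S A f`: the arrow `f` is the interpretation (computational for `b = true`, value
for `b = false`) of an indexed term of type `A` with erasure `P` in an environment with variable
names `N`, restricted to its used part `S`. -/
inductive Den {cty : ℕ → Ty} (I : Interp D cty) : (b : Bool) → List ℕ → PTm →
    (S : List (Option Ty)) → (A : Ty) →
    D.Hom (denSlots D I.obj S) ((mon D b).obj (denTy D I.obj A)) → Prop
  | var {b : Bool} {N : List ℕ} {x : ℕ} {S : List (Option Ty)} {A B : Ty}
      {p : D.Hom (denSlots D I.obj S) (denTy D I.obj A)} (s : SubD A B) :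
      Select I.obj x A N S p →
      Den I b N (.var x) S B ((p ▹ Isub D I.obj s) ▹ (mon D b).eta _)
  | cst {b : Bool} {N : List ℕ} {k : ℕ} {S : List (Option Ty)} {B : Ty}
      {u : D.Hom D.unit (denSlots D I.obj S)} {c : D.Hom (denSlots D I.obj S) D.unit}
      (s : SubD (.bang (cty k)) B) : Unused I.obj N S u c →
      Den I b N (.cst k) S B ((c ▹ I.cst k ▹ Isub D I.obj s) ▹ (mon D b).eta _)
  | star {b : Bool} {N : List ℕ} {S : List (Option Ty)} (n : ℕ)
      {u : D.Hom D.unit (denSlots D I.obj S)} {c : D.Hom (denSlots D I.obj S) D.unit}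
      {q : D.Hom (denSlots D I.obj S) (denTy D I.obj (bangN n .unit))} : Unused I.obj N S u c →
      q ▹ collD I.obj n .unit = c →
      Den I b N .star S (bangN n .unit) (q ▹ (mon D b).eta _)
  | lam {b : Bool} {N : List ℕ} {x : ℕ} {P : PTm} {S : List (Option Ty)} {o : Option Ty} (n : ℕ)
      {A B : Ty} {k : D.Hom (denTy D I.obj A) (denSlot D I.obj o)}
      {g : D.Hom (denSlots D I.obj (o :: S)) (D.T (denTy D I.obj B))}
      {q : D.Hom (denSlots D I.obj S) (denTy D I.obj (bangN n (.arrow A B)))} :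
      (0 < n → Banged S) → Den I true (x :: N) P (o :: S) B g → BindSlot I.obj A o k →
      q ▹ collD I.obj n (.arrow A B) = D.PhiInv (D.symm _ _ ▹ (k ⊠ D.id _) ▹ g) →
      Den I b N (.lam x P) S (bangN n (.arrow A B)) (q ▹ (mon D b).eta _)
  | app {N : List ℕ} {P Q : PTm} {S₁ S₂ S : List (Option Ty)} {A B : Ty}
      {m : D.Hom (denSlots D I.obj S) (D.tens (denSlots D I.obj S₁) (denSlots D I.obj S₂))}
      {f : D.Hom (denSlots D I.obj S₁) (D.T (denTy D I.obj (.arrow A B)))}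
      {g : D.Hom (denSlots D I.obj S₂) (D.T (denTy D I.obj A))} :
      SplitSlots I.obj S₁ S₂ S m → Den I true N P S₁ (.arrow A B) f → Den I true N Q S₂ A g →
      Den I true N (.app P Q) S B (m ▹ ((f ⊠ g) ▹ monPair D true _ _) ▹
        D.Tmap (D.appnt (denTy D I.obj A) (denTy D I.obj B)) ▹ D.mu _)
  | pair {b : Bool} {N : List ℕ} {P Q : PTm} {S₁ S₂ S : List (Option Ty)} (n : ℕ) {A₁ A₂ : Ty}
      {m : D.Hom (denSlots D I.obj S) (D.tens (denSlots D I.obj S₁) (denSlots D I.obj S₂))}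
      {f : D.Hom (denSlots D I.obj S₁) ((mon D b).obj (denTy D I.obj (bangN n A₁)))}
      {g : D.Hom (denSlots D I.obj S₂) ((mon D b).obj (denTy D I.obj (bangN n A₂)))} :
      SplitSlots I.obj S₁ S₂ S m → Den I b N P S₁ (bangN n A₁) f →
      Den I b N Q S₂ (bangN n A₂) g →
      Den I b N (.pair P Q) S (bangN n (.tensor A₁ A₂)) (m ▹ ((f ⊠ g) ▹ monPair D b _ _) ▹
        (mon D b).map (m2nD D I.obj n A₁ A₂))
  | letv {b : Bool} {N : List ℕ} {x : ℕ} {P Q : PTm} {S₁ S₂ S : List (Option Ty)}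
      {o : Option Ty} {A B : Ty}
      {m : D.Hom (denSlots D I.obj S) (D.tens (denSlots D I.obj S₁) (denSlots D I.obj S₂))}
      {f : D.Hom (denSlots D I.obj S₁) ((mon D b).obj (denTy D I.obj A))}
      {k : D.Hom (denTy D I.obj A) (denSlot D I.obj o)}
      {g : D.Hom (denSlots D I.obj (o :: S₂)) ((mon D b).obj (denTy D I.obj B))} :
      SplitSlots I.obj S₁ S₂ S m → Den I b N P S₁ A f → Den I b (x :: N) Q (o :: S₂) B g →
      BindSlot I.obj A o k →
      Den I b N (.letv x P Q) S B (m ▹ (f ⊠ D.id _) ▹ monLet D b ((k ⊠ D.id _) ▹ g))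
  | letUnit {b : Bool} {N : List ℕ} {P Q : PTm} {S₁ S₂ S : List (Option Ty)} {B : Ty}
      {m : D.Hom (denSlots D I.obj S) (D.tens (denSlots D I.obj S₁) (denSlots D I.obj S₂))}
      {f : D.Hom (denSlots D I.obj S₁) ((mon D b).obj (denTy D I.obj .unit))}
      {g : D.Hom (denSlots D I.obj S₂) ((mon D b).obj (denTy D I.obj B))} :
      SplitSlots I.obj S₁ S₂ S m → Den I b N P S₁ .unit f → Den I b N Q S₂ B g →
      Den I b N (.letUnit P Q) S B (m ▹ (f ⊠ D.id _) ▹ monLet D b (D.lunit _ ▹ g))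
  | letPair {b : Bool} {N : List ℕ} {x₁ x₂ : ℕ} {P Q : PTm} {S₁ S₂ S : List (Option Ty)}
      {o₁ o₂ : Option Ty} (n : ℕ) {A₁ A₂ B : Ty}
      {m : D.Hom (denSlots D I.obj S) (D.tens (denSlots D I.obj S₁) (denSlots D I.obj S₂))}
      {f : D.Hom (denSlots D I.obj S₁) ((mon D b).obj (denTy D I.obj (bangN n (.tensor A₁ A₂))))}
      {k₁ : D.Hom (denTy D I.obj (bangN n A₁)) (denSlot D I.obj o₁)}
      {k₂ : D.Hom (denTy D I.obj (bangN n A₂)) (denSlot D I.obj o₂)}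
      {g : D.Hom (denSlots D I.obj (o₁ :: o₂ :: S₂)) ((mon D b).obj (denTy D I.obj B))} :
      SplitSlots I.obj S₁ S₂ S m → Den I b N P S₁ (bangN n (.tensor A₁ A₂)) f →
      Den I b (x₁ :: x₂ :: N) Q (o₁ :: o₂ :: S₂) B g →
      BindSlot I.obj (bangN n A₁) o₁ k₁ → BindSlot I.obj (bangN n A₂) o₂ k₂ →
      Den I b N (.letPair x₁ x₂ P Q) S B (m ▹ (f ⊠ D.id _) ▹ monLet D b
        ((m2nDInv D I.obj n A₁ A₂ ⊠ D.id _) ▹ D.assoc _ _ _ ▹ (k₁ ⊠ k₂ ⊠ D.id _) ▹ g))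

/-- Which of the variables named `N` occur free in `P`. -/
def usedVars : PTm → List ℕ → List Bool
  | .var _, [] => []
  | .var x, y :: N => if y = x then true :: N.map (fun _ => false) else false :: usedVars (.var x) N
  | .cst _, N => N.map fun _ => false
  | .star, N => N.map fun _ => false
  | .lam x P, N => (usedVars P (x :: N)).tail
  | .app P Q, N => List.zipWith (· || ·) (usedVars P N) (usedVars Q N)
  | .pair P Q, N => List.zipWith (· || ·) (usedVars P N) (usedVars Q N)
  | .letv x P Q, N => List.zipWith (· || ·) (usedVars P N) (usedVars Q (x :: N)).tail
  | .letPair x y P Q, N =>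
      List.zipWith (· || ·) (usedVars P N) (usedVars Q (x :: y :: N)).tail.tail
  | .letUnit P Q, N => List.zipWith (· || ·) (usedVars P N) (usedVars Q N)

theorem Unused.isSome_eq {Θ : ℕ → D.Obj} {N : List ℕ} {S : List (Option Ty)}
    {u : D.Hom D.unit (denSlots D Θ S)} {c : D.Hom (denSlots D Θ S) D.unit}
    (h : Unused Θ N S u c) : S.map Option.isSome = N.map fun _ => false := by
  induction h with
  | nil => rfl
  | cons x _ ih => simp [ih]

theorem Select.isSome_eq {Θ : ℕ → D.Obj} {x : ℕ} {A : Ty} {N : List ℕ} {S : List (Option Ty)}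
    {p : D.Hom (denSlots D Θ S) (denTy D Θ A)} (h : Select Θ x A N S p) :
    S.map Option.isSome = usedVars (.var x) N := by
  induction h with
  | here h => simp [usedVars, h.isSome_eq]
  | there h _ ih => simp [usedVars, h, ih]

theorem SplitSlots.isSome_eq {Θ : ℕ → D.Obj} {S₁ S₂ S : List (Option Ty)}
    {m : D.Hom (denSlots D Θ S) (D.tens (denSlots D Θ S₁) (denSlots D Θ S₂))}
    (h : SplitSlots Θ S₁ S₂ S m) : S.map Option.isSome =
      List.zipWith (· || ·) (S₁.map Option.isSome) (S₂.map Option.isSome) := by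
  induction h with
  | nil => rfl
  | cons h _ ih => cases h <;> simp [ih]

theorem Den.isSome_eq {cty : ℕ → Ty} {I : Interp D cty} {b : Bool} {N : List ℕ} {P : PTm}
    {S : List (Option Ty)} {A : Ty}
    {f : D.Hom (denSlots D I.obj S) ((mon D b).obj (denTy D I.obj A))} (h : Den I b N P S A f) :
    S.map Option.isSome = usedVars P N := by
  induction h with
  | var _ h => exact h.isSome_eq
  | cst _ h => rw [usedVars]; exact h.isSome_eq
  | star _ h => rw [usedVars]; exact h.isSome_eq
  | lam _ _ _ _ _ ih => rw [usedVars, ← ih]; rfl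
  | app h _ _ ih₁ ih₂ => rw [h.isSome_eq, usedVars, ih₁, ih₂]
  | pair _ h _ _ ih₁ ih₂ => rw [h.isSome_eq, usedVars, ih₁, ih₂]
  | letv h _ _ _ ih₁ ih₂ => rw [h.isSome_eq, usedVars, ih₁, ← ih₂]; rfl
  | letUnit h _ _ ih₁ ih₂ => rw [h.isSome_eq, usedVars, ih₁, ih₂]
  | letPair _ h _ _ _ _ ih₁ ih₂ => rw [h.isSome_eq, usedVars, ih₁, ← ih₂]; rfl

end Judgement

section Fundamental

variable {D : LCDData}

/-- The logical relation on the interpretations of a used or unused variable. -/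
inductive SlotRel (Θ : ℕ → D.Obj) : (X : D.Obj) → (o o' : Option Ty) →
    D.Hom X (denSlot D Θ o) → D.Hom X (denSlot D Θ o') → Prop
  | none : SlotRel Θ D.unit none none (D.id _) (D.id _)
  | some {X : D.Obj} {A A' : Ty} {v : D.Hom X (denTy D Θ A)} {w : D.Hom X (denTy D Θ A')} :
      LogRel Θ A A' X v w → (A.IsBang ∨ A'.IsBang → Coalg D X) →
      SlotRel Θ X (some A) (some A') v w

/-- The logical relation on the interpretations of environments. -/
inductive EnvRel (Θ : ℕ → D.Obj) : (X : D.Obj) → (S S' : List (Option Ty)) →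
    D.Hom X (denSlots D Θ S) → D.Hom X (denSlots D Θ S') → Prop
  | nil : EnvRel Θ D.unit [] [] (D.id _) (D.id _)
  | cons {X Y : D.Obj} {o o' : Option Ty} {S S' : List (Option Ty)}
      {v : D.Hom X (denSlot D Θ o)} {v' : D.Hom X (denSlot D Θ o')}
      {e : D.Hom Y (denSlots D Θ S)} {e' : D.Hom Y (denSlots D Θ S')} :
      SlotRel Θ X o o' v v' → EnvRel Θ Y S S' e e' →
      EnvRel Θ (D.tens X Y) (o :: S) (o' :: S') (v ⊠ e) (v' ⊠ e')

namespace LCDLaws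

variable (hD : LCDLaws D)
include hD

theorem lunitInv_natural {A B : D.Obj} (f : D.Hom A B) :
    f ▹ D.lunitInv B = D.lunitInv A ▹ (D.id D.unit ⊠ f) := by
  rw [← hD.comp_id (D.id D.unit ⊠ f), ← hD.lunit_iso₁, hD.reassoc (hD.lunit_natural f),
    hD.comp_assoc, hD.reassoc_id (hD.lunit_iso₂ A)]

theorem runitInv_natural {A B : D.Obj} (f : D.Hom A B) :
    f ▹ D.runitInv B = D.runitInv A ▹ (f ⊠ D.id D.unit) := by
  rw [← hD.comp_id (f ⊠ D.id D.unit), ← hD.runit_iso₁, hD.reassoc (hD.runit_natural f),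
    hD.comp_assoc, hD.reassoc_id (hD.runit_iso₂ A)]

end LCDLaws

variable (hD : LCDLaws D) {Θ : ℕ → D.Obj}
include hD

theorem SlotRel.split {X : D.Obj} {o o' o₁ o₂ o₁' o₂' : Option Ty}
    {v : D.Hom X (denSlot D Θ o)} {v' : D.Hom X (denSlot D Θ o')} (h : SlotRel Θ X o o' v v')
    {k : D.Hom (denSlot D Θ o) (D.tens (denSlot D Θ o₁) (denSlot D Θ o₂))}
    {k' : D.Hom (denSlot D Θ o') (D.tens (denSlot D Θ o₁') (denSlot D Θ o₂'))}
    (hk : SplitSlot Θ o₁ o₂ o k) (hk' : SplitSlot Θ o₁' o₂' o' k') (h₁ : o₁.isSome = o₁'.isSome)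
    (h₂ : o₂.isSome = o₂'.isSome) :
    ∃ (X₁ X₂ : D.Obj) (w : D.Hom X (D.tens X₁ X₂)) (v₁ : D.Hom X₁ (denSlot D Θ o₁))
      (v₁' : D.Hom X₁ (denSlot D Θ o₁')) (v₂ : D.Hom X₂ (denSlot D Θ o₂))
      (v₂' : D.Hom X₂ (denSlot D Θ o₂')), SlotRel Θ X₁ o₁ o₁' v₁ v₁' ∧
      SlotRel Θ X₂ o₂ o₂' v₂ v₂' ∧ v ▹ k = w ▹ (v₁ ⊠ v₂) ∧ v' ▹ k' = w ▹ (v₁' ⊠ v₂') := by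
  cases hk with
  | neither =>
    cases h
    cases hk'
    exact ⟨_, _, D.lunitInv _, _, _, _, _, .none, .none, by rw [hD.lunitInv_natural],
      by rw [hD.lunitInv_natural]⟩
  | left A =>
    cases hk' <;> simp only [Option.isSome_some, Option.isSome_none, reduceCtorEq] at h₁ h₂
    exact ⟨_, _, D.runitInv _, _, _, _, _, h, .none, hD.runitInv_natural _,
      hD.runitInv_natural _⟩
  | right A =>
    cases hk' <;> simp only [Option.isSome_some, Option.isSome_none, reduceCtorEq] at h₁ h₂
    exact ⟨_, _, D.lunitInv _, _, _, _, _, .none, h, hD.lunitInv_natural _,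
      hD.lunitInv_natural _⟩
  | both A =>
    cases hk' <;> simp only [Option.isSome_some, Option.isSome_none, reduceCtorEq] at h₁ h₂
    obtain ⟨⟩ | ⟨hR, hX⟩ := h
    obtain ⟨d, hd⟩ := hD.coalg_dup (hX (.inl trivial))
    exact ⟨_, _, d, _, _, _, _, .some hR hX, .some hR hX, hd _, hd _⟩

theorem EnvRel.split {X : D.Obj} {S S' S₁ S₂ S₁' S₂' : List (Option Ty)}
    {e : D.Hom X (denSlots D Θ S)} {e' : D.Hom X (denSlots D Θ S')} (h : EnvRel Θ X S S' e e')
    {m : D.Hom (denSlots D Θ S) (D.tens (denSlots D Θ S₁) (denSlots D Θ S₂))}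
    {m' : D.Hom (denSlots D Θ S') (D.tens (denSlots D Θ S₁') (denSlots D Θ S₂'))}
    (hm : SplitSlots Θ S₁ S₂ S m) (hm' : SplitSlots Θ S₁' S₂' S' m')
    (h₁ : S₁.map Option.isSome = S₁'.map Option.isSome)
    (h₂ : S₂.map Option.isSome = S₂'.map Option.isSome) :
    ∃ (X₁ X₂ : D.Obj) (w : D.Hom X (D.tens X₁ X₂)) (e₁ : D.Hom X₁ (denSlots D Θ S₁))
      (e₁' : D.Hom X₁ (denSlots D Θ S₁')) (e₂ : D.Hom X₂ (denSlots D Θ S₂))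
      (e₂' : D.Hom X₂ (denSlots D Θ S₂')), EnvRel Θ X₁ S₁ S₁' e₁ e₁' ∧
      EnvRel Θ X₂ S₂ S₂' e₂ e₂' ∧ e ▹ m = w ▹ (e₁ ⊠ e₂) ∧ e' ▹ m' = w ▹ (e₁' ⊠ e₂') := by
  induction h generalizing S₁ S₂ S₁' S₂' with
  | nil =>
    cases hm
    cases hm'
    exact ⟨_, _, D.lunitInv _, _, _, _, _, .nil, .nil, hD.lunitInv_natural _,
      hD.lunitInv_natural _⟩
  | cons hv _ ih =>
    obtain _ | ⟨hk, hm⟩ := hm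
    obtain _ | ⟨hk', hm'⟩ := hm'
    simp only [List.map_cons, List.cons.injEq] at h₁ h₂
    obtain ⟨Z₁, Z₂, w, v₁, v₁', v₂, v₂', hv₁, hv₂, ev, ev'⟩ := hv.split hD hk hk' h₁.1 h₂.1
    obtain ⟨X₁, X₂, t, e₁, e₁', e₂, e₂', he₁, he₂, ee, ee'⟩ := ih hm hm' h₁.2 h₂.2
    refine ⟨_, _, (w ⊠ t) ▹ mid4 D Z₁ Z₂ X₁ X₂, _, _, _, _, .cons hv₁ he₁, .cons hv₂ he₂, ?_, ?_⟩
    · rw [hD.tmap_tmap_assoc, ev, ee, hD.comp_assoc, ← hD.mid4_natural, hD.tmap_tmap_assoc]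
    · rw [hD.tmap_tmap_assoc, ev', ee', hD.comp_assoc, ← hD.mid4_natural, hD.tmap_tmap_assoc]

theorem EnvRel.coalg {X : D.Obj} {S S' : List (Option Ty)}
    {e : D.Hom X (denSlots D Θ S)} {e' : D.Hom X (denSlots D Θ S')} (h : EnvRel Θ X S S' e e')
    (hS : Banged S ∨ Banged S') : Coalg D X := by
  induction h with
  | nil => exact hD.coalg_unit
  | cons hv _ ih =>
    refine hD.coalg_tens ?_ (ih (hS.imp (fun h A hA => h A (List.mem_cons_of_mem _ hA))
      (fun h A hA => h A (List.mem_cons_of_mem _ hA))))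
    cases hv with
    | none => exact hD.coalg_unit
    | some _ hX => exact hX (hS.imp (fun h => h _ (List.mem_cons_self ..))
        (fun h => h _ (List.mem_cons_self ..)))

theorem EnvRel.unused {X : D.Obj} {N : List ℕ} {S S' : List (Option Ty)}
    {e : D.Hom X (denSlots D Θ S)} {e' : D.Hom X (denSlots D Θ S')} (h : EnvRel Θ X S S' e e')
    {u : D.Hom D.unit (denSlots D Θ S)} {c : D.Hom (denSlots D Θ S) D.unit}
    (hu : Unused Θ N S u c) (c' : D.Hom (denSlots D Θ S') D.unit) :
    Coalg D X ∧ e ▹ c = e' ▹ c' := by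
  have hS : ∀ {N S u c}, Unused Θ N S u c → none :: S = List.replicate (S.length + 1) none := by
    intro N S u c h
    induction h with
    | nil => rfl
    | cons x _ ih => rw [ih]; simp [List.replicate_succ]
  have hc : Coalg D X := h.coalg hD (.inl fun A hA => by
    have := List.mem_cons_of_mem none hA
    rw [hS hu, List.mem_replicate] at this
    exact absurd this.2 (by simp))
  exact ⟨hc, hD.coalg_unit_ext hc _ _⟩

theorem EnvRel.select {X : D.Obj} {N N' : List ℕ} {x x' : ℕ} {A A' : Ty}
    {S S' : List (Option Ty)}
    {e : D.Hom X (denSlots D Θ S)} {e' : D.Hom X (denSlots D Θ S')} (h : EnvRel Θ X S S' e e')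
    {p : D.Hom (denSlots D Θ S) (denTy D Θ A)} {p' : D.Hom (denSlots D Θ S') (denTy D Θ A')}
    (hp : Select Θ x A N S p) (hp' : Select Θ x' A' N' S' p') :
    LogRel Θ A A' X (e ▹ p) (e' ▹ p') := by
  induction h generalizing N N' with
  | nil => cases hp
  | cons hv he ih =>
    cases hp with
    | here hu =>
      obtain _ | ⟨hR, hX⟩ := hv
      cases hp' with
      | here hu' =>
        obtain ⟨-, hc⟩ := he.unused hD hu _
        have aux : ∀ {X Y V W : D.Obj} (v : D.Hom X V) (e : D.Hom Y W) (c : D.Hom W D.unit),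
            (v ⊠ e) ▹ (D.id V ⊠ c) ▹ D.runit V = ((D.id X ⊠ (e ▹ c)) ▹ D.runit X) ▹ v := by
          intro X Y V W v e c
          rw [hD.comp_assoc, ← hD.runit_natural, hD.tmap_tmap_assoc, hD.tmap_tmap_assoc,
            hD.comp_id, hD.comp_id, hD.id_comp]
        rw [aux, aux, hc]
        exact hR.precomp hD _
    | there _ hp =>
      cases hv
      cases hp' with
      | there _ hp' =>
        rw [hD.reassoc (hD.lunit_natural _), hD.reassoc (hD.lunit_natural _), hD.comp_assoc,
          hD.comp_assoc]
        exact (ih hp hp').precomp hD _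

theorem LogRel.bindSlot {X : D.Obj} {A A' : Ty} {o o' : Option Ty} {a : D.Hom X (denTy D Θ A)}
    {a' : D.Hom X (denTy D Θ A')} (h : LogRel Θ A A' X a a')
    {k : D.Hom (denTy D Θ A) (denSlot D Θ o)} {k' : D.Hom (denTy D Θ A') (denSlot D Θ o')}
    (hk : BindSlot Θ A o k) (hk' : BindSlot Θ A' o' k') (ho : o.isSome = o'.isSome) :
    ∃ (Z : D.Obj) (u : D.Hom X Z) (v : D.Hom Z (denSlot D Θ o)) (v' : D.Hom Z (denSlot D Θ o')),
      SlotRel Θ Z o o' v v' ∧ a ▹ k = u ▹ v ∧ a' ▹ k' = u ▹ v' := by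
  obtain ⟨Y, u, a, a', rfl, rfl, h, hY⟩ := h.factor hD
  cases hk with
  | use A =>
    cases hk' with
    | drop A' => simp at ho
    | use A' => exact ⟨Y, u, a, a', .some h hY, hD.comp_id _, hD.comp_id _⟩
  | drop A =>
    cases hk' with
    | use A' => simp at ho
    | drop A' =>
      refine ⟨D.unit, u ▹ a ▹ D.disc _, D.id _, D.id _, .none, ?_, ?_⟩
      · rw [hD.comp_id, hD.comp_assoc]
      · rw [hD.comp_id, hD.comp_assoc, hD.coalg_unit_ext (hY (.inl trivial)) (a' ▹ D.disc _) (a ▹ D.disc _)]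

end Fundamental

section FundamentalThm

variable {D : LCDData} (hD : LCDLaws D)
include hD

/-- Two interpretations of terms with the same erasure are logically related. -/
theorem Den.fundamental {cty : ℕ → Ty} {I : Interp D cty} {b : Bool} {N : List ℕ} {P : PTm}
    {S S' : List (Option Ty)} {A A' : Ty}
    {f : D.Hom (denSlots D I.obj S) ((mon D b).obj (denTy D I.obj A))}
    {f' : D.Hom (denSlots D I.obj S') ((mon D b).obj (denTy D I.obj A'))}
    (h : Den I b N P S A f) (h' : Den I b N P S' A' f') {X : D.Obj}
    {e : D.Hom X (denSlots D I.obj S)} {e' : D.Hom X (denSlots D I.obj S')}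
    (he : EnvRel I.obj X S S' e e') :
    LiftRel b (LogRel I.obj A A') X (e ▹ f) (e' ▹ f') := by
  induction h generalizing S' A' X with
  | var s hs =>
    obtain ⟨s', hs'⟩ := h'
    simp only [← hD.comp_assoc]
    exact LiftRel.ret hD ((he.select hD hs hs').cast hD s s')
  | cst s hu =>
    obtain _ | ⟨s', hu'⟩ := h'
    obtain ⟨-, hc⟩ := he.unused hD hu _
    simp only [← hD.comp_assoc, hc]
    exact LiftRel.ret hD (((logRel_self hD _ _ _).2 rfl).cast hD s s')
  | star n hu hq =>
    obtain _ | _ | ⟨n', hu', hq'⟩ := h'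
    obtain ⟨hX, hc⟩ := he.unused hD hu _
    rw [← hD.comp_assoc, ← hD.comp_assoc]
    refine LiftRel.ret hD ((logRel_bangN hD (fun _ => hX) _ _).2 ?_)
    rw [hD.comp_assoc, hq, hD.comp_assoc, hq', hc]
    exact (logRel_self hD _ _ _).2 rfl
  | lam n hS hg hk hq ih =>
    obtain _ | _ | _ | ⟨n', hS', hg', hk', hq'⟩ := h'
    rw [← hD.comp_assoc, ← hD.comp_assoc]
    refine LiftRel.ret hD ((logRel_bangN hD (fun hn => ?_) _ _).2 ?_)
    · exact he.coalg hD ((Nat.eq_zero_or_pos n).elim (fun h0 => .inr (hS' (by omega)))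
        (fun h0 => .inl (hS h0)))
    · rw [hD.comp_assoc, hq, hD.comp_assoc, hq', LogRel]
      intro Y a a' ha
      obtain ⟨Z, u, v, v', hv, ev, ev'⟩ := ha.bindSlot hD hk hk' (by
        have := hg.isSome_eq.trans hg'.isSome_eq.symm
        exact (List.cons.inj this).1)
      have aux : ∀ {o : Option Ty} {S A B a v} {e : D.Hom X (denSlots D I.obj S)}
          {k : D.Hom (denTy D I.obj A) (denSlot D I.obj o)}
          {g : D.Hom (denSlots D I.obj (o :: S)) (D.T (denTy D I.obj B))}, a ▹ k = u ▹ v →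
          ((e ▹ D.PhiInv (D.symm _ _ ▹ (k ⊠ D.id _) ▹ g)) ⊠ a) ▹ D.appnt _ _ =
            (D.symm _ Y ▹ (u ⊠ D.id _)) ▹ (v ⊠ e) ▹ g := by
        intro o S A B a v e k g h
        rw [appnt_eq hD, hD.Phi_natural_left, hD.Phi_iso₂, hD.tmap_tmap_assoc, hD.id_comp,
          hD.comp_id, hD.reassoc (hD.symm_natural _ _), hD.comp_assoc, hD.tmap_tmap_assoc, h,
          hD.comp_id, hD.comp_assoc, hD.tmap_tmap_assoc, hD.id_comp]
      rw [aux ev, aux ev']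
      exact (ih hg' (.cons hv he)).precomp hD _
  | app hm hf hg ihf ihg =>
    obtain _ | _ | _ | _ | ⟨hm', hf', hg'⟩ := h'
    obtain ⟨X₁, X₂, w, e₁, e₁', e₂, e₂', he₁, he₂, em, em'⟩ := he.split hD hm hm'
      (hf.isSome_eq.trans hf'.isSome_eq.symm) (hg.isSome_eq.trans hg'.isSome_eq.symm)
    rw [hD.comp_assoc, hD.comp_assoc, hD.reassoc em, hD.reassoc em', hD.comp_assoc,
      hD.tmap_tmap_assoc, hD.comp_assoc, hD.tmap_tmap_assoc]
    have hp := (ihf hf' he₁).monPair hD (R := fun Y v w => LiftRel true (LogRel I.obj _ _) Y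
      (v ▹ D.appnt _ _) (w ▹ D.appnt _ _)) (ihg hg' he₂) (fun Y Z v v' w w' hv hw => by
        rw [LogRel] at hv
        exact hv _ _ _ hw)
    have := (hp.bind hD fun Y v w h => h).precomp hD w
    simpa only [hD.comp_assoc] using this
  | pair n hm hf hg ihf ihg =>
    obtain _ | _ | _ | _ | _ | ⟨n', hm', hf', hg'⟩ := h'
    obtain ⟨X₁, X₂, w, e₁, e₁', e₂, e₂', he₁, he₂, em, em'⟩ := he.split hD hm hm'
      (hf.isSome_eq.trans hf'.isSome_eq.symm) (hg.isSome_eq.trans hg'.isSome_eq.symm)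
    rw [hD.comp_assoc, hD.comp_assoc, hD.reassoc em, hD.reassoc em', hD.comp_assoc,
      hD.tmap_tmap_assoc, hD.comp_assoc, hD.tmap_tmap_assoc]
    have hp := (ihf hf' he₁).monPair hD (R := fun Y v w => LogRel I.obj _ _ Y
      (v ▹ m2nD _ _ n _ _) (w ▹ m2nD _ _ n' _ _)) (ihg hg' he₂)
      (fun Y Z v v' w w' hv hw => hv.tensor hD hw)
    have := (hp.map hD fun Y v w h => h).precomp hD w
    simpa only [hD.comp_assoc] using this
  | letv hm hf hg hk ihf ihg =>
    obtain _ | _ | _ | _ | _ | _ | ⟨hm', hf', hg', hk'⟩ := h'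
    have ho := hg.isSome_eq.trans hg'.isSome_eq.symm
    simp only [List.map_cons, List.cons.injEq] at ho
    obtain ⟨X₁, X₂, w, e₁, e₁', e₂, e₂', he₁, he₂, em, em'⟩ := he.split hD hm hm'
      (hf.isSome_eq.trans hf'.isSome_eq.symm) ho.2
    rw [hD.reassoc em, hD.reassoc em', hD.comp_assoc, hD.tmap_tmap_assoc, hD.comp_assoc,
      hD.tmap_tmap_assoc, hD.comp_id, hD.comp_id]
    refine ((ihf hf' he₁).monLet hD fun Y v v' hv => ?_).precomp hD w
    obtain ⟨Z, u, a, a', ha, ev, ev'⟩ := hv.bindSlot hD hk hk' ho.1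
    rw [hD.tmap_tmap_assoc, hD.tmap_tmap_assoc, ev, ev', hD.comp_id, hD.comp_id,
      ← hD.id_comp e₂, ← hD.id_comp e₂', ← hD.tmap_tmap_assoc, ← hD.tmap_tmap_assoc]
    exact (ihg hg' (.cons ha he₂)).precomp hD _
  | letUnit hm hf hg ihf ihg =>
    obtain _ | _ | _ | _ | _ | _ | _ | ⟨hm', hf', hg'⟩ := h'
    obtain ⟨X₁, X₂, w, e₁, e₁', e₂, e₂', he₁, he₂, em, em'⟩ := he.split hD hm hm'
      (hf.isSome_eq.trans hf'.isSome_eq.symm) (hg.isSome_eq.trans hg'.isSome_eq.symm)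
    rw [hD.reassoc em, hD.reassoc em', hD.comp_assoc, hD.tmap_tmap_assoc, hD.comp_assoc,
      hD.tmap_tmap_assoc, hD.comp_id, hD.comp_id]
    refine ((ihf hf' he₁).monLet hD fun Y v v' hv => ?_).precomp hD w
    obtain rfl := (logRel_self hD _ _ _).1 hv
    rw [hD.tmap_eq_comp v e₂, hD.tmap_eq_comp v e₂', hD.comp_assoc, hD.comp_assoc,
      hD.reassoc (hD.lunit_natural _), hD.reassoc (hD.lunit_natural _), hD.comp_assoc,
      hD.comp_assoc]
    exact ((ihg hg' he₂).precomp hD _).precomp hD _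
  | letPair n hm hf hg hk₁ hk₂ ihf ihg =>
    obtain _ | _ | _ | _ | _ | _ | _ | _ | ⟨n', hm', hf', hg', hk₁', hk₂'⟩ := h'
    have ho := hg.isSome_eq.trans hg'.isSome_eq.symm
    simp only [List.map_cons, List.cons.injEq] at ho
    obtain ⟨X₁, X₂, w, e₁, e₁', e₂, e₂', he₁, he₂, em, em'⟩ := he.split hD hm hm'
      (hf.isSome_eq.trans hf'.isSome_eq.symm) ho.2.2
    rw [hD.reassoc em, hD.reassoc em', hD.comp_assoc, hD.tmap_tmap_assoc, hD.comp_assoc,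
      hD.tmap_tmap_assoc, hD.comp_id, hD.comp_id]
    refine ((ihf hf' he₁).monLet hD fun Y v v' hv => ?_).precomp hD w
    obtain ⟨Y₁, Y₂, t, f₁, f₂, f₁', f₂', ef, ef', hv₁, hv₂⟩ := hv.tensor_elim hD
    obtain ⟨Z₁, u₁, a₁, a₁', ha₁, ev₁, ev₁'⟩ := hv₁.bindSlot hD hk₁ hk₁' ho.1
    obtain ⟨Z₂, u₂, a₂, a₂', ha₂, ev₂, ev₂'⟩ := hv₂.bindSlot hD hk₂ hk₂' ho.2.1
    have aux : ∀ {o₁ o₂ : Option Ty} {S A₁ A₂ B n f₁ f₂ a₁ a₂ v}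
        {e : D.Hom X₂ (denSlots D I.obj S)}
        {k₁ : D.Hom (denTy D I.obj (bangN n A₁)) (denSlot D I.obj o₁)}
        {k₂ : D.Hom (denTy D I.obj (bangN n A₂)) (denSlot D I.obj o₂)}
        {g : D.Hom (denSlots D I.obj (o₁ :: o₂ :: S)) B},
        v ▹ m2nDInv D I.obj n A₁ A₂ = t ▹ (f₁ ⊠ f₂) → f₁ ▹ k₁ = u₁ ▹ a₁ → f₂ ▹ k₂ = u₂ ▹ a₂ →
        (v ⊠ e) ▹ (m2nDInv D I.obj n A₁ A₂ ⊠ D.id _) ▹ D.assoc _ _ _ ▹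
          (k₁ ⊠ k₂ ⊠ D.id _) ▹ g = ((t ⊠ D.id _) ▹ D.assoc _ _ _ ▹ (u₁ ⊠ u₂ ⊠ D.id _)) ▹
            (a₁ ⊠ a₂ ⊠ e) ▹ g := by
      intro o₁ o₂ S A₁ A₂ B n f₁ f₂ a₁ a₂ v e k₁ k₂ g h h₁ h₂
      rw [hD.tmap_tmap_assoc, h, hD.comp_id, ← hD.id_comp e, ← hD.tmap_tmap_assoc,
        hD.reassoc (hD.assoc_natural _ _ _), hD.comp_assoc, hD.comp_assoc, hD.comp_assoc,
        hD.tmap_tmap_assoc, hD.tmap_tmap_assoc, hD.tmap_tmap, hD.tmap_tmap, h₁, h₂, hD.comp_id,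
        hD.id_comp, hD.id_comp]
    rw [aux ef ev₁ ev₂, aux ef' ev₁' ev₂']
    exact (ihg hg' (.cons ha₁ (.cons ha₂ he₂))).precomp hD _

end FundamentalThm

section Insertion

variable {D : LCDData}

/-- Insertion of the use `o` of the variable `x` in an environment that does not use `x`. -/
inductive Ins (Θ : ℕ → D.Obj) (x : ℕ) (o : Option Ty) : List ℕ → (S S' : List (Option Ty)) →
    D.Hom (D.tens (denSlot D Θ o) (denSlots D Θ S)) (denSlots D Θ S') → Prop
  | here {N : List ℕ} {S : List (Option Ty)} :
      Ins Θ x o (x :: N) (none :: S) (o :: S) (D.id _ ⊠ D.lunit _)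
  | there {y : ℕ} {N : List ℕ} {s : Option Ty} {S S' : List (Option Ty)}
      {m : D.Hom (D.tens (denSlot D Θ o) (denSlots D Θ S)) (denSlots D Θ S')} :
      y ≠ x → Ins Θ x o N S S' m →
      Ins Θ x o (y :: N) (s :: S) (s :: S') (D.sw _ _ _ ▹ (D.id _ ⊠ m))

variable (hD : LCDLaws D) {Θ : ℕ → D.Obj}
include hD

theorem LCDLaws.sw_natural_assoc {A B W A' B' W' C : D.Obj} (f : D.Hom A A') (g : D.Hom B B')
    (h : D.Hom W W') (k : D.Hom (D.tens B' (D.tens A' W')) C) :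
    (f ⊠ g ⊠ h) ▹ D.sw A' B' W' ▹ k = D.sw A B W ▹ (g ⊠ f ⊠ h) ▹ k := by
  rw [hD.reassoc (hD.sw_natural f g h), hD.comp_assoc]

theorem LCDLaws.mid4_natural_assoc {A₁ A₂ B₁ B₂ A₁' A₂' B₁' B₂' C : D.Obj} (f₁ : D.Hom A₁ A₁')
    (f₂ : D.Hom A₂ A₂') (g₁ : D.Hom B₁ B₁') (g₂ : D.Hom B₂ B₂')
    (k : D.Hom (D.tens (D.tens A₁' B₁') (D.tens A₂' B₂')) C) :
    ((f₁ ⊠ f₂) ⊠ (g₁ ⊠ g₂)) ▹ mid4 D _ _ _ _ ▹ k =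
      mid4 D _ _ _ _ ▹ ((f₁ ⊠ g₁) ⊠ (f₂ ⊠ g₂)) ▹ k := by
  rw [hD.reassoc (hD.mid4_natural f₁ f₂ g₁ g₂), hD.comp_assoc]

theorem LCDLaws.id_tmap_comp (A : D.Obj) {X Y Z : D.Obj} (f : D.Hom X Y) (g : D.Hom Y Z) :
    D.id A ⊠ (f ▹ g) = (D.id A ⊠ f) ▹ (D.id A ⊠ g) := by
  rw [hD.tmap_tmap, hD.id_comp]

theorem LCDLaws.reassoc_three {A B C E F : D.Obj} {f : D.Hom A B} {g : D.Hom B C} {h : D.Hom C E}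
    {l : D.Hom A E} (e : f ▹ g ▹ h = l) (k : D.Hom E F) : f ▹ g ▹ h ▹ k = l ▹ k := by
  rw [← e, hD.comp_assoc, hD.comp_assoc]

theorem LCDLaws.tmap_comp_three {A₁ A₂ B X Y Z₁ Z₂ W₁ W₂ : D.Obj} (k : D.Hom B (D.tens A₁ A₂))
    (f : D.Hom X Y) (g : D.Hom Y (D.tens Z₁ Z₂)) (h₁ : D.Hom Z₁ W₁) (h₂ : D.Hom Z₂ W₂) :
    k ⊠ (f ▹ g ▹ (h₁ ⊠ h₂)) =
      (k ⊠ f) ▹ (D.id _ ⊠ g) ▹ ((D.id A₁ ⊠ D.id A₂) ⊠ (h₁ ⊠ h₂)) := by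
  rw [hD.tmap_tmap, hD.tmap_tmap, hD.tmap_id, hD.comp_id, hD.comp_id]

theorem LCDLaws.sw_unit_unit (W : D.Obj) : D.sw D.unit D.unit W = D.id _ := by
  have h : D.sw D.unit D.unit W ▹ D.lunit _ = D.lunit _ := by rw [hD.sw_unit, hD.lunit_tens]
  rw [← hD.comp_id (D.sw _ _ _), ← hD.lunit_iso₁, hD.reassoc h]

theorem LCDLaws.sw_unit_assoc (A W : D.Obj) {B : D.Obj} (k : D.Hom (D.tens A W) B) :
    D.sw A D.unit W ▹ D.lunit _ ▹ k = (D.id A ⊠ D.lunit W) ▹ k :=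
  (hD.reassoc (hD.sw_unit A W) k)

theorem Ins.comm {x y : ℕ} {o p : Option Ty} {N : List ℕ} {S₀ S₁ S₂ : List (Option Ty)}
    {m₁ : D.Hom (D.tens (denSlot D Θ o) (denSlots D Θ S₀)) (denSlots D Θ S₁)}
    {m₂ : D.Hom (D.tens (denSlot D Θ p) (denSlots D Θ S₁)) (denSlots D Θ S₂)}
    (h₁ : Ins Θ x o N S₀ S₁ m₁) (h₂ : Ins Θ y p N S₁ S₂ m₂)
    (hxy : x = y → o = none ∧ p = none) :
    ∃ S₁' m₁' m₂', Ins Θ y p N S₀ S₁' m₁' ∧ Ins Θ x o N S₁' S₂ m₂' ∧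
      (D.id (denSlot D Θ p) ⊠ m₁) ▹ m₂ = D.sw _ _ _ ▹ (D.id (denSlot D Θ o) ⊠ m₁') ▹ m₂' := by
  induction h₁ generalizing S₂ with
  | here =>
    cases h₂ with
    | here =>
      obtain ⟨-, rfl⟩ := hxy rfl
      exact ⟨_, _, _, .here, .here, by rw [hD.sw_unit_unit, hD.id_comp]⟩
    | there hne h =>
      refine ⟨_, _, _, .there hne h, .here, ?_⟩
      rw [hD.sw_natural_assoc, hD.tmap_tmap, hD.tmap_tmap, hD.comp_assoc, hD.lunit_natural,
        hD.sw_unit_assoc]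
  | there hne h₁ ih =>
    cases h₂ with
    | here =>
      refine ⟨_, _, _, .here, .there hne h₁, ?_⟩
      rw [hD.sw_natural_assoc, ← hD.comp_assoc (D.sw _ _ _) (D.sw _ _ _), hD.sw_sw, hD.id_comp,
        hD.tmap_tmap, hD.tmap_tmap, hD.comp_assoc, hD.lunit_natural, hD.sw_unit_assoc]
    | there hne' h₂ =>
      obtain ⟨S₁', m₁', m₂', i₁, i₂, e⟩ := ih h₂
      refine ⟨_, _, _, .there hne' i₁, .there hne i₂, ?_⟩
      rw [hD.id_tmap_comp _ (D.sw _ _ _), hD.id_tmap_comp _ (D.sw _ _ _), hD.comp_assoc,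
        hD.comp_assoc, hD.sw_natural_assoc, hD.sw_natural_assoc, hD.tmap_tmap, hD.tmap_tmap, e,
        hD.id_comp]
      simp only [hD.id_tmap_comp]
      rw [hD.reassoc_three (hD.sw_braid _ _ _ _), hD.comp_assoc, hD.comp_assoc]

theorem Ins.split {x : ℕ} {o₁ o₂ o : Option Ty} {N : List ℕ} {S₁ S₂ S T₁ T₂ : List (Option Ty)}
    {m₁ : D.Hom (D.tens (denSlot D Θ o₁) (denSlots D Θ S₁)) (denSlots D Θ T₁)}
    {m₂ : D.Hom (D.tens (denSlot D Θ o₂) (denSlots D Θ S₂)) (denSlots D Θ T₂)}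
    {k₀ : D.Hom (denSlot D Θ o) (D.tens (denSlot D Θ o₁) (denSlot D Θ o₂))}
    {k : D.Hom (denSlots D Θ S) (D.tens (denSlots D Θ S₁) (denSlots D Θ S₂))}
    (h₁ : Ins Θ x o₁ N S₁ T₁ m₁) (h₂ : Ins Θ x o₂ N S₂ T₂ m₂) (h₀ : SplitSlot Θ o₁ o₂ o k₀)
    (hk : SplitSlots Θ S₁ S₂ S k) :
    ∃ T m t, Ins Θ x o N S T m ∧ SplitSlots Θ T₁ T₂ T t ∧
      m ▹ t = (k₀ ⊠ k) ▹ mid4 D _ _ _ _ ▹ (m₁ ⊠ m₂) := by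
  induction h₁ generalizing S₂ S T₂ with
  | here =>
    cases h₂ with
    | there hne => exact absurd rfl hne
    | here =>
      obtain _ | ⟨hs, hk⟩ := hk
      cases hs
      rename_i t
      refine ⟨_, _, _, .here, .cons h₀ hk, ?_⟩
      have e : ((D.lunitInv D.unit ⊠ t) ▹ mid4 D D.unit D.unit _ _) ▹ (D.lunit _ ⊠ D.lunit _) =
          D.lunit _ ▹ t := by
        rw [← hD.id_comp (D.lunitInv D.unit), ← hD.comp_id t, ← hD.tmap_tmap, hD.comp_assoc,
          hD.comp_assoc, hD.mid4_lunit, hD.lunit_natural, hD.comp_id]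
      rw [← hD.mid4_natural, hD.tmap_tmap_assoc (D.id _), hD.tmap_tmap_assoc, e, hD.id_comp,
        hD.tmap_id, hD.comp_id]
  | there hne h₁ ih =>
    cases h₂ with
    | here => exact absurd rfl hne
    | there _ h₂ =>
      obtain _ | ⟨hs, hk⟩ := hk
      obtain ⟨T, m, t, i, j, e⟩ := ih h₂ hk
      refine ⟨_, _, _, .there hne i, .cons hs j, ?_⟩
      rw [hD.comp_assoc, hD.tmap_tmap_assoc, hD.id_comp, e, hD.tmap_comp_three, hD.comp_assoc,
        hD.comp_assoc, ← hD.sw_natural_assoc, hD.mid4_natural, hD.reassoc_three (hD.sw_mid4 ..),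
        hD.comp_assoc, hD.comp_assoc, hD.tmap_tmap_assoc, hD.comp_id, hD.tmap_tmap]

end Insertion

section Structural

variable {D : LCDData} (hD : LCDLaws D) (Θ : ℕ → D.Obj)
include hD

theorem LCDLaws.mid4_assoc (X₁ X₂ Y₁ Y₂ Z₁ Z₂ : D.Obj) :
    (mid4 D X₁ X₂ Y₁ Y₂ ⊠ D.id (D.tens Z₁ Z₂)) ▹ mid4 D (D.tens X₁ Y₁) (D.tens X₂ Y₂) Z₁ Z₂ ▹
        (D.assoc X₁ Y₁ Z₁ ⊠ D.assoc X₂ Y₂ Z₂) =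
      D.assoc (D.tens X₁ X₂) (D.tens Y₁ Y₂) (D.tens Z₁ Z₂) ▹
        (D.id (D.tens X₁ X₂) ⊠ mid4 D Y₁ Y₂ Z₁ Z₂) ▹
        mid4 D X₁ X₂ (D.tens Y₁ Z₁) (D.tens Y₂ Z₂) := by
  simp only [hD.mid4_eq_tensorμ]
  exact CategoryTheory.MonoidalCategory.tensor_associativity (C := SymCat hD) X₁ X₂ Y₁ Y₂ Z₁ Z₂

theorem LCDLaws.assoc_runit (A B : D.Obj) :
    D.assoc A B D.unit ▹ (D.id A ⊠ D.runit B) = D.runit (D.tens A B) :=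
  (CategoryTheory.MonoidalCategory.rightUnitor_tensor_hom (C := SymCat hD) A B).symm

theorem swapMor_nil (p q : ℕ × Ty) (Γ : CtxL) :
    swapMor D Θ [] p q Γ = D.sw (denTy D Θ q.2) (denTy D Θ p.2) (denCtx D Θ Γ) := by
  simp only [swapMor, splitCtx, joinCtx, LCDData.sw]
  refine (congrArg _ (hD.lunit_natural _)).trans ?_
  exact hD.reassoc_id (hD.lunit_iso₂ _) _

theorem swapMor_cons (a p q : ℕ × Ty) (Γ₁ Γ₂ : CtxL) :
    swapMor D Θ (a :: Γ₁) p q Γ₂ = D.id (denTy D Θ a.2) ⊠ swapMor D Θ Γ₁ p q Γ₂ := by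
  simp only [swapMor, splitCtx, joinCtx, denCtx]
  rw [← hD.tmap_id, hD.comp_assoc, hD.reassoc (hD.assoc_natural ..), hD.comp_assoc,
    hD.reassoc_id (hD.assoc_iso₂ ..), hD.tmap_tmap, hD.tmap_tmap, hD.id_comp, hD.id_comp]

theorem eqHom_cons (a : ℕ × Ty) {Γ Γ' : CtxL} (h : Γ = Γ') (h' : a :: Γ = a :: Γ') :
    eqHom D (congrArg (denCtx D Θ) h') =
      D.id (denTy D Θ a.2) ⊠ eqHom D (congrArg (denCtx D Θ) h) := by
  subst h
  exact (hD.tmap_id _ _).symm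

theorem splitDup_nil (Γ₁ Γ₂ : CtxL) : splitDup D Θ [] Γ₁ Γ₂ = splitCtx D Θ Γ₁ Γ₂ := by
  have h : D.lunitInv (denCtx D Θ (Γ₁ ++ Γ₂)) ▹ (D.lunitInv D.unit ⊠ splitCtx D Θ Γ₁ Γ₂) ▹
      mid4 D D.unit D.unit (denCtx D Θ Γ₁) (denCtx D Θ Γ₂) ▹ (D.lunit _ ⊠ D.lunit _) =
      splitCtx D Θ Γ₁ Γ₂ := by
    rw [← hD.id_comp (D.lunitInv D.unit), ← hD.comp_id (splitCtx D Θ Γ₁ Γ₂), ← hD.tmap_tmap,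
      hD.comp_assoc, hD.mid4_lunit, hD.lunit_natural, hD.reassoc_id (hD.lunit_iso₂ _), hD.comp_id]
  exact (hD.id_comp _).trans h

theorem LCDLaws.mid4_tmap_dup {A A' W X X' G G₁ G₂ Y₁ Y₂ : D.Obj} (e : D.Hom X X')
    (s : D.Hom X' (D.tens W G)) (u : D.Hom A (D.tens A' A')) (d : D.Hom W (D.tens W W))
    (l : D.Hom G (D.tens G₁ G₂)) (j₁ : D.Hom (D.tens W G₁) Y₁) (j₂ : D.Hom (D.tens W G₂) Y₂) :
    (D.id A ⊠ e) ▹ ((D.id A ⊠ s) ▹ D.assocInv A W G) ▹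
        (((u ⊠ d) ▹ mid4 D A' A' W W) ⊠ l) ▹ mid4 D (D.tens A' W) (D.tens A' W) G₁ G₂ ▹
        ((D.assoc _ _ _ ▹ (D.id A' ⊠ j₁)) ⊠ (D.assoc _ _ _ ▹ (D.id A' ⊠ j₂))) =
      (u ⊠ (e ▹ s ▹ (d ⊠ l) ▹ mid4 D _ _ _ _ ▹ (j₁ ⊠ j₂))) ▹ mid4 D A' A' Y₁ Y₂ := by
  have h := hD.reassoc (hD.mid4_assoc A' A' W W G₁ G₂) ((D.id A' ⊠ j₁) ⊠ (D.id A' ⊠ j₂))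
  simp only [hD.comp_assoc] at h
  rw [← hD.comp_id l, ← hD.tmap_tmap, ← hD.tmap_tmap, hD.comp_assoc, hD.comp_assoc, h,
    hD.reassoc (hD.assoc_natural u d l), hD.comp_assoc, hD.reassoc_id (hD.assoc_iso₂ ..),
    ← hD.mid4_natural, hD.tmap_id, hD.comp_id]
  simp only [hD.tmap_tmap_assoc, hD.comp_id, hD.id_comp]

theorem splitDup_cons (a : ℕ × Ty) (Δ Γ₁ Γ₂ : CtxL) : splitDup D Θ (a :: Δ) Γ₁ Γ₂ =
    (D.dup (denTy D Θ a.2) ⊠ splitDup D Θ Δ Γ₁ Γ₂) ▹ mid4 D _ _ _ _ := by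
  have h := eqHom_cons hD Θ (a.1, a.2.bang) (List.append_assoc (bangify Δ) Γ₁ Γ₂)
    (List.append_assoc (bangify (a :: Δ)) Γ₁ Γ₂)
  simp only [splitDup]
  refine (congrArg (fun e => D.comp e _) h).trans ?_
  exact hD.mid4_tmap_dup ..

theorem extHom_nil (x : ℕ) (A : Ty) : extHom D Θ [] x A = D.symm _ _ := by
  simp only [extHom, joinCtx]
  refine (hD.lunit_natural _).trans ?_
  rw [← hD.symm_runit, hD.comp_assoc, hD.runit_iso₁, hD.comp_id]

theorem extHom_cons (a : ℕ × Ty) (Γ : CtxL) (x : ℕ) (A : Ty) : extHom D Θ (a :: Γ) x A =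
    D.assoc _ _ _ ▹ (D.id (denTy D Θ a.2) ⊠ extHom D Θ Γ x A) := by
  simp only [extHom, joinCtx, denCtx]
  rw [← hD.tmap_id, hD.reassoc (hD.assoc_natural ..), hD.comp_assoc, hD.tmap_tmap, hD.id_comp]

theorem ext2Hom_nil (x₁ x₂ : ℕ) (A₁ A₂ : Ty) : ext2Hom D Θ [] x₁ A₁ x₂ A₂ =
    D.symm _ _ ▹ D.assoc _ _ _ := by
  simp only [ext2Hom, joinCtx]
  refine (hD.lunit_natural _).trans ?_
  rw [← hD.symm_runit, hD.comp_assoc, ← hD.assoc_runit, hD.comp_assoc, hD.tmap_tmap, hD.id_comp,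
    hD.runit_iso₁, hD.tmap_id, hD.comp_id]

theorem ext2Hom_cons (a : ℕ × Ty) (Γ : CtxL) (x₁ x₂ : ℕ) (A₁ A₂ : Ty) :
    ext2Hom D Θ (a :: Γ) x₁ A₁ x₂ A₂ =
      D.assoc _ _ _ ▹ (D.id (denTy D Θ a.2) ⊠ ext2Hom D Θ Γ x₁ A₁ x₂ A₂) := by
  simp only [ext2Hom, joinCtx, denCtx]
  rw [← hD.tmap_id, hD.reassoc (hD.assoc_natural ..), hD.comp_assoc, hD.tmap_tmap, hD.id_comp]

theorem LCDLaws.tmap_m2_eps {A B : D.Obj} {f : D.Hom A (D.L A)} {g : D.Hom B (D.L B)}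
    (hf : f ▹ D.eps A = D.id A) (hg : g ▹ D.eps B = D.id B) :
    ((f ⊠ g) ▹ D.m2 A B) ▹ D.eps _ = D.id _ := by
  rw [hD.comp_assoc, hD.eps_monoidal, hD.tmap_tmap, hf, hg, hD.tmap_id]

theorem promCtx_eps (Δ : CtxL) : promCtx D Θ Δ ▹ D.eps _ = D.id (denCtx D Θ (bangify Δ)) := by
  induction Δ with
  | nil => exact hD.eps_monoidal_unit
  | cons a Δ ih => exact hD.tmap_m2_eps (hD.delta_counit_left _) ih

theorem coalg_bangify (Δ : CtxL) : Coalg D (denCtx D Θ (bangify Δ)) := by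
  induction Δ with
  | nil => exact hD.coalg_unit
  | cons a Δ ih => exact hD.coalg_tens (hD.coalg_bang _) ih

end Structural

section Restriction

variable {D : LCDData}

/-- The innermost variable named `x` is not used. -/
inductive Fresh (x : ℕ) : List ℕ → List (Option Ty) → Prop
  | here {N : List ℕ} {S : List (Option Ty)} : Fresh x (x :: N) (none :: S)
  | there {y : ℕ} {N : List ℕ} {s : Option Ty} {S : List (Option Ty)} :
      y ≠ x → Fresh x N S → Fresh x (y :: N) (s :: S)

/-- `Restr Θ N S Γ r`: the arrow `r` restricts the interpretation of the context `Γ` to its used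
part `S`, arranged in the order of the variable names `N`. -/
inductive Restr (Θ : ℕ → D.Obj) (N : List ℕ) : (S : List (Option Ty)) → (Γ : CtxL) →
    D.Hom (denCtx D Θ Γ) (denSlots D Θ S) → Prop
  | nil {S : List (Option Ty)} {u : D.Hom D.unit (denSlots D Θ S)}
      {c : D.Hom (denSlots D Θ S) D.unit} : Unused Θ N S u c → Restr Θ N S [] u
  | cons {x : ℕ} {A : Ty} {Γ : CtxL} {S S' : List (Option Ty)} {o : Option Ty}
      {k : D.Hom (denTy D Θ A) (denSlot D Θ o)} {r : D.Hom (denCtx D Θ Γ) (denSlots D Θ S)}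
      {m : D.Hom (D.tens (denSlot D Θ o) (denSlots D Θ S)) (denSlots D Θ S')} :
      BindSlot Θ A o k → Restr Θ N S Γ r → Ins Θ x o N S S' m → (o = none ∨ x ∉ names Γ) →
      Restr Θ N S' ((x, A) :: Γ) ((k ⊠ r) ▹ m)

theorem Unused.fresh {Θ : ℕ → D.Obj} {x : ℕ} {N : List ℕ} {S : List (Option Ty)}
    {u : D.Hom D.unit (denSlots D Θ S)} {c : D.Hom (denSlots D Θ S) D.unit}
    (h : Unused Θ N S u c) (hx : x ∈ N) : Fresh x N S := by
  induction h with
  | nil => cases hx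
  | cons y _ ih =>
    by_cases hy : y = x
    · subst hy
      exact .here
    · exact .there hy (ih ((List.mem_cons.1 hx).resolve_left (Ne.symm hy)))

theorem Unused.comp_eq_id (hD : LCDLaws D) {Θ : ℕ → D.Obj} {N : List ℕ} {S : List (Option Ty)}
    {u : D.Hom D.unit (denSlots D Θ S)} {c : D.Hom (denSlots D Θ S) D.unit}
    (h : Unused Θ N S u c) : u ▹ c = D.id _ := by
  induction h with
  | nil => exact hD.id_comp _
  | cons _ _ ih =>
    rw [hD.comp_assoc, hD.tmap_tmap_assoc, ih, hD.id_comp, hD.tmap_id, hD.id_comp, hD.lunit_iso₂]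

theorem exists_unused (Θ : ℕ → D.Obj) (N : List ℕ) : ∃ S u c, Unused (D := D) Θ N S u c := by
  induction N with
  | nil => exact ⟨_, _, _, .nil⟩
  | cons x N ih =>
    obtain ⟨S, u, c, h⟩ := ih
    exact ⟨_, _, _, .cons x h⟩

theorem Ins.fresh_of_ne {Θ : ℕ → D.Obj} {x y : ℕ} {o : Option Ty} {N : List ℕ}
    {S S' : List (Option Ty)}
    {m : D.Hom (D.tens (denSlot D Θ o) (denSlots D Θ S)) (denSlots D Θ S')}
    (h : Ins Θ x o N S S' m) (hS : Fresh y N S) (hy : o = none ∨ y ≠ x) : Fresh y N S' := by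
  induction h with
  | here =>
    obtain rfl | hy := hy
    · exact hS
    · obtain _ | ⟨h, hS⟩ := hS
      · exact absurd rfl hy
      · exact .there h hS
  | there _ _ ih =>
    obtain _ | ⟨h, hS⟩ := hS
    · exact .here
    · exact .there h (ih hS)

theorem Ins.eq_none {Θ : ℕ → D.Obj} {x : ℕ} {o o' : Option Ty} {N : List ℕ}
    {S S' S'' : List (Option Ty)}
    {m : D.Hom (D.tens (denSlot D Θ o) (denSlots D Θ S)) (denSlots D Θ S')}
    {m' : D.Hom (D.tens (denSlot D Θ o') (denSlots D Θ S')) (denSlots D Θ S'')}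
    (h : Ins Θ x o N S S' m) (h' : Ins Θ x o' N S' S'' m') : o = none := by
  induction h generalizing S'' with
  | here =>
    obtain _ | ⟨hne, _⟩ := h'
    · rfl
    · exact absurd rfl hne
  | there hne _ ih =>
    obtain _ | ⟨_, h'⟩ := h'
    · exact absurd rfl hne
    · exact ih h'

variable (hD : LCDLaws D) {Θ : ℕ → D.Obj}
include hD

theorem LCDLaws.sw_lunit (B W : D.Obj) :
    D.sw D.unit B W ▹ (D.id B ⊠ D.lunit W) = D.lunit (D.tens B W) := by
  rw [← hD.sw_unit, hD.reassoc_id (hD.sw_sw ..)]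

theorem Fresh.ins {x : ℕ} {N : List ℕ} {S : List (Option Ty)} (h : Fresh x N S) :
    Ins Θ x none N S S (D.lunit (denSlots D Θ S)) := by
  induction h with
  | here =>
    rw [hD.lunit_tens]
    exact .here
  | there hne _ ih =>
    have h := Ins.there (s := by assumption) hne ih
    rwa [hD.sw_lunit] at h

omit hD in
theorem Fresh.exists_ins {x : ℕ} {N : List ℕ} {S : List (Option Ty)} (h : Fresh x N S)
    (o : Option Ty) : ∃ S' m, Ins Θ x o N S S' m := by
  induction h with
  | here => exact ⟨_, _, .here⟩
  | there hne _ ih =>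
    obtain ⟨_, _, ih⟩ := ih
    exact ⟨_, _, .there hne ih⟩

omit hD in
theorem Restr.fresh {x : ℕ} {N : List ℕ} {S : List (Option Ty)} {Γ : CtxL}
    {r : D.Hom (denCtx D Θ Γ) (denSlots D Θ S)} (h : Restr Θ N S Γ r) (hx : x ∈ N)
    (hΓ : x ∉ names Γ) : Fresh x N S := by
  induction h with
  | nil h => exact h.fresh hx
  | cons _ _ h _ ih =>
    simp only [names, List.map_cons, List.mem_cons, not_or] at hΓ
    exact h.fresh_of_ne (ih hΓ.2) (.inr hΓ.1)

theorem LCDLaws.id_tmap_comp_tmap {A A' W X Y Z : D.Obj} (k : D.Hom A A') (f : D.Hom W X)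
    (r : D.Hom X Y) (m : D.Hom (D.tens A' Y) Z) :
    (D.id A ⊠ f) ▹ (k ⊠ r) ▹ m = (k ⊠ (f ▹ r)) ▹ m := by
  rw [hD.tmap_tmap_assoc, hD.id_comp]

theorem LCDLaws.sw_comp_tmap {A B W A' B' W' P Q R : D.Obj} (k : D.Hom A A') (k' : D.Hom B B')
    (r : D.Hom W W') {m : D.Hom (D.tens B' W') P} {n : D.Hom (D.tens A' P) R}
    {m' : D.Hom (D.tens A' W') Q} {n' : D.Hom (D.tens B' Q) R}
    (e : (D.id A' ⊠ m) ▹ n = D.sw _ _ _ ▹ (D.id B' ⊠ m') ▹ n') :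
    D.sw B A W ▹ (k ⊠ ((k' ⊠ r) ▹ m)) ▹ n = (k' ⊠ ((k ⊠ r) ▹ m')) ▹ n' := by
  rw [← hD.comp_id k, ← hD.comp_id k', ← hD.tmap_tmap, hD.comp_assoc, e, hD.sw_natural_assoc,
    hD.reassoc_id (hD.sw_sw ..), hD.comp_id, hD.comp_id, hD.tmap_tmap_assoc, hD.comp_id]

theorem Restr.swap {N : List ℕ} {S : List (Option Ty)} {Γ₁ Γ₂ : CtxL} {p q : ℕ × Ty}
    {r : D.Hom (denCtx D Θ (Γ₁ ++ p :: q :: Γ₂)) (denSlots D Θ S)}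
    (h : Restr Θ N S (Γ₁ ++ p :: q :: Γ₂) r) :
    Restr Θ N S (Γ₁ ++ q :: p :: Γ₂) (swapMor D Θ Γ₁ p q Γ₂ ▹ r) := by
  induction Γ₁ generalizing S with
  | nil =>
    obtain ⟨x, A⟩ := p
    obtain ⟨y, B⟩ := q
    cases h with
    | cons hk hr hi hx =>
      cases hr with
      | cons hk' hr hi' hx' =>
        have hxy : y = x → _ ∧ _ := fun h =>
          ⟨(h ▸ hi').eq_none hi, hx.resolve_right fun hx => hx (by simp [names, h])⟩
        obtain ⟨_, _, _, i₁, i₂, e⟩ := hi'.comm hD hi hxy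
        rw [swapMor_nil hD]
        refine (hD.sw_comp_tmap _ _ _ e).symm ▸ .cons hk' (.cons hk hr i₁ ?_) i₂ ?_
        · simp only [names, List.map_cons, List.mem_cons, not_or] at hx
          exact hx.imp_right And.right
        · by_cases h : y = x
          · exact .inl (hxy h).1
          · simpa [names, h] using hx'
  | cons a Γ₁ ih =>
    cases h with
    | cons hk hr hi hx =>
      rw [swapMor_cons hD]
      have := Restr.cons hk (ih hr) hi (by simpa [names, or_comm, or_left_comm] using hx)
      rw [← hD.id_tmap_comp_tmap] at this
      exact this

end Restriction

section Splitting

variable {D : LCDData} (hD : LCDLaws D) {Θ : ℕ → D.Obj}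
include hD

omit hD in
theorem splitSlot_none_left (o : Option Ty) : SplitSlot Θ none o o (D.lunitInv _) := by
  cases o with
  | none => exact .neither
  | some A => exact .right A

theorem LCDLaws.mid4_mid4 (A B C E : D.Obj) : mid4 D A B C E ▹ mid4 D A C B E = D.id _ := by
  change (D.assoc A B (D.tens C E) ▹ (D.id A ⊠ D.sw B C E) ▹ D.assocInv A C (D.tens B E)) ▹
    (D.assoc A C (D.tens B E) ▹ (D.id A ⊠ D.sw C B E) ▹ D.assocInv A B (D.tens C E)) = D.id _
  rw [hD.comp_assoc, hD.comp_assoc, hD.reassoc_id (hD.assoc_iso₂ ..), hD.tmap_tmap_assoc,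
    hD.sw_sw, hD.id_comp, hD.tmap_id, hD.id_comp, hD.assoc_iso₁]

theorem LCDLaws.lunitInv_tmap_mid4 {A S S₁ : D.Obj} (u : D.Hom D.unit S₁) :
    (D.lunitInv A ⊠ (D.lunitInv S ▹ (u ⊠ D.id S))) ▹ mid4 D D.unit A S₁ S =
      D.lunitInv (D.tens A S) ▹ ((D.lunitInv D.unit ▹ (D.id D.unit ⊠ u)) ⊠ D.id (D.tens A S)) := by
  have h : (D.lunitInv A ⊠ D.lunitInv S) ▹ mid4 D D.unit A D.unit S =
      D.lunitInv (D.tens A S) ▹ (D.lunitInv D.unit ⊠ D.id _) := by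
    have h := congrArg (fun f => D.lunitInv _ ▹ f ▹
      (D.lunitInv A ⊠ D.lunitInv S) ▹ mid4 D D.unit A D.unit S) (hD.mid4_lunit A S)
    simp only [hD.comp_assoc] at h
    rw [hD.tmap_tmap_assoc, hD.lunit_iso₁, hD.lunit_iso₁, hD.tmap_id, hD.id_comp, hD.mid4_mid4,
      hD.comp_id, hD.reassoc_id (hD.lunit_iso₂ _)] at h
    exact h.symm
  have e : D.lunitInv A ⊠ (D.lunitInv S ▹ (u ⊠ D.id S)) =
      (D.lunitInv A ⊠ D.lunitInv S) ▹ ((D.id _ ⊠ D.id _) ⊠ (u ⊠ D.id S)) := by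
    rw [hD.tmap_tmap, hD.tmap_id, hD.comp_id]
  rw [e, hD.comp_assoc, hD.mid4_natural, hD.reassoc h, hD.comp_assoc, hD.tmap_tmap, hD.tmap_id,
    hD.id_comp]

theorem Unused.split {N : List ℕ} {S₁ S : List (Option Ty)} {u : D.Hom D.unit (denSlots D Θ S₁)}
    {c : D.Hom (denSlots D Θ S₁) D.unit} (h : Unused Θ N S₁ u c) (hl : S.length = N.length) :
    SplitSlots Θ S₁ S S (D.lunitInv _ ▹ (u ⊠ D.id _)) := by
  induction h generalizing S with
  | nil =>
    obtain rfl := List.length_eq_zero_iff.1 hl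
    rw [hD.tmap_id, hD.comp_id]
    exact .nil
  | cons x _ ih =>
    obtain _ | ⟨o, S⟩ := S
    · cases hl
    · have h := SplitSlots.cons (splitSlot_none_left (D := D) (Θ := Θ) o) (ih (Nat.succ.inj hl))
      rwa [hD.lunitInv_tmap_mid4] at h

theorem LCDLaws.dup_disc_right (A : D.Obj) :
    D.dup A ▹ (D.id _ ⊠ D.disc A) = D.id _ ▹ D.runitInv _ := by
  rw [← hD.comp_id (D.dup A ▹ _), ← hD.runit_iso₁, hD.comp_assoc,
    hD.reassoc_three (hD.dup_counit_right A)]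

theorem LCDLaws.dup_disc_left (A : D.Obj) :
    D.dup A ▹ (D.disc A ⊠ D.id _) = D.id _ ▹ D.lunitInv _ := by
  rw [← hD.comp_id (D.dup A ▹ _), ← hD.lunit_iso₁, hD.comp_assoc,
    hD.reassoc_three (hD.dup_counit_left A)]

theorem LCDLaws.dup_disc_disc (A : D.Obj) :
    D.dup A ▹ (D.disc A ⊠ D.disc A) = D.disc A ▹ D.lunitInv _ := by
  rw [hD.tmap_eq_comp, hD.reassoc (hD.dup_disc_left A), hD.comp_assoc, hD.id_comp,
    hD.lunitInv_natural]

theorem BindSlot.split {A : Ty} {o₁ o₂ : Option Ty}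
    {k₁ : D.Hom (denTy D Θ A.bang) (denSlot D Θ o₁)}
    {k₂ : D.Hom (denTy D Θ A.bang) (denSlot D Θ o₂)}
    (h₁ : BindSlot Θ A.bang o₁ k₁) (h₂ : BindSlot Θ A.bang o₂ k₂) :
    ∃ o k k₀, BindSlot Θ A.bang o k ∧ SplitSlot Θ o₁ o₂ o k₀ ∧
      D.dup (denTy D Θ A) ▹ (k₁ ⊠ k₂) = k ▹ k₀ := by
  cases h₁ <;> cases h₂
  · exact ⟨_, _, _, .use _, .both _, by rw [hD.tmap_id, hD.id_comp, hD.comp_id]⟩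
  · exact ⟨_, _, _, .use _, .left _, hD.dup_disc_right _⟩
  · exact ⟨_, _, _, .use _, .right _, hD.dup_disc_left _⟩
  · exact ⟨_, _, _, .drop _, .neither, hD.dup_disc_disc _⟩

theorem splitSlot_none (o : Option Ty) : SplitSlot Θ o none o (D.runitInv _) := by
  cases o with
  | none => exact hD.lunitInv_unit ▸ .neither
  | some A => exact .left A

omit hD in
theorem Ins.length {x : ℕ} {o : Option Ty} {N : List ℕ} {S S' : List (Option Ty)}
    {m : D.Hom (D.tens (denSlot D Θ o) (denSlots D Θ S)) (denSlots D Θ S')}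
    (h : Ins Θ x o N S S' m) : S'.length = S.length := by
  induction h with
  | here => rfl
  | there _ _ ih => simp [ih]

omit hD in
theorem Unused.length {N : List ℕ} {S : List (Option Ty)} {u : D.Hom D.unit (denSlots D Θ S)}
    {c : D.Hom (denSlots D Θ S) D.unit} (h : Unused Θ N S u c) : S.length = N.length := by
  induction h with
  | nil => rfl
  | cons _ _ ih => simp [ih]

omit hD in
theorem Restr.length {N : List ℕ} {S : List (Option Ty)} {Γ : CtxL}
    {r : D.Hom (denCtx D Θ Γ) (denSlots D Θ S)} (h : Restr Θ N S Γ r) : S.length = N.length := by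
  induction h with
  | nil h => exact h.length
  | cons _ _ h _ ih => exact h.length.trans ih

theorem LCDLaws.split_right {A A' W W₁ W₂ S S₁ S₂ T T₁ : D.Obj} (k : D.Hom A A')
    {l : D.Hom W (D.tens W₁ W₂)} {r₁ : D.Hom W₁ S₁} {r₂ : D.Hom W₂ S₂} {r : D.Hom W S}
    {s : D.Hom S (D.tens S₁ S₂)} {m₁ : D.Hom (D.tens A' S₁) T₁} {m : D.Hom (D.tens A' S) T}
    {t : D.Hom T (D.tens T₁ S₂)} (e : l ▹ (r₁ ⊠ r₂) = r ▹ s)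
    (h : m ▹ t = (D.runitInv A' ⊠ s) ▹ mid4 D _ _ _ _ ▹ (m₁ ⊠ D.lunit S₂)) :
    ((D.id A ⊠ l) ▹ D.assocInv A W₁ W₂) ▹ (((k ⊠ r₁) ▹ m₁) ⊠ r₂) = ((k ⊠ r) ▹ m) ▹ t := by
  have hn : D.assocInv A W₁ W₂ ▹ ((k ⊠ r₁) ⊠ r₂) =
      (k ⊠ (r₁ ⊠ r₂)) ▹ D.assocInv A' S₁ S₂ := by
    rw [← hD.comp_id (_ ▹ ((k ⊠ r₁) ⊠ r₂)), ← hD.assoc_iso₁, hD.comp_assoc,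
      hD.reassoc (hD.assoc_natural ..), hD.comp_assoc, hD.reassoc_id (hD.assoc_iso₂ ..)]
  have hr : (D.runitInv A' ⊠ D.id _) ▹ mid4 D A' D.unit S₁ S₂ ▹ (m₁ ⊠ D.lunit S₂) =
      D.assocInv A' S₁ S₂ ▹ (m₁ ⊠ D.id _) := by
    rw [← hD.mid4_runit, hD.comp_assoc, hD.comp_assoc, hD.tmap_tmap, hD.id_comp, hD.comp_id]
  rw [hD.comp_assoc, hD.comp_assoc, h, ← hD.comp_id r₂, hD.tmap_comp, hD.reassoc hn,
    hD.comp_assoc, ← hr, hD.tmap_tmap_assoc, hD.tmap_tmap_assoc, hD.tmap_tmap_assoc, e, hD.id_comp,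
    hD.comp_id]

theorem LCDLaws.split_both {A A' A₁ A₂ W W₁ W₂ S S₁ S₂ T T₁ T₂ B : D.Obj}
    {d : D.Hom B (D.tens A A')} {k₁ : D.Hom A A₁} {k₂ : D.Hom A' A₂} {C : D.Obj} {k : D.Hom B C}
    {k₀ : D.Hom C (D.tens A₁ A₂)}
    {l : D.Hom W (D.tens W₁ W₂)} {r₁ : D.Hom W₁ S₁} {r₂ : D.Hom W₂ S₂} {r : D.Hom W S}
    {s : D.Hom S (D.tens S₁ S₂)} {m₁ : D.Hom (D.tens A₁ S₁) T₁} {m₂ : D.Hom (D.tens A₂ S₂) T₂}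
    {m : D.Hom (D.tens C S) T}
    {t : D.Hom T (D.tens T₁ T₂)} (hk : d ▹ (k₁ ⊠ k₂) = k ▹ k₀) (e : l ▹ (r₁ ⊠ r₂) = r ▹ s)
    (h : m ▹ t = (k₀ ⊠ s) ▹ mid4 D _ _ _ _ ▹ (m₁ ⊠ m₂)) :
    ((d ⊠ l) ▹ mid4 D A A' W₁ W₂) ▹ (((k₁ ⊠ r₁) ▹ m₁) ⊠ ((k₂ ⊠ r₂) ▹ m₂)) =
      ((k ⊠ r) ▹ m) ▹ t := by
  rw [hD.comp_assoc, hD.comp_assoc, h, ← hD.tmap_tmap (k₁ ⊠ r₁), ← hD.mid4_natural_assoc,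
    hD.tmap_tmap_assoc, hD.tmap_tmap_assoc, hk, e]

theorem LCDLaws.lunitInv_comp_tmap {A B C : D.Obj} (u : D.Hom D.unit C) (r : D.Hom A B) :
    D.lunitInv A ▹ (u ⊠ r) = r ▹ D.lunitInv B ▹ (u ⊠ D.id B) := by
  rw [hD.reassoc (hD.lunitInv_natural r), hD.comp_assoc, hD.tmap_tmap, hD.id_comp, hD.comp_id]

theorem Restr.splitCtx {N : List ℕ} {S₁ S₂ : List (Option Ty)} {Γ₁ Γ₂ : CtxL}
    {r₁ : D.Hom (denCtx D Θ Γ₁) (denSlots D Θ S₁)} {r₂ : D.Hom (denCtx D Θ Γ₂) (denSlots D Θ S₂)}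
    (h₁ : Restr Θ N S₁ Γ₁ r₁) (h₂ : Restr Θ N S₂ Γ₂ r₂) (hn : (names (Γ₁ ++ Γ₂)).Nodup)
    (hN : names Γ₁ ⊆ N) :
    ∃ S r m, Restr Θ N S (Γ₁ ++ Γ₂) r ∧ SplitSlots Θ S₁ S₂ S m ∧
      splitCtx D Θ Γ₁ Γ₂ ▹ (r₁ ⊠ r₂) = r ▹ m := by
  induction h₁ with
  | nil h =>
    refine ⟨_, _, _, h₂, h.split hD h₂.length, ?_⟩
    exact hD.lunitInv_comp_tmap _ _
  | @cons x A Γ S S' o k r m hk hr hi hx ih =>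
    simp only [names, List.cons_append, List.map_cons, List.nodup_cons, List.cons_subset,
      List.map_append, List.mem_append, not_or] at hn hN
    obtain ⟨T, r', t, h, hs, e⟩ := ih (by simpa [names] using hn.2) hN.2
    obtain ⟨T', m', t', hi', hs', e'⟩ :=
      hi.split hD ((h₂.fresh hN.1 hn.1.2).ins hD) (splitSlot_none hD o) hs
    refine ⟨_, _, _, .cons hk h hi' (.inr ?_), hs', hD.split_right k e e'⟩
    simpa [names] using hn.1

theorem Restr.splitDup {N : List ℕ} {S₁ S₂ : List (Option Ty)} {Δ Γ₁ Γ₂ : CtxL}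
    {r₁ : D.Hom (denCtx D Θ (bangify Δ ++ Γ₁)) (denSlots D Θ S₁)}
    {r₂ : D.Hom (denCtx D Θ (bangify Δ ++ Γ₂)) (denSlots D Θ S₂)}
    (h₁ : Restr Θ N S₁ (bangify Δ ++ Γ₁) r₁) (h₂ : Restr Θ N S₂ (bangify Δ ++ Γ₂) r₂)
    (hn : (names (bangify Δ ++ Γ₁ ++ Γ₂)).Nodup) (hN : names (bangify Δ ++ Γ₁ ++ Γ₂) ⊆ N) :
    ∃ S r m, Restr Θ N S (bangify Δ ++ Γ₁ ++ Γ₂) r ∧ SplitSlots Θ S₁ S₂ S m ∧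
      splitDup D Θ Δ Γ₁ Γ₂ ▹ (r₁ ⊠ r₂) = r ▹ m := by
  induction Δ generalizing S₁ S₂ with
  | nil =>
    rw [splitDup_nil hD]
    refine h₁.splitCtx hD h₂ hn fun x hx => hN ?_
    rw [names, List.map_append]
    exact List.mem_append_left _ hx
  | cons a Δ ih =>
    cases h₁ with
    | cons hk₁ hr₁ hi₁ hx₁ =>
      cases h₂ with
      | cons hk₂ hr₂ hi₂ hx₂ =>
        have hn' := List.nodup_cons.1 hn
        obtain ⟨S, r, s, h, hs, e⟩ := ih hr₁ hr₂ hn'.2 (List.cons_subset.1 hN).2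
        obtain ⟨o, k, k₀, hk, hk₀, e₀⟩ := hk₁.split hD hk₂
        obtain ⟨T, m, t, hi, ht, e'⟩ := hi₁.split hD hi₂ hk₀ hs
        rw [splitDup_cons hD]
        exact ⟨_, _, _, .cons hk h hi (.inr hn'.1), ht, hD.split_both e₀ e e'⟩

end Splitting

section Binders

variable {D : LCDData}

/-- A restriction of the context `Γ, x : A` splits into one of `A` and one of `Γ`. -/
inductive BoundRestr (Θ : ℕ → D.Obj) (N : List ℕ) (Γ : CtxL) (x : ℕ) (A : Ty) :
    (S : List (Option Ty)) → D.Hom (denCtx D Θ (Γ ++ [(x, A)])) (denSlots D Θ S) → Prop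
  | mk {s : Option Ty} {S : List (Option Ty)} {r' : D.Hom (denCtx D Θ Γ) (denSlots D Θ S)}
      {k : D.Hom (denTy D Θ A) (denSlot D Θ s)}
      {r : D.Hom (denCtx D Θ (Γ ++ [(x, A)])) (denSlots D Θ (s :: S))} :
      Restr Θ N S Γ r' → BindSlot Θ A s k → extHom D Θ Γ x A ▹ r = D.symm _ _ ▹ (k ⊠ r') →
      BoundRestr Θ N Γ x A (s :: S) r

/-- A restriction of the context `Γ, x₁ : A₁, x₂ : A₂` splits into ones of `A₁`, `A₂` and `Γ`. -/
inductive BoundRestrPair (Θ : ℕ → D.Obj) (N : List ℕ) (Γ : CtxL) (x₁ : ℕ) (A₁ : Ty) (x₂ : ℕ)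
    (A₂ : Ty) : (S : List (Option Ty)) →
    D.Hom (denCtx D Θ (Γ ++ [(x₁, A₁), (x₂, A₂)])) (denSlots D Θ S) → Prop
  | mk {s₁ s₂ : Option Ty} {S : List (Option Ty)} {r' : D.Hom (denCtx D Θ Γ) (denSlots D Θ S)}
      {k₁ : D.Hom (denTy D Θ A₁) (denSlot D Θ s₁)} {k₂ : D.Hom (denTy D Θ A₂) (denSlot D Θ s₂)}
      {r : D.Hom (denCtx D Θ (Γ ++ [(x₁, A₁), (x₂, A₂)])) (denSlots D Θ (s₁ :: s₂ :: S))} :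
      Restr Θ N S Γ r' → BindSlot Θ A₁ s₁ k₁ → BindSlot Θ A₂ s₂ k₂ →
      ext2Hom D Θ Γ x₁ A₁ x₂ A₂ ▹ r = (D.symm _ _ ▹ D.assoc _ _ _) ▹ (k₁ ⊠ k₂ ⊠ r') →
      BoundRestrPair Θ N Γ x₁ A₁ x₂ A₂ (s₁ :: s₂ :: S) r

variable (hD : LCDLaws D) {Θ : ℕ → D.Obj}
include hD

omit hD in
theorem mem_names_append_left {x : ℕ} {Γ₁ : CtxL} (Γ₂ : CtxL) (h : x ∈ names Γ₁) :
    x ∈ names (Γ₁ ++ Γ₂) := by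
  rw [names, List.map_append]
  exact List.mem_append_left _ h

theorem LCDLaws.lunitInv_tmap_lunit {A A' S : D.Obj} (k : D.Hom A A') (u : D.Hom D.unit S) :
    (k ⊠ (D.lunitInv D.unit ▹ (D.id D.unit ⊠ u))) ▹ (D.id A' ⊠ D.lunit S) = k ⊠ u := by
  rw [hD.tmap_tmap, hD.comp_assoc, hD.lunit_natural, hD.reassoc_id (hD.lunit_iso₂ _), hD.comp_id]

theorem LCDLaws.lunitInv_sw (B W : D.Obj) :
    (D.id B ⊠ D.lunitInv W) ▹ D.sw B D.unit W = D.lunitInv (D.tens B W) := by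
  rw [← hD.comp_id (_ ▹ D.sw B D.unit W), ← hD.lunit_iso₁, ← hD.sw_lunit B W, hD.comp_assoc,
    hD.comp_assoc, hD.reassoc_id (hD.sw_sw ..), hD.tmap_tmap_assoc, hD.lunit_iso₂, hD.id_comp,
    hD.tmap_id, hD.id_comp]

theorem LCDLaws.bind_pair_nil {A₁ A₁' A₂ A₂' S : D.Obj} (k₁ : D.Hom A₁ A₁') (k₂ : D.Hom A₂ A₂')
    (u : D.Hom D.unit S) :
    (k₁ ⊠ ((k₂ ⊠ (D.lunitInv D.unit ▹ (D.id D.unit ⊠ (D.lunitInv D.unit ▹ (D.id D.unit ⊠ u))))) ▹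
        D.sw A₂' D.unit (D.tens D.unit S) ▹ (D.id D.unit ⊠ (D.id A₂' ⊠ D.lunit S)))) ▹
      (D.id A₁' ⊠ D.lunit (D.tens A₂' S)) = k₁ ⊠ k₂ ⊠ u := by
  have h (w : D.Hom D.unit (D.tens D.unit S)) : k₂ ⊠ (D.lunitInv D.unit ▹ (D.id D.unit ⊠ w)) =
      (k₂ ⊠ w) ▹ (D.id A₂' ⊠ D.lunitInv (D.tens D.unit S)) := by
    rw [hD.tmap_tmap, hD.comp_id, hD.lunitInv_natural]
  rw [h, hD.comp_assoc, hD.reassoc (hD.lunitInv_sw ..), ← hD.lunitInv_natural, hD.tmap_tmap,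
    hD.comp_id, hD.comp_assoc, hD.comp_assoc, hD.lunit_natural, hD.reassoc_id (hD.lunit_iso₂ _),
    hD.tmap_tmap, hD.comp_id, hD.comp_assoc, hD.lunit_iso₂, hD.comp_id]

theorem LCDLaws.bind_cons {B B' W A A' P X R : D.Obj} (k' : D.Hom B B')
    {e : D.Hom (D.tens W A) P} {r : D.Hom P (D.tens A' X)}
    {r' : D.Hom W X} {k : D.Hom A A'} (m : D.Hom (D.tens B' X) R)
    (h : e ▹ r = D.symm W A ▹ (k ⊠ r')) :
    (D.assoc B W A ▹ (D.id B ⊠ e)) ▹ (k' ⊠ r) ▹ D.sw B' A' X ▹ (D.id A' ⊠ m) =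
      D.symm (D.tens B W) A ▹ (k ⊠ ((k' ⊠ r') ▹ m)) := by
  have h₁ : k' ⊠ (D.symm W A ▹ (k ⊠ r')) = (D.id B ⊠ D.symm W A) ▹ (k' ⊠ (k ⊠ r')) := by
    rw [hD.tmap_tmap, hD.id_comp]
  have h₂ : k ⊠ ((k' ⊠ r') ▹ m) = (k ⊠ (k' ⊠ r')) ▹ (D.id A' ⊠ m) := by
    rw [hD.tmap_tmap, hD.comp_id]
  rw [← hD.assoc_symm_sw, h₂, hD.comp_assoc, hD.tmap_tmap_assoc, h, hD.id_comp,
    hD.comp_assoc, hD.comp_assoc, h₁, hD.comp_assoc, hD.sw_natural_assoc]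

theorem LCDLaws.bind_pair_cons {B B' W A₁ A₂ A₁' A₂' P X R : D.Obj} (k' : D.Hom B B')
    {e : D.Hom (D.tens W (D.tens A₁ A₂)) P} {r : D.Hom P (D.tens A₁' (D.tens A₂' X))}
    {r' : D.Hom W X} {k₁ : D.Hom A₁ A₁'} {k₂ : D.Hom A₂ A₂'} (m : D.Hom (D.tens B' X) R)
    (h : e ▹ r = (D.symm W (D.tens A₁ A₂) ▹ D.assoc A₁ A₂ W) ▹ (k₁ ⊠ k₂ ⊠ r')) :
    (D.assoc B W (D.tens A₁ A₂) ▹ (D.id B ⊠ e)) ▹ (k' ⊠ r) ▹ D.sw B' A₁' (D.tens A₂' X) ▹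
        (D.id A₁' ⊠ (D.sw B' A₂' X ▹ (D.id A₂' ⊠ m))) =
      (D.symm (D.tens B W) (D.tens A₁ A₂) ▹ D.assoc A₁ A₂ (D.tens B W)) ▹
        (k₁ ⊠ k₂ ⊠ ((k' ⊠ r') ▹ m)) := by
  have h₁ : k' ⊠ ((D.symm W (D.tens A₁ A₂) ▹ D.assoc A₁ A₂ W) ▹ (k₁ ⊠ k₂ ⊠ r')) =
      (D.id B ⊠ D.symm W (D.tens A₁ A₂)) ▹ (D.id B ⊠ D.assoc A₁ A₂ W) ▹ (k' ⊠ k₁ ⊠ k₂ ⊠ r') := by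
    rw [hD.tmap_tmap, hD.tmap_tmap, hD.id_comp, hD.id_comp, hD.comp_assoc]
  have h₂ : k₁ ⊠ k₂ ⊠ ((k' ⊠ r') ▹ m) = (k₁ ⊠ k₂ ⊠ (k' ⊠ r')) ▹ (D.id A₁' ⊠ D.id A₂' ⊠ m) := by
    rw [hD.tmap_tmap, hD.tmap_tmap, hD.comp_id, hD.comp_id]
  have h₃ : (k₁ ⊠ k' ⊠ k₂ ⊠ r') ▹ (D.id A₁' ⊠ (D.sw B' A₂' X ▹ (D.id A₂' ⊠ m))) =
      (D.id A₁ ⊠ D.sw B A₂ W) ▹ (k₁ ⊠ k₂ ⊠ (k' ⊠ r')) ▹ (D.id A₁' ⊠ D.id A₂' ⊠ m) := by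
    rw [hD.tmap_tmap, hD.sw_natural_assoc, hD.tmap_tmap k₁, hD.tmap_tmap k₂, hD.tmap_tmap,
      hD.id_comp]
  rw [← hD.assoc_symm_sw, h₂, hD.comp_assoc, hD.tmap_tmap_assoc, h, hD.id_comp, h₁,
    hD.comp_assoc, hD.comp_assoc, hD.comp_assoc, hD.comp_assoc, hD.comp_assoc,
    hD.sw_natural_assoc, h₃, hD.reassoc_three (hD.sw_tens ..), hD.comp_assoc]

theorem Restr.bind {N : List ℕ} {x : ℕ} {A : Ty} {S : List (Option Ty)} {Γ : CtxL}
    {r : D.Hom (denCtx D Θ (Γ ++ [(x, A)])) (denSlots D Θ S)}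
    (h : Restr Θ (x :: N) S (Γ ++ [(x, A)]) r) (hx : x ∉ names Γ) :
    BoundRestr Θ N Γ x A S r := by
  induction Γ generalizing S with
  | nil =>
    cases h with
    | cons hk hr hi =>
      cases hr with
      | nil hu =>
        cases hu with
        | cons _ hu =>
          cases hi with
          | there hne => exact absurd rfl hne
          | here =>
            refine .mk (.nil hu) hk ?_
            rw [extHom_nil hD, hD.lunitInv_tmap_lunit]
  | cons a Γ ih =>
    simp only [names, List.map_cons, List.mem_cons, not_or] at hx
    cases h with
    | cons hk hr hi ho =>
      cases ih hr hx.2 with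
      | mk hr' hk' e =>
        cases hi with
        | here => exact absurd rfl hx.1
        | there _ hi =>
          refine .mk (.cons hk hr' hi (ho.imp_right ?_)) hk' ?_
          · exact fun h h' => h (mem_names_append_left _ h')
          · rw [extHom_cons hD]
            exact hD.bind_cons _ _ e

theorem Restr.bindPair {N : List ℕ} {x₁ x₂ : ℕ} {A₁ A₂ : Ty} {S : List (Option Ty)} {Γ : CtxL}
    {r : D.Hom (denCtx D Θ (Γ ++ [(x₁, A₁), (x₂, A₂)])) (denSlots D Θ S)}
    (h : Restr Θ (x₁ :: x₂ :: N) S (Γ ++ [(x₁, A₁), (x₂, A₂)]) r) (hne : x₁ ≠ x₂)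
    (hx₁ : x₁ ∉ names Γ) (hx₂ : x₂ ∉ names Γ) : BoundRestrPair Θ N Γ x₁ A₁ x₂ A₂ S r := by
  induction Γ generalizing S with
  | nil =>
    cases h with
    | cons hk hr hi =>
      cases hr with
      | cons hk' hr hi' =>
        cases hr with
        | nil hu =>
          cases hu with
          | cons _ hu =>
            cases hu with
            | cons _ hu =>
              cases hi' with
              | here => exact absurd rfl hne
              | there _ hi' =>
                cases hi' with
                | there hne => exact absurd rfl hne
                | here =>
                  cases hi with
                  | there hne => exact absurd rfl hne
                  | here =>
                    refine .mk (.nil hu) hk hk' ?_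
                    rw [ext2Hom_nil hD]
                    exact congrArg _ (hD.bind_pair_nil _ _ _)
  | cons a Γ ih =>
    simp only [names, List.map_cons, List.mem_cons, not_or] at hx₁ hx₂
    cases h with
    | cons hk hr hi ho =>
      cases ih hr hx₁.2 hx₂.2 with
      | mk hr' hk₁ hk₂ e =>
        cases hi with
        | here => exact absurd rfl hx₁.1
        | there _ hi =>
          cases hi with
          | here => exact absurd rfl hx₂.1
          | there _ hi =>
            refine .mk (.cons hk hr' hi (ho.imp_right ?_)) hk₁ hk₂ ?_
            · exact fun h h' => h (mem_names_append_left _ h')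
            · rw [ext2Hom_cons hD]
              exact hD.bind_pair_cons _ _ e

end Binders

section Discard

variable {D : LCDData} (hD : LCDLaws D) {Θ : ℕ → D.Obj}
include hD

theorem LCDLaws.discard_cons {B W G P X : D.Obj} (k : D.Hom B D.unit) (s : D.Hom P (D.tens W G))
    (d : D.Hom W D.unit) (r : D.Hom G X) :
    ((D.id B ⊠ s) ▹ D.assocInv B W G) ▹ (((k ⊠ d) ▹ D.lunit D.unit) ⊠ r) ▹ D.lunit X =
      (k ⊠ (s ▹ (d ⊠ r) ▹ D.lunit X)) ▹ D.lunit X := by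
  have h₁ : D.lunit D.unit ⊠ D.id X = D.assoc D.unit D.unit X ▹ (D.id D.unit ⊠ D.lunit X) := by
    rw [← hD.assoc_lunit, hD.lunit_tens]
  rw [hD.comp_assoc, ← hD.comp_id r, hD.tmap_comp, hD.comp_id, hD.comp_assoc, h₁, hD.comp_assoc,
    hD.reassoc (hD.assoc_natural k d r), hD.comp_assoc, hD.reassoc_id (hD.assoc_iso₂ ..),
    hD.tmap_tmap_assoc, hD.tmap_tmap_assoc, hD.id_comp, hD.comp_id, hD.comp_assoc]

theorem LCDLaws.discard_unused_cons {B W X : D.Obj} (k : D.Hom B D.unit)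
    (d : D.Hom W D.unit) (u : D.Hom D.unit X) :
    ((k ⊠ d) ▹ D.lunit D.unit) ▹ u = (k ⊠ (d ▹ u)) ▹ D.lunit X := by
  rw [hD.comp_assoc, ← hD.lunit_natural, hD.tmap_tmap_assoc, hD.comp_id]

theorem Restr.discard {N : List ℕ} {S : List (Option Ty)} {Γ : CtxL}
    {r : D.Hom (denCtx D Θ Γ) (denSlots D Θ S)} (h : Restr Θ N S Γ r) {Δ : CtxL}
    (hΔ : ∀ x ∈ names Δ, Fresh x N S) :
    Restr Θ N S (bangify Δ ++ Γ)
      (QLamSem.splitCtx D Θ (bangify Δ) Γ ▹ (discCtx D Θ Δ ⊠ r) ▹ D.lunit _) := by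
  induction Δ with
  | nil =>
    have : QLamSem.splitCtx D Θ (bangify []) Γ ▹ (discCtx D Θ [] ⊠ r) ▹ D.lunit _ = r := by
      change D.lunitInv _ ▹ (D.id _ ⊠ r) ▹ D.lunit _ = r
      rw [hD.lunit_natural, hD.reassoc_id (hD.lunit_iso₂ _)]
    rwa [this]
  | cons p Δ ih =>
    simp only [names, List.map_cons, List.mem_cons, forall_eq_or_imp] at hΔ
    exact (hD.discard_cons _ _ _ _).symm ▸
      Restr.cons (.drop p.2) (ih hΔ.2) (hΔ.1.ins hD) (.inl rfl)

theorem Unused.discard {N : List ℕ} {S : List (Option Ty)} {u : D.Hom D.unit (denSlots D Θ S)}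
    {c : D.Hom (denSlots D Θ S) D.unit} (h : Unused Θ N S u c) {Δ : CtxL}
    (hΔ : names Δ ⊆ N) : Restr Θ N S (bangify Δ) (discCtx D Θ Δ ▹ u) := by
  induction Δ with
  | nil => exact (hD.id_comp u).symm ▸ .nil h
  | cons p Δ ih =>
    simp only [names, List.map_cons, List.cons_subset] at hΔ
    exact (hD.discard_unused_cons _ _ _).symm ▸
      Restr.cons (.drop p.2) (ih hΔ.2) ((h.fresh hΔ.1).ins hD) (.inl rfl)

theorem Ins.select {x : ℕ} {A : Ty} {N : List ℕ} {S S' : List (Option Ty)}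
    {m : D.Hom (D.tens (denSlot D Θ (some A)) (denSlots D Θ S)) (denSlots D Θ S')}
    (h : Ins Θ x (some A) N S S' m) {u : D.Hom D.unit (denSlots D Θ S)}
    {c : D.Hom (denSlots D Θ S) D.unit} (hu : Unused Θ N S u c) :
    ∃ p, Select Θ x A N S' p ∧ m ▹ p = (D.id _ ⊠ c) ▹ D.runit _ := by
  induction h with
  | here =>
    cases hu with
    | cons _ hu =>
      refine ⟨_, .here hu, ?_⟩
      rw [hD.tmap_tmap_assoc, hD.id_comp, hD.lunit_natural]
  | there hne _ ih =>
    cases hu with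
    | cons _ hu =>
      obtain ⟨p, hp, e⟩ := ih hu
      refine ⟨_, .there hne hp, ?_⟩
      rw [hD.comp_assoc, hD.reassoc (hD.lunit_natural _), hD.comp_assoc, e,
        hD.reassoc (hD.sw_unit ..), hD.tmap_tmap_assoc, hD.lunit_natural, hD.comp_id]

end Discard

section Banged

variable {D : LCDData} {Θ : ℕ → D.Obj}

theorem Unused.banged {N : List ℕ} {S : List (Option Ty)} {u : D.Hom D.unit (denSlots D Θ S)}
    {c : D.Hom (denSlots D Θ S) D.unit} (h : Unused Θ N S u c) : Banged S := by
  induction h with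
  | nil => simp [Banged]
  | cons _ _ ih => simpa [Banged] using ih

theorem Ins.banged {x : ℕ} {o : Option Ty} {N : List ℕ} {S S' : List (Option Ty)}
    {m : D.Hom (D.tens (denSlot D Θ o) (denSlots D Θ S)) (denSlots D Θ S')}
    (h : Ins Θ x o N S S' m) (ho : Banged [o]) (hS : Banged S) : Banged S' := by
  induction h with
  | here =>
    intro A hA
    obtain rfl | h := List.mem_cons.1 hA
    · exact ho A List.mem_cons_self
    · exact hS A (List.mem_cons_of_mem _ h)
  | there _ _ ih =>
    intro A hA
    obtain rfl | h := List.mem_cons.1 hA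
    · exact hS A List.mem_cons_self
    · exact ih (fun B hB => hS B (List.mem_cons_of_mem _ hB)) A h

theorem Restr.banged {N : List ℕ} {S : List (Option Ty)} {Γ : CtxL}
    {r : D.Hom (denCtx D Θ Γ) (denSlots D Θ S)} (h : Restr Θ N S Γ r)
    (hΓ : ∀ p ∈ Γ, p.2.IsBang) : Banged S := by
  induction h with
  | nil h => exact h.banged
  | cons hk _ hi _ ih =>
    refine hi.banged ?_ (ih fun p hp => hΓ p (List.mem_cons_of_mem _ hp))
    cases hk with
    | use A => simpa [Banged] using hΓ _ List.mem_cons_self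
    | drop A => simp [Banged]

theorem isBang_of_mem_bangify {Δ : CtxL} : ∀ p ∈ bangify Δ, p.2.IsBang := by
  intro p hp
  obtain ⟨q, _, rfl⟩ := List.mem_map.1 hp
  trivial

theorem LCDLaws.coalg_denSlots (hD : LCDLaws D) {S : List (Option Ty)} (h : Banged S) :
    Coalg D (denSlots D Θ S) := by
  induction S with
  | nil => exact hD.coalg_unit
  | cons o S ih =>
    refine hD.coalg_tens ?_ (ih fun A hA => h A (List.mem_cons_of_mem _ hA))
    match o, h with
    | none, _ => exact hD.coalg_unit
    | some (.bang A), _ => exact hD.coalg_bang _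
    | some (.unit), h => exact (h _ List.mem_cons_self).elim
    | some (.tconst _), h => exact (h _ List.mem_cons_self).elim
    | some (.arrow _ _), h => exact (h _ List.mem_cons_self).elim
    | some (.tensor _ _), h => exact (h _ List.mem_cons_self).elim

end Banged

section Kleisli

variable {D : LCDData} (hD : LCDLaws D)
include hD

theorem LCDLaws.PhiInv_natural {X X' A B : D.Obj} (f : D.Hom X' X)
    (g : D.Hom (D.tens X A) (D.T B)) : D.PhiInv ((f ⊠ D.id A) ▹ g) = f ▹ D.PhiInv g := by
  rw [← hD.Phi_iso₁ (f ▹ D.PhiInv g), hD.Phi_natural_left, hD.Phi_iso₂]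

theorem LCDLaws.PhiInv_bind {W A A' X P B : D.Obj} {e : D.Hom (D.tens W A) P}
    {r : D.Hom P (D.tens A' X)} {k : D.Hom A A'} {r' : D.Hom W X}
    (h : e ▹ r = D.symm W A ▹ (k ⊠ r')) (g : D.Hom (D.tens A' X) (D.T B)) :
    D.PhiInv (e ▹ r ▹ g) = r' ▹ D.PhiInv (D.symm X A ▹ (k ⊠ D.id X) ▹ g) := by
  rw [← hD.PhiInv_natural, hD.reassoc (hD.symm_natural _ _), hD.comp_assoc, hD.tmap_tmap_assoc,
    hD.id_comp, hD.comp_id, hD.reassoc h, hD.comp_assoc]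

theorem LCDLaws.monLet_symm (b : Bool) {P W Q C : D.Obj} (e : D.Hom (D.tens W P) Q)
    (g : D.Hom Q ((mon D b).obj C)) : monLet D b (D.symm P W ▹ e ▹ g) =
      D.symm _ W ▹ (mon D b).str W P ▹ (mon D b).map e ▹ (mon D b).map g ▹ (mon D b).mu C := by
  rw [monLet, hD.reassoc_id (hD.symm_symm ..), mon_map_comp hD, hD.comp_assoc]

end Kleisli

section Interpretation

variable {D : LCDData} {cty : ℕ → Ty} (I : Interp D cty)

/-- The computational (`b = true`) or value (`b = false`) interpretation. -/
def denM {Γ : CtxL} {M : Tm} {A : Ty} (π : TypingD cty Γ M A) :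
    (b : Bool) → (b = false → isValue M = true) →
      D.Hom (denCtx D I.obj Γ) ((mon D b).obj (denTy D I.obj A))
  | true, _ => denC I π
  | false, h => denV I π (h rfl)

theorem denM_swap {Γ₁ Γ₂ : CtxL} {p q : ℕ × Ty} {M : Tm} {A : Ty}
    (d : TypingD cty (Γ₁ ++ p :: q :: Γ₂) M A) (b : Bool) (h : b = false → isValue M = true) :
    denM I (.swap d) b h = swapMor D I.obj Γ₁ p q Γ₂ ▹ denM I d b h := by
  cases b <;> rfl

variable (hD : LCDLaws D)
include hD

theorem denM_var {Δ : CtxL} {x : ℕ} {A B : Ty} (hx : x ∉ names Δ) (s : SubD A B) (b : Bool)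
    (h : b = false → isValue (.var x B) = true) :
    denM I (.var hx s) b h = splitCtx D I.obj (bangify Δ) [(x, A)] ▹
      (discCtx D I.obj Δ ⊠ D.runit _) ▹ D.lunit _ ▹ Isub D I.obj s ▹ (mon D b).eta _ := by
  cases b
  · have : D.lunit _ ▹ Isub D I.obj s ▹ (mon D false).eta _ = D.lunit _ ▹ Isub D I.obj s :=
      congrArg _ (hD.comp_id _)
    rw [this]; rfl
  · rfl

theorem denM_cst {Δ : CtxL} {k : ℕ} {B : Ty} (s : SubD (.bang (cty k)) B) (b : Bool)
    (h : b = false → isValue (.cst k B) = true) :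
    denM I (.cst (Δ := Δ) s) b h =
      discCtx D I.obj Δ ▹ I.cst k ▹ Isub D I.obj s ▹ (mon D b).eta _ := by
  cases b
  · have : I.cst k ▹ Isub D I.obj s ▹ (mon D false).eta _ = I.cst k ▹ Isub D I.obj s :=
      congrArg _ (hD.comp_id _)
    rw [this]; rfl
  · rfl

theorem denM_star {Δ : CtxL} {n : ℕ} (b : Bool) (h : b = false → isValue (.star n) = true) :
    denM I (.star (cty := cty) (Δ := Δ) (n := n)) b h =
      discCtx D I.obj Δ ▹ starMap D I.obj n ▹ (mon D b).eta _ := by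
  cases b
  · exact congrArg _ (hD.comp_id _).symm
  · rfl

theorem denM_lam_zero {Δ : CtxL} {x : ℕ} {A B : Ty} {M : Tm} (hx : x ∉ names Δ)
    (d : TypingD cty (Δ ++ [(x, A)]) M B) (b : Bool)
    (h : b = false → isValue (.lam 0 x A M) = true) :
    denM I (.lam0 hx d) b h =
      D.PhiInv (extHom D I.obj Δ x A ▹ denM I d true nofun) ▹ (mon D b).eta _ := by
  cases b
  · exact (hD.comp_id _).symm
  · rfl

theorem denM_lam_succ {Δ : CtxL} {n x : ℕ} {A B : Ty} {M : Tm} (hx : x ∉ names Δ)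
    (d : TypingD cty (bangify Δ ++ [(x, A)]) M B) (b : Bool)
    (h : b = false → isValue (.lam (n + 1) x A M) = true) :
    denM I (.lamS (n := n) hx d) b h = (promCtx D I.obj Δ ▹
      D.Lmap (D.PhiInv (extHom D I.obj (bangify Δ) x A ▹ denM I d true nofun)) ▹
        D.castHom rfl (denTy_bangN D I.obj (n + 1) (.arrow A B)).symm
          (padL D n (denTy D I.obj (.arrow A B)))) ▹ (mon D b).eta _ := by
  cases b
  · exact (hD.comp_id _).symm
  · refine Eq.trans ?_ (hD.comp_assoc _ _ _).symm
    exact congrArg _ (hD.comp_assoc _ _ _).symm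

theorem denM_pair {Δ Γ₁ Γ₂ : CtxL} {n : ℕ} {M₁ M₂ : Tm} {A₁ A₂ : Ty}
    (hn : (names (bangify Δ ++ Γ₁ ++ Γ₂)).Nodup)
    (d₁ : TypingD cty (bangify Δ ++ Γ₁) M₁ (bangN n A₁))
    (d₂ : TypingD cty (bangify Δ ++ Γ₂) M₂ (bangN n A₂)) (b : Bool)
    (h : b = false → isValue (.pair n M₁ M₂) = true) : ∃ h₁ h₂,
    denM I (.pair hn d₁ d₂) b h = splitDup D I.obj Δ Γ₁ Γ₂ ▹ (denM I d₁ b h₁ ⊠ denM I d₂ b h₂) ▹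
      monPair D b _ _ ▹ (mon D b).map (m2nD D I.obj n A₁ A₂) := by
  refine ⟨fun e => (Bool.and_eq_true_iff.1 (h e)).1, fun e => (Bool.and_eq_true_iff.1 (h e)).2, ?_⟩
  cases b
  · rw [hD.monPair_false]
    exact congrArg _ (congrArg _ (hD.id_comp _).symm)
  · rfl

theorem denM_letv {Δ Γ₁ Γ₂ : CtxL} {x : ℕ} {A : Ty} {M N : Tm} {B : Ty}
    (hn : (names (bangify Δ ++ Γ₁ ++ Γ₂)).Nodup) (hx : x ∉ names (bangify Δ ++ Γ₁ ++ Γ₂))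
    (d₁ : TypingD cty (bangify Δ ++ Γ₁) M A)
    (d₂ : TypingD cty ((bangify Δ ++ Γ₂) ++ [(x, A)]) N B) (b : Bool)
    (h : b = false → isValue (.letv x A M N) = true) : ∃ h₁ h₂,
    denM I (.letv hn hx d₁ d₂) b h = splitDup D I.obj Δ Γ₁ Γ₂ ▹ (denM I d₁ b h₁ ⊠ D.id _) ▹
      monLet D b (D.symm _ _ ▹ extHom D I.obj (bangify Δ ++ Γ₂) x A ▹ denM I d₂ b h₂) := by
  refine ⟨fun e => (Bool.and_eq_true_iff.1 (h e)).1, fun e => (Bool.and_eq_true_iff.1 (h e)).2, ?_⟩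
  cases b
  · rw [hD.monLet_false]; rfl
  · rw [hD.monLet_symm]; rfl

theorem denM_letUnit {Δ Γ₁ Γ₂ : CtxL} {M N : Tm} {B : Ty}
    (hn : (names (bangify Δ ++ Γ₁ ++ Γ₂)).Nodup) (d₁ : TypingD cty (bangify Δ ++ Γ₁) M .unit)
    (d₂ : TypingD cty (bangify Δ ++ Γ₂) N B) (b : Bool)
    (h : b = false → isValue (.letUnit M N) = true) : ∃ h₁ h₂,
    denM I (.letUnit hn d₁ d₂) b h = splitDup D I.obj Δ Γ₁ Γ₂ ▹ (denM I d₁ b h₁ ⊠ D.id _) ▹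
      monLet D b (D.lunit _ ▹ denM I d₂ b h₂) := by
  refine ⟨fun e => (Bool.and_eq_true_iff.1 (h e)).1, fun e => (Bool.and_eq_true_iff.1 (h e)).2, ?_⟩
  rw [← hD.reassoc (hD.symm_runit _)]
  cases b
  · rw [hD.monLet_false]; rfl
  · rw [hD.monLet_symm]; rfl

theorem denM_letPair {Δ Γ₁ Γ₂ : CtxL} {n x₁ : ℕ} {A₁ : Ty} {x₂ : ℕ} {A₂ : Ty} {M N : Tm} {A : Ty}
    (hn : (names (bangify Δ ++ Γ₁ ++ Γ₂)).Nodup) (hne : x₁ ≠ x₂)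
    (hx₁ : x₁ ∉ names (bangify Δ ++ Γ₁ ++ Γ₂)) (hx₂ : x₂ ∉ names (bangify Δ ++ Γ₁ ++ Γ₂))
    (d₁ : TypingD cty (bangify Δ ++ Γ₁) M (bangN n (.tensor A₁ A₂)))
    (d₂ : TypingD cty ((bangify Δ ++ Γ₂) ++ [(x₁, bangN n A₁), (x₂, bangN n A₂)]) N A) (b : Bool)
    (h : b = false → isValue (.letPair n x₁ A₁ x₂ A₂ M N) = true) : ∃ h₁ h₂,
    denM I (.letPair hn hne hx₁ hx₂ d₁ d₂) b h =
      splitDup D I.obj Δ Γ₁ Γ₂ ▹ (denM I d₁ b h₁ ⊠ D.id _) ▹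
        monLet D b (D.symm _ _ ▹ ((D.id _ ⊠ m2nDInv D I.obj n A₁ A₂) ▹
          ext2Hom D I.obj (bangify Δ ++ Γ₂) x₁ (bangN n A₁) x₂ (bangN n A₂)) ▹ denM I d₂ b h₂) := by
  refine ⟨fun e => (Bool.and_eq_true_iff.1 (h e)).1, fun e => (Bool.and_eq_true_iff.1 (h e)).2, ?_⟩
  cases b
  · rw [hD.monLet_false, hD.comp_assoc]; rfl
  · rw [hD.monLet_symm]; rfl

end Interpretation

section Factorisation

variable {D : LCDData} {cty : ℕ → Ty} (I : Interp D cty)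

/-- The interpretation of `π` factors through the restriction of its context to the used
variables. -/
def Factors {Γ : CtxL} {M : Tm} {A : Ty} (π : TypingD cty Γ M A) : Prop :=
  ∀ N : List ℕ, names Γ ⊆ N → ∃ S r, Restr I.obj N S Γ r ∧
    ∀ b h, ∃ f, Den I b N (erase M) S A f ∧ denM I π b h = r ▹ f

theorem names_bangify (Δ : CtxL) : names (bangify Δ) = names Δ := by
  simp [names, bangify, Function.comp_def]

variable {I} (hD : LCDLaws D)
include hD

theorem LCDLaws.factor_var {P W G A B C X : D.Obj} (s : D.Hom P (D.tens W G)) (d : D.Hom W D.unit)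
    {r : D.Hom G X} {p : D.Hom X A} {t : D.Hom G A} (e : r ▹ p = t) (k : D.Hom A B)
    (l : D.Hom B C) :
    s ▹ (d ⊠ t) ▹ D.lunit A ▹ k ▹ l = (s ▹ (d ⊠ r) ▹ D.lunit X) ▹ (p ▹ k) ▹ l := by
  rw [hD.comp_assoc, hD.comp_assoc, hD.comp_assoc, hD.reassoc (hD.lunit_natural p).symm,
    hD.comp_assoc, hD.tmap_tmap_assoc, hD.comp_id, e]

theorem LCDLaws.factor_lam_succ {W A B : D.Obj} {w : D.Hom W (D.L W)} (hw : w ▹ D.eps W = D.id W)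
    {c : D.Hom (D.L A) B} {l : D.Hom B A} (hc : c ▹ l = D.eps A) (f : D.Hom W A) :
    (w ▹ D.Lmap f ▹ c) ▹ l = f := by
  rw [hD.comp_assoc, hD.comp_assoc, hc, hD.eps_natural, hD.reassoc_id hw]

theorem LCDLaws.factor_pair {P X Y X' Y' Q R C : D.Obj} {s : D.Hom P (D.tens X Y)}
    {r₁ : D.Hom X X'} {r₂ : D.Hom Y Y'} {r : D.Hom P Q} {m : D.Hom Q (D.tens X' Y')}
    (e : s ▹ (r₁ ⊠ r₂) = r ▹ m) {B B' : D.Obj} (f : D.Hom X' B) (g : D.Hom Y' B')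
    (k : D.Hom (D.tens B B') R) (l : D.Hom R C) :
    s ▹ ((r₁ ▹ f) ⊠ (r₂ ▹ g)) ▹ k ▹ l = r ▹ m ▹ ((f ⊠ g) ▹ k) ▹ l := by
  rw [hD.tmap_comp, hD.comp_assoc, hD.reassoc e, hD.comp_assoc, hD.comp_assoc]

theorem LCDLaws.factor_let (b : Bool) {P X Y X' Y' Q A C : D.Obj} {s : D.Hom P (D.tens X Y)}
    {r₁ : D.Hom X X'} {r₂ : D.Hom Y Y'} {r : D.Hom P Q} {m : D.Hom Q (D.tens X' Y')}
    (e : s ▹ (r₁ ⊠ r₂) = r ▹ m) (f : D.Hom X' ((mon D b).obj A))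
    {h : D.Hom (D.tens A Y) ((mon D b).obj C)} {h' : D.Hom (D.tens A Y') ((mon D b).obj C)}
    (eh : h = (D.id A ⊠ r₂) ▹ h') :
    s ▹ ((r₁ ▹ f) ⊠ D.id Y) ▹ monLet D b h = r ▹ m ▹ (f ⊠ D.id Y') ▹ monLet D b h' := by
  rw [eh, ← hD.id_tmap_monLet, hD.tmap_tmap_assoc, hD.comp_id, hD.id_comp, ← hD.comp_assoc r m, ← e,
    hD.comp_assoc, hD.tmap_tmap_assoc, hD.comp_id]

theorem LCDLaws.factor_bind {W A A' X P C : D.Obj} {e : D.Hom (D.tens W A) P}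
    {r : D.Hom P (D.tens A' X)} {k : D.Hom A A'} {r' : D.Hom W X}
    (h : e ▹ r = D.symm W A ▹ (k ⊠ r')) (g : D.Hom (D.tens A' X) C) :
    D.symm A W ▹ e ▹ r ▹ g = (D.id A ⊠ r') ▹ (k ⊠ D.id X) ▹ g := by
  rw [hD.reassoc h, hD.comp_assoc, hD.reassoc_id (hD.symm_symm ..), hD.tmap_tmap_assoc, hD.id_comp,
    hD.comp_id]

theorem LCDLaws.factor_bind_pair {W T A₁ A₂ A₁' A₂' X P C : D.Obj} (t : D.Hom T (D.tens A₁ A₂))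
    {e : D.Hom (D.tens W (D.tens A₁ A₂)) P} {r : D.Hom P (D.tens A₁' (D.tens A₂' X))}
    {k₁ : D.Hom A₁ A₁'} {k₂ : D.Hom A₂ A₂'} {r' : D.Hom W X}
    (h : e ▹ r = (D.symm W (D.tens A₁ A₂) ▹ D.assoc A₁ A₂ W) ▹ (k₁ ⊠ k₂ ⊠ r'))
    (g : D.Hom (D.tens A₁' (D.tens A₂' X)) C) :
    D.symm T W ▹ ((D.id W ⊠ t) ▹ e) ▹ r ▹ g =
      (D.id T ⊠ r') ▹ (t ⊠ D.id X) ▹ D.assoc A₁ A₂ X ▹ (k₁ ⊠ k₂ ⊠ D.id X) ▹ g := by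
  rw [hD.comp_assoc, hD.reassoc h, hD.comp_assoc, hD.comp_assoc,
    hD.reassoc (hD.symm_natural _ _).symm.symm, hD.comp_assoc,
    hD.reassoc_id (hD.symm_symm ..), hD.tmap_tmap_assoc, hD.id_comp, hD.comp_id]
  have : t ⊠ r' = (t ⊠ D.id W) ▹ ((D.id A₁ ⊠ D.id A₂) ⊠ r') := by
    rw [hD.tmap_tmap, hD.tmap_id, hD.comp_id, hD.id_comp]
  rw [this, hD.comp_assoc, hD.reassoc (hD.assoc_natural _ _ _), hD.comp_assoc, hD.tmap_tmap_assoc,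
    hD.tmap_tmap, hD.id_comp, hD.id_comp, hD.comp_id]

omit hD in
theorem names_subset_left {Δ Γ₁ Γ₂ : CtxL} {N : List ℕ} (h : names (Δ ++ Γ₁ ++ Γ₂) ⊆ N) :
    names (Δ ++ Γ₁) ⊆ N :=
  fun _ hx => h (mem_names_append_left _ hx)

omit hD in
theorem names_subset_right {Δ Γ₁ Γ₂ : CtxL} {N : List ℕ} (h : names (Δ ++ Γ₁ ++ Γ₂) ⊆ N) :
    names (Δ ++ Γ₂) ⊆ N := by
  simp only [names, List.map_append, List.append_subset] at h ⊢
  exact ⟨h.1.1, h.2⟩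

omit hD in
theorem names_append_pair_subset {Γ : CtxL} {x₁ x₂ : ℕ} {A₁ A₂ : Ty} {N : List ℕ}
    (h : names Γ ⊆ N) : names (Γ ++ [(x₁, A₁), (x₂, A₂)]) ⊆ x₁ :: x₂ :: N := by
  rw [names, List.map_append, List.append_subset]
  exact ⟨fun y hy => List.mem_cons_of_mem _ (List.mem_cons_of_mem _ (h hy)), by simp⟩

theorem Factors.swap {Γ₁ Γ₂ : CtxL} {p q : ℕ × Ty} {M : Tm} {A : Ty}
    {d : TypingD cty (Γ₁ ++ p :: q :: Γ₂) M A} (hd : Factors I d) : Factors I (.swap d) := by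
  intro N hN
  obtain ⟨S, r, hr, hf⟩ := hd N fun x hx => hN (by simpa [names, or_comm, or_left_comm] using hx)
  refine ⟨S, _, hr.swap hD, fun b h => ?_⟩
  obtain ⟨f, hf, e⟩ := hf b h
  exact ⟨f, hf, by rw [denM_swap, e, hD.comp_assoc]⟩

theorem Factors.var {Δ : CtxL} {x : ℕ} {A B : Ty} (hx : x ∉ names Δ) (s : SubD A B) :
    Factors I (.var hx s) := by
  intro N hN
  rw [names, List.map_append, List.append_subset] at hN
  obtain ⟨S, u, c, hu⟩ := exists_unused I.obj N
  obtain ⟨S', m, hm⟩ := (hu.fresh (hN.2 List.mem_cons_self)).exists_ins (some A)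
  obtain ⟨p, hp, e⟩ := hm.select hD hu
  have hr := Restr.cons (.use A) (.nil hu) hm (.inr List.not_mem_nil)
  refine ⟨S', _, hr.discard hD (Δ := Δ) fun y hy => hr.fresh (hN.1 ?_) ?_, fun b h =>
    ⟨_, .var s hp, ?_⟩⟩
  · change y ∈ names (bangify Δ)
    rwa [names_bangify]
  · simpa [names] using ne_of_mem_of_not_mem hy hx
  · rw [denM_var I hD]
    have e' : ((D.id _ ⊠ u) ▹ m) ▹ p = D.runit _ := by
      rw [hD.comp_assoc, e, hD.tmap_tmap_assoc, hu.comp_eq_id hD, hD.id_comp, hD.tmap_id,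
        hD.id_comp]
    exact hD.factor_var _ _ e' _ _

theorem Factors.cst {Δ : CtxL} {k : ℕ} {B : Ty} (s : SubD (.bang (cty k)) B) :
    Factors I (.cst (Δ := Δ) s) := by
  intro N hN
  obtain ⟨S, u, c, hu⟩ := exists_unused I.obj N
  refine ⟨S, _, hu.discard hD ?_, fun b h => ⟨_, .cst s hu, ?_⟩⟩
  · exact names_bangify Δ ▸ hN
  · rw [denM_cst I hD, hD.comp_assoc, hD.comp_assoc, hD.comp_assoc, hD.reassoc_id (hu.comp_eq_id hD)]

theorem Factors.star {Δ : CtxL} {n : ℕ} : Factors I (.star (cty := cty) (Δ := Δ) (n := n)) := by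
  intro N hN
  obtain ⟨S, u, c, hu⟩ := exists_unused I.obj N
  refine ⟨S, _, hu.discard hD ?_, fun b h => ⟨_, .star (q := c ▹ starMap D I.obj n) n hu ?_, ?_⟩⟩
  · exact names_bangify Δ ▸ hN
  · rw [hD.comp_assoc, starMap_collD hD, hD.comp_id]
  · rw [denM_star I hD, hD.comp_assoc, hD.comp_assoc, hD.reassoc_id (hu.comp_eq_id hD)]

omit hD in
theorem names_append_subset_cons {Γ : CtxL} {x : ℕ} {A : Ty} {N : List ℕ} (h : names Γ ⊆ N) :
    names (Γ ++ [(x, A)]) ⊆ x :: N := by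
  rw [names, List.map_append, List.append_subset]
  exact ⟨fun y hy => List.mem_cons_of_mem _ (h hy), by simp⟩

theorem Factors.lam_zero {Δ : CtxL} {x : ℕ} {A B : Ty} {M : Tm} (hx : x ∉ names Δ)
    {d : TypingD cty (Δ ++ [(x, A)]) M B} (hd : Factors I d) : Factors I (.lam0 hx d) := by
  intro N hN
  obtain ⟨S, r, hr, hf⟩ := hd _ (names_append_subset_cons hN)
  obtain ⟨g, hg, e⟩ := hf true nofun
  cases hr.bind hD hx with
  | mk hr' hk er =>
    refine ⟨_, _, hr', fun b h => ⟨_, .lam 0 (fun h => absurd h (lt_irrefl 0)) hg hk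
      (hD.comp_id _), ?_⟩⟩
    rw [denM_lam_zero I hD, e, hD.PhiInv_bind er, hD.comp_assoc]

theorem Factors.lam_succ {Δ : CtxL} {n x : ℕ} {A B : Ty} {M : Tm} (hx : x ∉ names Δ)
    {d : TypingD cty (bangify Δ ++ [(x, A)]) M B} (hd : Factors I d) :
    Factors I (.lamS (n := n) hx d) := by
  intro N hN
  have hx' : x ∉ names (bangify Δ) := names_bangify Δ ▸ hx
  obtain ⟨S, r, hr, hf⟩ := hd _ (names_append_subset_cons hN)
  obtain ⟨g, hg, e⟩ := hf true nofun
  cases hr.bind hD hx' with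
  | mk hr' hk er =>
    have hS := hr'.banged isBang_of_mem_bangify
    obtain ⟨q, hq⟩ := collD_lift hD I.obj (n := n + 1) (A := .arrow A B)
      (fun _ => hD.coalg_denSlots hS) (D.PhiInv (D.symm _ _ ▹ (_ ⊠ D.id _) ▹ g))
    refine ⟨_, _, hr', fun b h => ⟨_, .lam (n + 1) (fun _ => hS) hg hk hq, ?_⟩⟩
    rw [denM_lam_succ I hD]
    refine Eq.trans ?_ (hD.comp_assoc _ _ _)
    refine congrArg (fun t => t ▹ (mon D b).eta _) (collD_ext hD I.obj (fun _ => coalg_bangify hD I.obj Δ) ?_)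
    refine (hD.factor_lam_succ (promCtx_eps hD I.obj Δ)
      (castHom_padL_collD hD I.obj n (.arrow A B)) _).trans ?_
    rw [e, hD.PhiInv_bind er g, ← hq, hD.comp_assoc]

theorem Factors.app {Δ Γ₁ Γ₂ : CtxL} {M N : Tm} {A B : Ty}
    (hn : (names (bangify Δ ++ Γ₁ ++ Γ₂)).Nodup)
    {d₁ : TypingD cty (bangify Δ ++ Γ₁) M (.arrow A B)} {d₂ : TypingD cty (bangify Δ ++ Γ₂) N A}
    (hd₁ : Factors I d₁) (hd₂ : Factors I d₂) : Factors I (.app hn d₁ d₂) := by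
  intro V hV
  obtain ⟨S₁, r₁, hr₁, hf₁⟩ := hd₁ V (names_subset_left hV)
  obtain ⟨S₂, r₂, hr₂, hf₂⟩ := hd₂ V (names_subset_right hV)
  obtain ⟨S, r, m, hr, hm, e⟩ := hr₁.splitDup hD hr₂ hn hV
  obtain ⟨f, hf, ef⟩ := hf₁ true nofun
  obtain ⟨g, hg, eg⟩ := hf₂ true nofun
  refine ⟨S, r, hr, fun b h => ?_⟩
  cases b with
  | false => exact absurd (h rfl) nofun
  | true =>
    refine ⟨_, .app hm hf hg, ?_⟩
    change splitDup D I.obj Δ Γ₁ Γ₂ ▹ (denM I d₁ true nofun ⊠ denM I d₂ true nofun) ▹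
      monPair D true _ _ ▹ D.Tmap (D.appnt _ _) ▹ D.mu _ = _
    rw [ef, eg]
    exact hD.factor_pair e _ _ _ _

theorem Factors.pair {Δ Γ₁ Γ₂ : CtxL} {n : ℕ} {M₁ M₂ : Tm} {A₁ A₂ : Ty}
    (hn : (names (bangify Δ ++ Γ₁ ++ Γ₂)).Nodup)
    {d₁ : TypingD cty (bangify Δ ++ Γ₁) M₁ (bangN n A₁)}
    {d₂ : TypingD cty (bangify Δ ++ Γ₂) M₂ (bangN n A₂)}
    (hd₁ : Factors I d₁) (hd₂ : Factors I d₂) : Factors I (.pair hn d₁ d₂) := by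
  intro V hV
  obtain ⟨S₁, r₁, hr₁, hf₁⟩ := hd₁ V (names_subset_left hV)
  obtain ⟨S₂, r₂, hr₂, hf₂⟩ := hd₂ V (names_subset_right hV)
  obtain ⟨S, r, m, hr, hm, e⟩ := hr₁.splitDup hD hr₂ hn hV
  refine ⟨S, r, hr, fun b h => ?_⟩
  obtain ⟨h₁, h₂, eq⟩ := denM_pair I hD hn d₁ d₂ b h
  obtain ⟨f, hf, ef⟩ := hf₁ b h₁
  obtain ⟨g, hg, eg⟩ := hf₂ b h₂
  refine ⟨_, .pair n hm hf hg, ?_⟩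
  rw [eq, ef, eg]
  exact hD.factor_pair e _ _ _ _

theorem Factors.letv {Δ Γ₁ Γ₂ : CtxL} {x : ℕ} {A : Ty} {M N : Tm} {B : Ty}
    (hn : (names (bangify Δ ++ Γ₁ ++ Γ₂)).Nodup) (hx : x ∉ names (bangify Δ ++ Γ₁ ++ Γ₂))
    {d₁ : TypingD cty (bangify Δ ++ Γ₁) M A}
    {d₂ : TypingD cty ((bangify Δ ++ Γ₂) ++ [(x, A)]) N B}
    (hd₁ : Factors I d₁) (hd₂ : Factors I d₂) : Factors I (.letv hn hx d₁ d₂) := by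
  intro V hV
  obtain ⟨S₁, r₁, hr₁, hf₁⟩ := hd₁ V (names_subset_left hV)
  obtain ⟨S₂, r₂, hr₂, hf₂⟩ := hd₂ _ (names_append_subset_cons (names_subset_right hV))
  cases hr₂.bind hD (fun h => hx (names_subset_right (List.Subset.refl _) h)) with
  | mk hr' hk er =>
    obtain ⟨S, r, m, hr, hm, e⟩ := hr₁.splitDup hD hr' hn hV
    refine ⟨S, r, hr, fun b h => ?_⟩
    obtain ⟨h₁, h₂, eq⟩ := denM_letv I hD hn hx d₁ d₂ b h
    obtain ⟨f, hf, ef⟩ := hf₁ b h₁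
    obtain ⟨g, hg, eg⟩ := hf₂ b h₂
    refine ⟨_, .letv hm hf hg hk, ?_⟩
    rw [eq, ef, eg]
    exact hD.factor_let b e _ (hD.factor_bind er g)

theorem Factors.letUnit {Δ Γ₁ Γ₂ : CtxL} {M N : Tm} {B : Ty}
    (hn : (names (bangify Δ ++ Γ₁ ++ Γ₂)).Nodup)
    {d₁ : TypingD cty (bangify Δ ++ Γ₁) M .unit} {d₂ : TypingD cty (bangify Δ ++ Γ₂) N B}
    (hd₁ : Factors I d₁) (hd₂ : Factors I d₂) : Factors I (.letUnit hn d₁ d₂) := by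
  intro V hV
  obtain ⟨S₁, r₁, hr₁, hf₁⟩ := hd₁ V (names_subset_left hV)
  obtain ⟨S₂, r₂, hr₂, hf₂⟩ := hd₂ V (names_subset_right hV)
  obtain ⟨S, r, m, hr, hm, e⟩ := hr₁.splitDup hD hr₂ hn hV
  refine ⟨S, r, hr, fun b h => ?_⟩
  obtain ⟨h₁, h₂, eq⟩ := denM_letUnit I hD hn d₁ d₂ b h
  obtain ⟨f, hf, ef⟩ := hf₁ b h₁
  obtain ⟨g, hg, eg⟩ := hf₂ b h₂
  refine ⟨_, .letUnit hm hf hg, ?_⟩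
  rw [eq, ef, eg]
  exact hD.factor_let b e _ (hD.reassoc (hD.lunit_natural r₂).symm g |>.trans (hD.comp_assoc ..))

theorem Factors.letPair {Δ Γ₁ Γ₂ : CtxL} {n x₁ : ℕ} {A₁ : Ty} {x₂ : ℕ} {A₂ : Ty} {M N : Tm}
    {A : Ty} (hn : (names (bangify Δ ++ Γ₁ ++ Γ₂)).Nodup) (hne : x₁ ≠ x₂)
    (hx₁ : x₁ ∉ names (bangify Δ ++ Γ₁ ++ Γ₂)) (hx₂ : x₂ ∉ names (bangify Δ ++ Γ₁ ++ Γ₂))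
    {d₁ : TypingD cty (bangify Δ ++ Γ₁) M (bangN n (.tensor A₁ A₂))}
    {d₂ : TypingD cty ((bangify Δ ++ Γ₂) ++ [(x₁, bangN n A₁), (x₂, bangN n A₂)]) N A}
    (hd₁ : Factors I d₁) (hd₂ : Factors I d₂) : Factors I (.letPair hn hne hx₁ hx₂ d₁ d₂) := by
  intro V hV
  obtain ⟨S₁, r₁, hr₁, hf₁⟩ := hd₁ V (names_subset_left hV)
  obtain ⟨S₂, r₂, hr₂, hf₂⟩ := hd₂ (x₁ :: x₂ :: V) (names_append_pair_subset (names_subset_right hV))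
  cases hr₂.bindPair hD hne (fun h => hx₁ (names_subset_right (List.Subset.refl _) h))
    (fun h => hx₂ (names_subset_right (List.Subset.refl _) h)) with
  | mk hr' hk₁ hk₂ er =>
    obtain ⟨S, r, m, hr, hm, e⟩ := hr₁.splitDup hD hr' hn hV
    refine ⟨S, r, hr, fun b h => ?_⟩
    obtain ⟨h₁, h₂, eq⟩ := denM_letPair I hD hn hne hx₁ hx₂ d₁ d₂ b h
    obtain ⟨f, hf, ef⟩ := hf₁ b h₁
    obtain ⟨g, hg, eg⟩ := hf₂ b h₂
    refine ⟨_, .letPair n hm hf hg hk₁ hk₂, ?_⟩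
    rw [eq, ef, eg]
    exact hD.factor_let b e _ (hD.factor_bind_pair _ er g)

theorem factors {Γ : CtxL} {M : Tm} {A : Ty} (π : TypingD cty Γ M A) : Factors I π := by
  induction π with
  | swap _ ih => exact ih.swap hD
  | var hx s => exact .var hD hx s
  | cst s => exact .cst hD s
  | star => exact .star hD
  | lam0 hx _ ih => exact ih.lam_zero hD hx
  | lamS hx _ ih => exact ih.lam_succ hD hx
  | app hn _ _ ih₁ ih₂ => exact ih₁.app hD hn ih₂
  | pair hn _ _ ih₁ ih₂ => exact ih₁.pair hD hn ih₂
  | letv hn hx _ _ ih₁ ih₂ => exact ih₁.letv hD hn hx ih₂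
  | letUnit hn _ _ ih₁ ih₂ => exact ih₁.letUnit hD hn ih₂
  | letPair hn hne hx₁ hx₂ _ _ ih₁ ih₂ => exact ih₁.letPair hD hn hne hx₁ hx₂ ih₂

end Factorisation

section Casting

theorem isValue_eq_of_erase_eq {M M' : Tm} (h : erase M' = erase M) : isValue M' = isValue M := by
  induction M generalizing M' <;> cases M' <;> simp_all [erase, isValue]

theorem SubCtxD.names_eq {Γ' Γ : CtxL} (σ : SubCtxD Γ' Γ) : names Γ' = names Γ := by
  induction σ with
  | nil => rfl
  | cons x s σ ih => simpa [names] using ih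

theorem SubD.isBang {A A' : Ty} (s : SubD A' A) (h : A.IsBang) : A'.IsBang := by
  have hb : ∀ (n m : ℕ) (B B' : Ty), (m = 0 ∨ 1 ≤ n) → ¬ B.IsBang → (bangN m B).IsBang →
      (bangN n B').IsBang := fun n m B B' hn hB hm =>
    isBang_bangN B' <| hn.resolve_left fun h0 => hB (by subst h0; exact hm)
  cases s with
  | tconst n m a hn => exact hb n m (.tconst a) _ hn not_false h
  | unit n m hn => exact hb n m .unit _ hn not_false h
  | arrow n m A A' B B' hn => exact hb n m (.arrow A B') _ hn not_false h
  | tensor n m A A' B B' hn => exact hb n m (.tensor A' B') _ hn not_false h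

variable {D : LCDData}

/-- The canonical cast between the interpretations of a used or unused variable. -/
inductive SlotCast (Θ : ℕ → D.Obj) : (o' o : Option Ty) →
    D.Hom (denSlot D Θ o') (denSlot D Θ o) → Prop
  | none : SlotCast Θ none none (D.id _)
  | some {A' A : Ty} (s : SubD A' A) : SlotCast Θ (some A') (some A) (Isub D Θ s)

/-- The canonical cast between the interpretations of environments. -/
inductive SlotsCast (Θ : ℕ → D.Obj) : (S' S : List (Option Ty)) →
    D.Hom (denSlots D Θ S') (denSlots D Θ S) → Prop
  | nil : SlotsCast Θ [] [] (D.id _)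
  | cons {o' o : Option Ty} {S' S : List (Option Ty)} {t : D.Hom (denSlot D Θ o') (denSlot D Θ o)}
      {e : D.Hom (denSlots D Θ S') (denSlots D Θ S)} :
      SlotCast Θ o' o t → SlotsCast Θ S' S e → SlotsCast Θ (o' :: S') (o :: S) (t ⊠ e)

theorem Ins.isSome_eq {Θ : ℕ → D.Obj} {x : ℕ} {o o' : Option Ty} {N : List ℕ}
    {S T S' T' : List (Option Ty)} {m : D.Hom (D.tens (denSlot D Θ o) (denSlots D Θ S)) (denSlots D Θ T)}
    {m' : D.Hom (D.tens (denSlot D Θ o') (denSlots D Θ S')) (denSlots D Θ T')}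
    (h : Ins Θ x o N S T m) (h' : Ins Θ x o' N S' T' m')
    (hT : T.map Option.isSome = T'.map Option.isSome) :
    o.isSome = o'.isSome ∧ S.map Option.isSome = S'.map Option.isSome := by
  induction h generalizing S' T' with
  | here =>
    cases h' with
    | here => simpa using hT
    | there hy => exact absurd rfl hy
  | there hy _ ih =>
    cases h' with
    | here => exact absurd rfl hy
    | there _ h' =>
      simp only [List.map_cons, List.cons.injEq] at hT ⊢
      exact (ih h' hT.2).imp_right fun h => ⟨hT.1, h⟩

variable (hD : LCDLaws D) {Θ : ℕ → D.Obj}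
include hD

theorem logRel_Isub {A' A : Ty} (s : SubD A' A) : LogRel Θ A A' _ (Isub D Θ s) (D.id _) := by
  obtain ⟨t, ht⟩ := exists_Isub_refl hD Θ A'
  have h := LogRel.cast (Θ := Θ) hD s t ((logRel_self hD A' (D.id _) (D.id _)).2 rfl)
  rwa [ht, hD.id_comp, hD.id_comp] at h

theorem SlotCast.rel {o' o : Option Ty} {t : D.Hom (denSlot D Θ o') (denSlot D Θ o)}
    (h : SlotCast Θ o' o t) : SlotRel Θ _ o o' t (D.id _) := by
  cases h with
  | none => exact .none
  | @some A' A s =>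
    refine .some (logRel_Isub hD s) fun hA => ?_
    have hA' : A'.IsBang := hA.elim s.isBang id
    match A', hA' with
    | .bang B, _ => exact hD.coalg_bang _

theorem SlotsCast.rel {S' S : List (Option Ty)} {e : D.Hom (denSlots D Θ S') (denSlots D Θ S)}
    (h : SlotsCast Θ S' S e) : EnvRel Θ _ S S' e (D.id _) := by
  induction h with
  | nil => exact .nil
  | cons ht _ ih =>
    have h := EnvRel.cons (ht.rel hD) ih
    rwa [hD.tmap_id] at h

theorem BindSlot.cast {A A' : Ty} {o o' : Option Ty} {k : D.Hom (denTy D Θ A) (denSlot D Θ o)}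
    {k' : D.Hom (denTy D Θ A') (denSlot D Θ o')} (h : BindSlot Θ A o k) (h' : BindSlot Θ A' o' k')
    (s : SubD A' A) (ho : o.isSome = o'.isSome) :
    ∃ t, SlotCast Θ o' o t ∧ Isub D Θ s ▹ k = k' ▹ t := by
  cases h with
  | use =>
    cases h' with
    | use => exact ⟨_, .some s, (hD.comp_id _).trans (hD.id_comp _).symm⟩
    | drop => simp at ho
  | drop =>
    cases h' with
    | use => simp at ho
    | drop => exact ⟨_, .none, hD.coalg_unit_ext (hD.coalg_bang _) _ _⟩

theorem Unused.cast {N : List ℕ} {S S' : List (Option Ty)} {u : D.Hom D.unit (denSlots D Θ S)}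
    {c : D.Hom (denSlots D Θ S) D.unit} {u' : D.Hom D.unit (denSlots D Θ S')}
    {c' : D.Hom (denSlots D Θ S') D.unit} (h : Unused Θ N S u c) (h' : Unused Θ N S' u' c') :
    ∃ e, SlotsCast Θ S' S e ∧ u = u' ▹ e := by
  induction h generalizing S' with
  | nil =>
    cases h'
    exact ⟨_, .nil, (hD.comp_id _).symm⟩
  | cons x _ ih =>
    cases h' with
    | cons _ h' =>
      obtain ⟨e, he, rfl⟩ := ih h'
      exact ⟨_, .cons .none he, by rw [hD.comp_assoc, hD.tmap_tmap, hD.id_comp]⟩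

theorem Ins.cast {x : ℕ} {o o' : Option Ty} {N : List ℕ}
    {S T S' T' : List (Option Ty)} {m : D.Hom (D.tens (denSlot D Θ o) (denSlots D Θ S)) (denSlots D Θ T)}
    {m' : D.Hom (D.tens (denSlot D Θ o') (denSlots D Θ S')) (denSlots D Θ T')}
    (h : Ins Θ x o N S T m) (h' : Ins Θ x o' N S' T' m')
    {t : D.Hom (denSlot D Θ o') (denSlot D Θ o)} {e : D.Hom (denSlots D Θ S') (denSlots D Θ S)}
    (ht : SlotCast Θ o' o t) (he : SlotsCast Θ S' S e) :
    ∃ e', SlotsCast Θ T' T e' ∧ (t ⊠ e) ▹ m = m' ▹ e' := by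
  induction h generalizing S' T' with
  | here =>
    cases h' with
    | here =>
      cases he with
      | cons hn he =>
        cases hn
        exact ⟨_, .cons ht he, by
          rw [hD.tmap_tmap, hD.tmap_tmap, hD.comp_id, hD.id_comp, hD.lunit_natural]⟩
    | there hy => exact absurd rfl hy
  | there hy _ ih =>
    cases h' with
    | here => exact absurd rfl hy
    | there _ h' =>
      cases he with
      | cons ht' he =>
        obtain ⟨e', he', eq⟩ := ih h' he
        refine ⟨_, .cons ht' he', ?_⟩
        rw [hD.sw_natural_assoc, hD.tmap_tmap, hD.comp_assoc, hD.tmap_tmap, hD.id_comp, hD.comp_id,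
          eq]

theorem Restr.cast {N : List ℕ} {Γ' Γ : CtxL} (σ : SubCtxD Γ' Γ) {S S' : List (Option Ty)}
    {r : D.Hom (denCtx D Θ Γ) (denSlots D Θ S)} {r' : D.Hom (denCtx D Θ Γ') (denSlots D Θ S')}
    (h : Restr Θ N S Γ r) (h' : Restr Θ N S' Γ' r')
    (hS : S.map Option.isSome = S'.map Option.isSome) :
    ∃ e, SlotsCast Θ S' S e ∧ ICtx D Θ σ ▹ r = r' ▹ e := by
  induction σ generalizing S S' with
  | nil =>
    obtain ⟨h⟩ := h
    obtain ⟨h'⟩ := h'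
    obtain ⟨e, he, rfl⟩ := h.cast hD h'
    exact ⟨e, he, hD.id_comp _⟩
  | cons x s σ ih =>
    cases h with
    | cons hk hr hm _ =>
      cases h' with
      | cons hk' hr' hm' _ =>
        obtain ⟨ho, hS⟩ := hm.isSome_eq hm' hS
        obtain ⟨e, he, eq⟩ := ih hr hr' hS
        obtain ⟨t, ht, eq'⟩ := hk.cast hD hk' s ho
        obtain ⟨e', he', eq''⟩ := hm.cast hD hm' ht he
        refine ⟨e', he', ?_⟩
        rw [hD.comp_assoc, ← eq'', hD.tmap_tmap_assoc, ← eq, ← eq', ICtx, hD.tmap_tmap_assoc]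

theorem denM_cast {cty : ℕ → Ty} (I : Interp D cty) {Δ Δ' : CtxL} {M M' : Tm} {A A' : Ty}
    (π : TypingD cty Δ M A) (π' : TypingD cty Δ' M' A') (σ : SubCtxD Δ' Δ) (s : SubD A A')
    (he : erase M' = erase M) (b : Bool) (h : b = false → isValue M = true)
    (h' : b = false → isValue M' = true) :
    denM I π' b h' = ICtx D I.obj σ ▹ denM I π b h ▹ (mon D b).map (Isub D I.obj s) := by
  obtain ⟨S, r, hr, hf⟩ := factors hD π (names Δ) (List.Subset.refl _)
  obtain ⟨S', r', hr', hf'⟩ := factors hD π' (names Δ) (σ.names_eq ▸ List.Subset.refl _)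
  obtain ⟨f, hf, ef⟩ := hf b h
  obtain ⟨f', hf', ef'⟩ := hf' b h'
  rw [he] at hf'
  obtain ⟨e, hc, ec⟩ := hr.cast hD σ hr' (hf.isSome_eq.trans hf'.isSome_eq.symm)
  obtain ⟨t, ht⟩ := exists_Isub_refl hD I.obj A'
  have hrel := LiftRel.map (R' := LogRel I.obj A' A') hD (fun Y v w => LogRel.cast hD s t)
    (LiftRel.precomp hD r' (Den.fundamental hD hf hf' (hc.rel hD)))
  have := liftRel_self hD A' hrel
  rw [ht, mon_map_id hD, hD.comp_id, hD.id_comp] at this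
  rw [ef', ← this, ef, hD.comp_assoc r, hD.reassoc ec]
  simp only [hD.comp_assoc]

end Casting

/-- **Statement 15.** Let `M' = ⟨Δ'<:Δ ⊢ M : A<:A'⟩` be the canonical type cast of a
valid typing judgment `Δ ⊢ M : A` along `Δ' <: Δ` and `A <: A'` (characterized by
`Erase(M') = Erase(M)` and `Δ' ⊢ M' : A'` valid).  Then
`⟦Δ' ⊢ M' : A'⟧^c = I_{Δ',Δ} ; ⟦Δ ⊢ M : A⟧^c ; T(I_{A,A'})`, and if `M = V` is a
value then `M'` is a value and
`⟦Δ' ⊢ V' : A'⟧^v = I_{Δ',Δ} ; ⟦Δ ⊢ V : A⟧^v ; I_{A,A'}`. -/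
theorem denotation_of_type_cast
    (D : LCDData) (hD : LCDLaws D) (cty : ℕ → Ty) (I : Interp D cty)
    {Δ Δ' : CtxL} {M M' : Tm} {A A' : Ty}
    (π : TypingD cty Δ M A) (π' : TypingD cty Δ' M' A')
    (σ : SubCtxD Δ' Δ) (s : SubD A A')
    (he : erase M' = erase M) :
    denC I π' = D.comp (ICtx D I.obj σ) (D.comp (denC I π) (D.Tmap (Isub D I.obj s))) ∧
    ∀ hM : isValue M = true, ∃ hM' : isValue M' = true,
      denV I π' hM' = D.comp (ICtx D I.obj σ) (D.comp (denV I π hM) (Isub D I.obj s)) := by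
  refine ⟨denM_cast hD I π π' σ s he true (fun h => nomatch h) (fun h => nomatch h), fun hM => ?_⟩
  have hM' := (isValue_eq_of_erase_eq he).trans hM
  exact ⟨hM', denM_cast hD I π π' σ s he false (fun _ => hM) (fun _ => hM')⟩

end QLamSem
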